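/- arXiv:math/0501048 — 6 statements merged into one kernel-verified Lean document; each statement's English description precedes it below -/
import Mathlib

section
/- ℓ∞ is complemented in every Banach space containing it isomorphically as a closed subspace: if X is a Banach space and Y is a closed subspace of X which is topologically isomorphic (linearly homeomorphic) to ℓ∞, then Y is complemented in X. -/
open scoped ENNReal

/-- A uniformly bounded family of continuous linear functionals defines a continuous linear map
into `ℓ∞`. -/
theorem exists_continuousLinearMap_lp_infty {𝕜 E ι : Type*} [RCLike 𝕜] [NormedAddCommGroup E]
    [NormedSpace 𝕜 E] (g : ι → StrongDual 𝕜 E) {C : ℝ} (hC : ∀ i, ‖g i‖ ≤ C) :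
    ∃ T : E →L[𝕜] lp (fun _ : ι => 𝕜) ∞, ∀ x i, T x i = g i x := by
  have bound (x : E) (i : ι) : ‖g i x‖ ≤ |C| * ‖x‖ :=
    (g i).le_of_opNorm_le ((hC i).trans (le_abs_self C)) x
  let T : E →ₗ[𝕜] lp (fun _ : ι => 𝕜) ∞ :=
    { toFun x := ⟨fun i => g i x, memℓp_infty ⟨|C| * ‖x‖, by
        rintro _ ⟨i, rfl⟩
        exact bound x i⟩⟩
      map_add' x y := by
        ext i
        exact map_add (g i) x y
      map_smul' c x := by
        ext i
        exact map_smul (g i) c x }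
  exact ⟨T.mkContinuous |C| fun x => lp.norm_le_of_forall_le (by positivity) (bound x),
    fun _ _ => rfl⟩

/-- `ℓ∞` is injective: continuous linear maps into it extend from subspaces. -/
theorem exists_extension_lp_infty {𝕜 E ι : Type*} [RCLike 𝕜] [NormedAddCommGroup E]
    [NormedSpace 𝕜 E] (p : Submodule 𝕜 E) (f : p →L[𝕜] lp (fun _ : ι => 𝕜) ∞) :
    ∃ T : E →L[𝕜] lp (fun _ : ι => 𝕜) ∞, ∀ x : p, T x = f x := by
  choose g hg hg_norm using fun i : ι =>
    exists_extension_norm_eq p ((lp.evalCLM 𝕜 (fun _ : ι => 𝕜) ∞ i).comp f)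
  have hC (i : ι) : ‖g i‖ ≤ ‖f‖ := by
    rw [hg_norm]
    exact ContinuousLinearMap.opNorm_le_bound _ (norm_nonneg f) fun x =>
      (lp.norm_apply_le_norm ENNReal.top_ne_zero (f x) i).trans (f.le_opNorm x)
  obtain ⟨T, hT⟩ := exists_continuousLinearMap_lp_infty g hC
  refine ⟨T, fun x => ?_⟩
  ext i
  rw [hT, hg]
  rfl

/-- `ℓ∞` is complemented in every Banach space containing it isomorphically as a closed
subspace: if `Y` is a closed subspace of a Banach space `X` which is topologically
isomorphic to `ℓ∞`, then `Y` is complemented in `X`. -/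
theorem linfty_complemented_in_any_superspace
    {X : Type*} [NormedAddCommGroup X] [NormedSpace ℝ X] [CompleteSpace X]
    (Y : Submodule ℝ X) (hY : IsClosed (Y : Set X))
    (hiso : Nonempty (Y ≃L[ℝ] lp (fun _ : ℕ => ℝ) ∞)) :
    Y.ClosedComplemented := by
  obtain ⟨e⟩ := hiso
  obtain ⟨T, hT⟩ := exists_extension_lp_infty Y (e : Y →L[ℝ] lp (fun _ : ℕ => ℝ) ∞)
  exact ⟨(e.symm : lp (fun _ : ℕ => ℝ) ∞ →L[ℝ] Y).comp T, fun y => by simp [hT]⟩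
end

section
/- Murray's theorem: for every real p with 1 < p < ∞ and p ≠ 2, the space ℓp contains a closed subspace which is not complemented, i.e., a closed subspace onto which there is no continuous linear projection. -/
open scoped ENNReal

/-- Hadamard matrices of every order `2 ^ n` exist (Sylvester). -/
theorem exists_isHadamard_two_pow (n : ℕ) :
    ∃ H : Matrix (Fin (2 ^ n)) (Fin (2 ^ n)) ℝ, H.IsHadamard := by
  induction n with
  | zero =>
    refine ⟨1, ⟨fun i j => ?_, ?_, ?_⟩⟩
    · rw [show i = j from Subsingleton.elim (α := Fin 1) i j, Matrix.one_apply_eq]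
      exact one_mem _
    · simp
    · simp
  | succ n ih =>
    obtain ⟨H, hH⟩ := ih
    have h2 : (!![1, 1; 1, -1] : Matrix (Fin 2) (Fin 2) ℝ).IsHadamard := by
      refine ⟨fun i j => ?_, ?_, ?_⟩
      · fin_cases i <;> fin_cases j <;> simp [Unitary.mem_iff]
      · ext i j
        fin_cases i <;> fin_cases j <;> norm_num [Matrix.mul_apply, Fin.sum_univ_two]
      · ext i j
        fin_cases i <;> fin_cases j <;> norm_num [Matrix.mul_apply, Fin.sum_univ_two]
    let e : Fin (2 ^ n) × Fin 2 ≃ Fin (2 ^ (n + 1)) :=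
      finProdFinEquiv.trans (finCongr (pow_succ 2 n).symm)
    exact ⟨_, (hH.kronecker h2).reindex e e⟩

theorem Matrix.IsHadamard.abs_apply {ι : Type*} [Fintype ι] [DecidableEq ι]
    {H : Matrix ι ι ℝ} (hH : H.IsHadamard) (i j : ι) : |H i j| = 1 := by
  have h := (Unitary.mem_iff.1 (hH.apply_mem i j)).1
  rw [star_trivial] at h
  rcases mul_self_eq_one_iff.1 h with h | h <;> simp [h]

theorem Matrix.IsHadamard.sum_mul_apply {ι : Type*} [Fintype ι] [DecidableEq ι]
    {H : Matrix ι ι ℝ} (hH : H.IsHadamard) (j k : ι) :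
    ∑ i, H i j * H i k = if j = k then (Fintype.card ι : ℝ) else 0 := by
  have h := congr_fun (congr_fun hH.conjTranspose_mul j) k
  simpa [Matrix.mul_apply, Matrix.one_apply] using h

section lpBounds

variable {α ι : Type*} [Fintype ι] {p : ℝ≥0∞}

/-- The `ℓp` norm of a sum of `#ι` signed distinct unit vectors. -/
theorem lp.norm_sum_sign_smul_single [DecidableEq α] (hp0 : 0 < p.toReal) {k : ι → α}
    (hk : Function.Injective k) (a : ι → ℝ) (ha : ∀ i, |a i| = 1) :
    ‖∑ i, a i • lp.single (E := fun _ : α => ℝ) p (k i) (1 : ℝ)‖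
      = (Fintype.card ι : ℝ) ^ (1 / p.toReal) := by
  let g : α → ℝ := Function.extend k a 0
  have hg : ∀ i, g (k i) = a i := fun i => hk.extend_apply a 0 i
  have h := lp.norm_sum_single (E := fun _ : α => ℝ) hp0 g (Finset.univ.map ⟨k, hk⟩)
  simp only [Finset.sum_map, Function.Embedding.coeFn_mk, hg, Real.norm_eq_abs, ha,
    Real.one_rpow, Finset.sum_const, Finset.card_univ, nsmul_eq_mul, mul_one] at h
  have h' : ∀ i, a i • lp.single (E := fun _ : α => ℝ) p (k i) (1 : ℝ)
      = lp.single (E := fun _ : α => ℝ) p (k i) (a i) := fun i => by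
    rw [← lp.single_smul]; simp
  simp only [h']
  rw [← h, ← Real.rpow_mul (lp.norm_nonneg' _), mul_one_div_cancel hp0.ne', Real.rpow_one]

theorem lp.sum_abs_apply_le (hp1 : 1 ≤ p.toReal) {k : ι → α}
    (hk : Function.Injective k) (f : lp (fun _ : α => ℝ) p) :
    ∑ i, |f (k i)| ≤ (Fintype.card ι : ℝ) ^ (1 - 1 / p.toReal) * ‖f‖ := by
  have hp0 : 0 < p.toReal := one_pos.trans_le hp1
  have h1 := Real.rpow_sum_le_const_mul_sum_rpow Finset.univ (fun i => f (k i)) hp1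
  have h2 := lp.sum_rpow_le_norm_rpow hp0 f (Finset.univ.map ⟨k, hk⟩)
  simp only [Finset.sum_map, Function.Embedding.coeFn_mk, Real.norm_eq_abs] at h2
  rw [← Real.rpow_le_rpow_iff (Finset.sum_nonneg fun i _ => abs_nonneg _)
      (mul_nonneg (by positivity) (lp.norm_nonneg' _)) hp0,
    Real.mul_rpow (by positivity) (lp.norm_nonneg' _), ← Real.rpow_mul (by positivity), sub_mul,
    one_mul, one_div_mul_cancel hp0.ne']
  exact h1.trans (mul_le_mul_of_nonneg_left h2 (by positivity))

variable [DecidableEq α] [Fact (1 ≤ p)]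

theorem lp.sum_sign_mul_apply_single_le_of_domain (hp0 : 0 < p.toReal)
    (P : lp (fun _ : α => ℝ) p →L[ℝ] lp (fun _ : α => ℝ) p) {k : ι → α} (l : ι → α)
    (hk : Function.Injective k) (a : ι → ι → ℝ) (ha : ∀ i j, |a i j| = 1) :
    ∑ i, ∑ j, a i j * P (lp.single p (k j) (1 : ℝ)) (l i)
      ≤ Fintype.card ι * (‖P‖ * (Fintype.card ι : ℝ) ^ (1 / p.toReal)) := by
  have hpne : p ≠ 0 := fun h => by simp [h] at hp0
  have hrow : ∀ i, ∑ j, a i j * P (lp.single p (k j) (1 : ℝ)) (l i)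
      ≤ ‖P‖ * (Fintype.card ι : ℝ) ^ (1 / p.toReal) := fun i => by
    have h : ∑ j, a i j * P (lp.single p (k j) (1 : ℝ)) (l i)
        = P (∑ j, a i j • lp.single p (k j) (1 : ℝ)) (l i) := by
      rw [map_sum, lp.coeFn_sum, Finset.sum_apply]
      simp
    rw [h, ← lp.norm_sum_sign_smul_single hp0 hk (a i) (ha i)]
    exact (le_abs_self _).trans ((lp.norm_apply_le_norm hpne _ _).trans (P.le_opNorm _))
  exact (Finset.sum_le_sum fun i _ => hrow i).trans (by simp)

theorem lp.sum_sign_mul_apply_single_le_of_range (hp1 : 1 ≤ p.toReal)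
    (P : lp (fun _ : α => ℝ) p →L[ℝ] lp (fun _ : α => ℝ) p) (k : ι → α) {l : ι → α}
    (hl : Function.Injective l) (a : ι → ι → ℝ) (ha : ∀ i j, |a i j| = 1) :
    ∑ i, ∑ j, a i j * P (lp.single p (k j) (1 : ℝ)) (l i)
      ≤ Fintype.card ι * (‖P‖ * (Fintype.card ι : ℝ) ^ (1 - 1 / p.toReal)) := by
  have hpne : 0 < p := one_pos.trans_le Fact.out
  rw [Finset.sum_comm]
  have hcol : ∀ j, ∑ i, a i j * P (lp.single p (k j) (1 : ℝ)) (l i)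
      ≤ ‖P‖ * (Fintype.card ι : ℝ) ^ (1 - 1 / p.toReal) := fun j => calc
    _ ≤ ∑ i, |P (lp.single p (k j) (1 : ℝ)) (l i)| := Finset.sum_le_sum fun i _ =>
        (le_abs_self _).trans (by rw [abs_mul, ha, one_mul])
    _ ≤ _ := lp.sum_abs_apply_le hp1 hl _
    _ ≤ (Fintype.card ι : ℝ) ^ (1 - 1 / p.toReal) * ‖P‖ := by
      refine mul_le_mul_of_nonneg_left ?_ (by positivity)
      simpa [lp.norm_single hpne] using P.le_opNorm (lp.single p (k j) (1 : ℝ))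
    _ = _ := mul_comm _ _
  exact (Finset.sum_le_sum fun j _ => hcol j).trans (by simp)

end lpBounds

section HadamardGraph

variable {α ι : Type*} [DecidableEq α] [Fintype ι] [DecidableEq ι] {p : ℝ≥0∞} [Fact (1 ≤ p)]

/-- The trace identity for an operator `P` whose range consists of `f` with
`√N f(y i) = ∑ j, H i j f(x j)`, and which fixes the corresponding graph vectors. -/
theorem Matrix.IsHadamard.sqrt_card_mul_card_eq {H : Matrix ι ι ℝ} (hH : H.IsHadamard)
    {x y : ι → α} (hxy : ∀ i j, x i ≠ y j)
    (P : lp (fun _ : α => ℝ) p →L[ℝ] lp (fun _ : α => ℝ) p)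
    (hrange : ∀ f i, √(Fintype.card ι : ℝ) * P f (y i) = ∑ j, H i j * P f (x j))
    (hfix : ∀ j,
      P (√(Fintype.card ι : ℝ) • lp.single p (x j) (1 : ℝ)
          + ∑ i, H i j • lp.single p (y i) (1 : ℝ))
        = √(Fintype.card ι : ℝ) • lp.single p (x j) (1 : ℝ)
          + ∑ i, H i j • lp.single p (y i) (1 : ℝ)) :
    √(Fintype.card ι : ℝ) * Fintype.card ι
      = ∑ i, ∑ j, H i j * P (lp.single p (x j) (1 : ℝ)) (y i)
        + ∑ j, ∑ i, H i j * P (lp.single p (y i) (1 : ℝ)) (x j) := by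
  set s := √(Fintype.card ι : ℝ) with hs
  have hss : s * s = Fintype.card ι := Real.mul_self_sqrt (Nat.cast_nonneg _)
  have hdiag : ∀ j, s = s * P (lp.single p (x j) (1 : ℝ)) (x j)
      + ∑ i, H i j * P (lp.single p (y i) (1 : ℝ)) (x j) := fun j => by
    have h := congr_arg (fun f : lp (fun _ : α => ℝ) p => f (x j)) (hfix j)
    simp only [map_add, map_smul, map_sum, lp.coeFn_add, lp.coeFn_smul, lp.coeFn_sum,
      Pi.add_apply, Pi.smul_apply, Finset.sum_apply, smul_eq_mul, lp.single_apply_self,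
      lp.single_apply] at h
    rw [h]
    simp [hxy]
  have hgraph : ∀ j, s * P (lp.single p (x j) (1 : ℝ)) (x j)
      = ∑ i, H i j * P (lp.single p (x j) (1 : ℝ)) (y i) := fun j => by
    have hspos : s ≠ 0 := by
      have : Nonempty ι := ⟨j⟩
      exact (Real.sqrt_pos.2 (Nat.cast_pos.2 Fintype.card_pos)).ne'
    apply mul_left_cancel₀ hspos
    calc s * (s * P (lp.single p (x j) (1 : ℝ)) (x j))
        = ∑ k, (∑ i, H i j * H i k) * P (lp.single p (x j) (1 : ℝ)) (x k) := by
          simp [hH.sum_mul_apply, ← mul_assoc, hss]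
      _ = ∑ i, H i j * ∑ k, H i k * P (lp.single p (x j) (1 : ℝ)) (x k) := by
          simp only [Finset.sum_mul, Finset.mul_sum, mul_assoc]
          exact Finset.sum_comm
      _ = s * ∑ i, H i j * P (lp.single p (x j) (1 : ℝ)) (y i) := by
          simp only [← hrange, Finset.mul_sum]
          exact Finset.sum_congr rfl fun i _ => by ring
  have hsum : s * Fintype.card ι = ∑ _j : ι, s := by simp [mul_comm]
  rw [hsum, Finset.sum_comm, ← Finset.sum_add_distrib]
  exact Finset.sum_congr rfl fun j _ => by rw [← hgraph]; exact hdiag j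

/-- Projections onto the graph of a normalised Hadamard matrix of order `N` in `ℓp` have norm at
least `N ^ |1 / 2 - 1 / p| / 2`. -/
theorem Matrix.IsHadamard.card_rpow_le [Nonempty ι] (hp1 : 1 ≤ p.toReal)
    {H : Matrix ι ι ℝ} (hH : H.IsHadamard)
    {x y : ι → α} (hx : Function.Injective x) (hy : Function.Injective y)
    (hxy : ∀ i j, x i ≠ y j)
    (P : lp (fun _ : α => ℝ) p →L[ℝ] lp (fun _ : α => ℝ) p)
    (hrange : ∀ f i, √(Fintype.card ι : ℝ) * P f (y i) = ∑ j, H i j * P f (x j))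
    (hfix : ∀ j,
      P (√(Fintype.card ι : ℝ) • lp.single p (x j) (1 : ℝ)
          + ∑ i, H i j • lp.single p (y i) (1 : ℝ))
        = √(Fintype.card ι : ℝ) • lp.single p (x j) (1 : ℝ)
          + ∑ i, H i j • lp.single p (y i) (1 : ℝ)) :
    (Fintype.card ι : ℝ) ^ |1 / 2 - 1 / p.toReal| ≤ 2 * ‖P‖ := by
  have hp0 : 0 < p.toReal := one_pos.trans_le hp1
  have hN : (0 : ℝ) < Fintype.card ι := Nat.cast_pos.2 Fintype.card_pos
  have htrace := hH.sqrt_card_mul_card_eq hxy P hrange hfix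
  have key : ∀ t : ℝ, √(Fintype.card ι : ℝ) * Fintype.card ι
      ≤ 2 * (Fintype.card ι * (‖P‖ * (Fintype.card ι : ℝ) ^ t)) →
      (Fintype.card ι : ℝ) ^ (1 / 2 - t) ≤ 2 * ‖P‖ := fun t ht => by
    rw [Real.rpow_sub hN, ← Real.sqrt_eq_rpow, div_le_iff₀ (Real.rpow_pos_of_pos hN t)]
    refine le_of_mul_le_mul_right ?_ hN
    linarith
  rcases abs_choice (1 / 2 - 1 / p.toReal) with h | h
  · rw [h]
    apply key
    have h1 := lp.sum_sign_mul_apply_single_le_of_domain hp0 P y hx H hH.abs_apply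
    have h2 := lp.sum_sign_mul_apply_single_le_of_domain hp0 P x hy (fun j i => H i j)
      fun j i => hH.abs_apply i j
    linarith
  · rw [h, show -(1 / 2 - 1 / p.toReal) = 1 / 2 - (1 - 1 / p.toReal) by ring]
    apply key
    have h1 := lp.sum_sign_mul_apply_single_le_of_range hp1 P x hy H hH.abs_apply
    have h2 := lp.sum_sign_mul_apply_single_le_of_range hp1 P y hx (fun j i => H i j)
      fun j i => hH.abs_apply i j
    linarith

end HadamardGraph

/-- Murray's theorem: for `1 < p < ∞`, `p ≠ 2`, the space `ℓp` contains a closed subspace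
which is not complemented: there is no continuous linear projection onto it. -/
theorem murray_lp_has_noncomplemented_subspace
    (p : ℝ≥0∞) [Fact (1 ≤ p)] (hp1 : 1 < p) (hp2 : p ≠ ∞) (hp3 : p ≠ 2) :
    ∃ Y : Submodule ℝ (lp (fun _ : ℕ => ℝ) p),
      IsClosed (Y : Set (lp (fun _ : ℕ => ℝ) p)) ∧ ¬ Y.ClosedComplemented := by
  choose H hH using exists_isHadamard_two_pow
  let φ : (Σ n : ℕ, Fin (2 ^ n) ⊕ Fin (2 ^ n)) → ℕ := Encodable.encode
  have hφ : Function.Injective φ := Encodable.encode_injective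
  let x : ∀ n, Fin (2 ^ n) → ℕ := fun n i => φ ⟨n, Sum.inl i⟩
  let y : ∀ n, Fin (2 ^ n) → ℕ := fun n i => φ ⟨n, Sum.inr i⟩
  have hxx : ∀ {m n i j}, m ≠ n → x m i ≠ x n j := fun hmn h => hmn (congr_arg Sigma.fst (hφ h))
  have hyy : ∀ {m n i j}, m ≠ n → y m i ≠ y n j := fun hmn h => hmn (congr_arg Sigma.fst (hφ h))
  have hx : ∀ n, Function.Injective (x n) := fun n i j h => by simpa using hφ h
  have hy : ∀ n, Function.Injective (y n) := fun n i j h => by simpa using hφ h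
  have hxy : ∀ {m n i j}, x m i ≠ y n j := fun {m n i j} h => by
    have h' := hφ h
    obtain rfl : m = n := congr_arg Sigma.fst h'
    simp at h'
  let ev : ℕ → lp (fun _ : ℕ => ℝ) p →L[ℝ] ℝ := lp.evalCLM ℝ (fun _ : ℕ => ℝ) p
  have hev : ∀ k f, ev k f = f k := fun _ _ => rfl
  let L : ∀ n, Fin (2 ^ n) → lp (fun _ : ℕ => ℝ) p →L[ℝ] ℝ := fun n i =>
    √(Fintype.card (Fin (2 ^ n)) : ℝ) • ev (y n i) - ∑ j, H n i j • ev (x n j)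
  have hL : ∀ n i f, L n i f
      = √(Fintype.card (Fin (2 ^ n)) : ℝ) * f (y n i) - ∑ j, H n i j * f (x n j) :=
    fun n i f => by simp [L, hev]
  let Y : Submodule ℝ (lp (fun _ : ℕ => ℝ) p) := ⨅ n, ⨅ i, (L n i).ker
  have hY : ∀ f, f ∈ Y ↔ ∀ n i, L n i f = 0 := fun f => by simp [Y, Submodule.mem_iInf]
  refine ⟨Y, ?_, ?_⟩
  · simp only [Y, Submodule.coe_iInf]
    exact isClosed_iInter fun n => isClosed_iInter fun i => (L n i).isClosed_ker
  rintro ⟨Q, hQ⟩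
  let P : lp (fun _ : ℕ => ℝ) p →L[ℝ] lp (fun _ : ℕ => ℝ) p := Y.subtypeL.comp Q
  have hPY : ∀ f ∈ Y, P f = f := fun f hf => congr_arg Subtype.val (hQ ⟨f, hf⟩)
  have hp1' : 1 < p.toReal := by
    simpa using (ENNReal.toReal_lt_toReal ENNReal.one_ne_top hp2).2 hp1
  have hp3' : p.toReal ≠ 2 := fun h => hp3 <| by
    rw [← ENNReal.ofReal_toReal hp2, h]; simp
  have hδ : 0 < |1 / 2 - 1 / p.toReal| := by
    rw [abs_pos, sub_ne_zero]
    intro h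
    field_simp at h
    exact hp3' h
  have hbound : ∀ n : ℕ, ((2 : ℝ) ^ n) ^ |1 / 2 - 1 / p.toReal| ≤ 2 * ‖P‖ := fun n => by
    have h := (hH n).card_rpow_le hp1'.le (hx n) (hy n) (fun _ _ => hxy) P
      (fun f i => ?_) (fun j => hPY _ ((hY _).2 fun m i => ?_))
    · simpa using h
    · have := (hY _).1 (Q f).2 n i
      rw [hL, sub_eq_zero] at this
      exact this
    · rw [hL, sub_eq_zero]
      simp only [lp.coeFn_add, lp.coeFn_smul, lp.coeFn_sum, Pi.add_apply, Pi.smul_apply,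
        Finset.sum_apply, lp.single_apply]
      rcases eq_or_ne m n with rfl | hmn
      · simp [Pi.single_apply, (hx m).eq_iff, (hy m).eq_iff, hxy, hxy.symm, mul_comm]
      · simp [hxx hmn, hyy hmn, hxy, hxy.symm]
  have htend : Filter.Tendsto (fun n : ℕ => ((2 : ℝ) ^ n) ^ |1 / 2 - 1 / p.toReal|)
      Filter.atTop Filter.atTop :=
    (tendsto_rpow_atTop hδ).comp (tendsto_pow_atTop_atTop_of_one_lt one_lt_two)
  obtain ⟨n, hn⟩ := (htend.eventually_gt_atTop (2 * ‖P‖)).exists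
  exact (hbound n).not_gt hn
end

section
/- Lindenstrauss–Tzafriri theorem: if X is an infinite-dimensional Banach space in which every closed subspace is complemented, then X is topologically isomorphic to a Hilbert space; equivalently, every infinite-dimensional Banach space which is not isomorphic to a Hilbert space contains a closed non-complemented subspace. -/
open MeasureTheory ProbabilityTheory Filter Topology Module
open scoped RealInnerProductSpace NNReal ENNReal

theorem measure_pi_fin_absolutelyContinuous {α : Type*} [MeasurableSpace α] {μ ν : Measure α}
    [SigmaFinite μ] [SigmaFinite ν] (h : μ ≪ ν) (n : ℕ) :
    Measure.pi (fun _ : Fin n => μ) ≪ Measure.pi (fun _ : Fin n => ν) := by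
  induction n with
  | zero =>
    rw [Measure.pi_of_empty, Measure.pi_of_empty]
  | succ n ih =>
    have hμ := (measurePreserving_piFinSuccAbove (fun _ : Fin (n + 1) => μ) 0).symm
    have hν := (measurePreserving_piFinSuccAbove (fun _ : Fin (n + 1) => ν) 0).symm
    rw [← hμ.map_eq, ← hν.map_eq]
    exact (h.prod ih).map hμ.measurable

section

variable {E : Type*} [NormedAddCommGroup E] [InnerProductSpace ℝ E]

/-- The increment of `f` along the first step, of angle `δ`, of the rotation in `E × E`. -/
noncomputable def rotationIncrement (f : E → ℝ) (δ : ℝ) (p : E × E) : ℝ :=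
  f (Real.cos δ • p.1 + Real.sin δ • p.2) - f p.1

theorem abs_rotationIncrement_le {f : E → ℝ} (hf : LipschitzWith 1 f) {δ : ℝ} (hδ : 0 ≤ δ)
    (p : E × E) : |rotationIncrement f δ p| ≤ δ * (‖p.1‖ + ‖p.2‖) := by
  have h := hf.dist_le_mul (Real.cos δ • p.1 + Real.sin δ • p.2) p.1
  rw [NNReal.coe_one, one_mul, Real.dist_eq, dist_eq_norm] at h
  refine h.trans ?_
  have h1 : |Real.cos δ - 1| ≤ δ := by
    have := Real.abs_cos_sub_cos_le δ 0
    simpa [abs_of_nonneg hδ] using this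
  have h2 : |Real.sin δ| ≤ δ := by
    simpa [abs_of_nonneg hδ] using Real.abs_sin_le_abs (x := δ)
  calc ‖Real.cos δ • p.1 + Real.sin δ • p.2 - p.1‖
      = ‖(Real.cos δ - 1) • p.1 + Real.sin δ • p.2‖ := by congr 1; module
    _ ≤ |Real.cos δ - 1| * ‖p.1‖ + |Real.sin δ| * ‖p.2‖ := by
        refine (norm_add_le _ _).trans ?_
        rw [norm_smul, norm_smul, Real.norm_eq_abs, Real.norm_eq_abs]
    _ ≤ δ * ‖p.1‖ + δ * ‖p.2‖ := by gcongr
    _ = _ := by ring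

theorem continuous_rotationIncrement {f : E → ℝ} (hf : LipschitzWith 1 f) (δ : ℝ) :
    Continuous (rotationIncrement f δ) := by
  have := hf.continuous
  unfold rotationIncrement
  fun_prop

theorem tendsto_rotationIncrement_div {f : E → ℝ} {p : E × E} (hp : DifferentiableAt ℝ f p.1) :
    Tendsto (fun N : ℕ => ((N + 1 : ℕ) : ℝ) * rotationIncrement f (Real.pi / 2 / (N + 1 : ℕ)) p)
      atTop (𝓝 (Real.pi / 2 * fderiv ℝ f p.1 p.2)) := by
  have hd : HasDerivAt (fun t : ℝ => f (Real.cos t • p.1 + Real.sin t • p.2))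
      (fderiv ℝ f p.1 p.2) 0 := by
    have h1 : HasDerivAt (fun t : ℝ => Real.cos t • p.1 + Real.sin t • p.2) p.2 0 := by
      have := ((Real.hasDerivAt_cos 0).smul_const p.1).add
        ((Real.hasDerivAt_sin 0).smul_const p.2)
      simpa [Pi.add_def] using this
    have h2 : HasFDerivAt f (fderiv ℝ f p.1) (Real.cos 0 • p.1 + Real.sin 0 • p.2) := by
      simpa using hp.hasFDerivAt
    exact h2.comp_hasDerivAt 0 h1
  have hlim : Tendsto (fun N : ℕ => Real.pi / 2 / ((N + 1 : ℕ) : ℝ)) atTop (𝓝[≠] 0) := by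
    refine tendsto_nhdsWithin_iff.2 ⟨?_, Eventually.of_forall fun N => ?_⟩
    · exact (tendsto_const_div_atTop_nhds_zero_nat _).comp (tendsto_add_atTop_nat 1)
    · have : 0 < Real.pi / 2 / ((N + 1 : ℕ) : ℝ) := by positivity
      exact this.ne'
  have h := ((hasDerivAt_iff_tendsto_slope.1 hd).comp hlim).const_mul (Real.pi / 2)
  refine h.congr fun N => ?_
  simp only [Function.comp, slope_def_field, rotationIncrement]
  have := Real.pi_pos.ne'
  have : ((N + 1 : ℕ) : ℝ) ≠ 0 := by positivity
  simp
  field_simp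

variable [FiniteDimensional ℝ E] [MeasurableSpace E] [BorelSpace E]

variable (E) in
theorem stdGaussian_absolutelyContinuous : stdGaussian E ≪ volume := by
  have h : stdGaussian (EuclideanSpace ℝ (Fin (Module.finrank ℝ E))) ≪ volume := by
    rw [← map_pi_eq_stdGaussian, ← (PiLp.volume_preserving_toLp _).map_eq]
    exact (measure_pi_fin_absolutelyContinuous
      (gaussianReal_absolutelyContinuous 0 one_ne_zero) _).map (by fun_prop)
  have e := (stdOrthonormalBasis ℝ E).repr.symm
  rw [← stdGaussian_map e, ← e.measurePreserving.map_eq]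
  exact h.map e.continuous.measurable

theorem stdGaussian_map_of_norm_adjoint {F : Type*} [NormedAddCommGroup F] [InnerProductSpace ℝ F]
    [FiniteDimensional ℝ F] [MeasurableSpace F] [BorelSpace F] (A : E →L[ℝ] F) (B : F → E)
    (hAB : ∀ x y, ⟪A x, y⟫ = ⟪x, B y⟫) (hB : ∀ y, ‖B y‖ = ‖y‖) :
    (stdGaussian E).map A = stdGaussian F := by
  apply Measure.ext_of_charFun
  ext t
  rw [charFun_stdGaussian, charFun_apply, integral_map (by fun_prop) (by fun_prop), ← hB t,
    ← charFun_stdGaussian, charFun_apply]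
  simp_rw [hAB]

theorem integral_sq_strongDual_stdGaussian (L : StrongDual ℝ E) :
    ∫ x, (L x) ^ 2 ∂(stdGaussian E) = ‖L‖ ^ 2 := by
  rw [← variance_dual_stdGaussian, variance_eq_integral (by fun_prop)]
  simp

theorem integrable_sq_norm_add_norm_stdGaussian :
    Integrable (fun p : E × E => (‖p.1‖ + ‖p.2‖) ^ 2) ((stdGaussian E).prod (stdGaussian E)) := by
  have h : MemLp (fun x : E => ‖x‖) 2 (stdGaussian E) := (IsGaussian.memLp_two_id).norm
  have h1 : MemLp (fun p : E × E => ‖p.1‖) 2 ((stdGaussian E).prod (stdGaussian E)) :=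
    h.comp_measurePreserving measurePreserving_fst
  have h2 : MemLp (fun p : E × E => ‖p.2‖) 2 ((stdGaussian E).prod (stdGaussian E)) :=
    h.comp_measurePreserving measurePreserving_snd
  exact (h1.add h2).integrable_sq

theorem LipschitzWith.memLp_two_stdGaussian {f : E → ℝ} (hf : LipschitzWith 1 f) :
    MemLp f 2 (stdGaussian E) := by
  have h : MemLp (fun x : E => ‖x‖ + ‖f 0‖) 2 (stdGaussian E) :=
    (IsGaussian.memLp_two_id).norm.add (memLp_const _)
  refine h.of_le hf.continuous.aestronglyMeasurable (ae_of_all _ fun x => ?_)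
  have := hf.dist_le_mul x 0
  rw [dist_eq_norm, dist_zero_right, NNReal.coe_one, one_mul] at this
  calc ‖f x‖ = ‖(f x - f 0) + f 0‖ := by simp
    _ ≤ ‖x‖ + ‖f 0‖ := (norm_add_le _ _).trans (by gcongr)
    _ ≤ _ := le_abs_self _

theorem integrable_sq_rotationIncrement {f : E → ℝ} (hf : LipschitzWith 1 f) {δ : ℝ}
    (hδ : 0 ≤ δ) : Integrable (fun p => rotationIncrement f δ p ^ 2)
      ((stdGaussian E).prod (stdGaussian E)) := by
  refine (integrable_sq_norm_add_norm_stdGaussian.const_mul (δ ^ 2)).mono'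
    ((continuous_rotationIncrement hf δ).pow 2).aestronglyMeasurable (ae_of_all _ fun p => ?_)
  rw [Real.norm_eq_abs, abs_pow, ← mul_pow]
  gcongr
  exact abs_rotationIncrement_le hf hδ p

theorem integral_sq_sub_le_mul_integral_rotationIncrement {f : E → ℝ} (hf : LipschitzWith 1 f)
    {N : ℕ} (hN : 0 < N) :
    ∫ p : E × E, (f p.2 - f p.1) ^ 2 ∂((stdGaussian E).prod (stdGaussian E)) ≤
      (N : ℝ) ^ 2 * ∫ p, rotationIncrement f (Real.pi / 2 / N) p ^ 2
        ∂((stdGaussian E).prod (stdGaussian E)) := by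
  set ν := (stdGaussian E).prod (stdGaussian E)
  set δ : ℝ := Real.pi / 2 / N with hδdef
  have hδ : 0 ≤ δ := by positivity
  have hNr : (N : ℝ) ≠ 0 := by positivity
  have hrot (θ : ℝ) : MeasurePreserving (ContinuousLinearMap.rotation (E := E) θ) ν ν :=
    ⟨by fun_prop, IsGaussian.map_rotation_eq_self (by simp) θ⟩
  have hint (j : ℕ) : Integrable
      (fun p => rotationIncrement f δ (ContinuousLinearMap.rotation (j * δ) p) ^ 2) ν :=
    (hrot _).integrable_comp_of_integrable (integrable_sq_rotationIncrement hf hδ)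
  have heq (j : ℕ) : ∫ p, rotationIncrement f δ (ContinuousLinearMap.rotation (j * δ) p) ^ 2 ∂ν =
      ∫ p, rotationIncrement f δ p ^ 2 ∂ν := by
    conv_rhs => rw [← (hrot (j * δ)).map_eq]
    exact (integral_map (f := fun p => rotationIncrement f δ p ^ 2) (by fun_prop)
      ((continuous_rotationIncrement hf δ).pow 2).aestronglyMeasurable).symm
  have htel (p : E × E) : f p.2 - f p.1 = ∑ j ∈ Finset.range N,
      rotationIncrement f δ (ContinuousLinearMap.rotation (j * δ) p) := by
    have : ∀ j : ℕ, rotationIncrement f δ (ContinuousLinearMap.rotation (j * δ) p) =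
        f (Real.cos ((j + 1 : ℕ) * δ) • p.1 + Real.sin ((j + 1 : ℕ) * δ) • p.2) -
        f (Real.cos (j * δ) • p.1 + Real.sin (j * δ) • p.2) := by
      intro j
      simp only [rotationIncrement, ContinuousLinearMap.rotation_apply]
      congr 2
      rw [show ((j + 1 : ℕ) : ℝ) * δ = j * δ + δ by push_cast; ring, Real.cos_add, Real.sin_add]
      module
    rw [Finset.sum_congr rfl fun j _ => this j, Finset.sum_range_sub
      (fun j : ℕ => f (Real.cos (j * δ) • p.1 + Real.sin (j * δ) • p.2))]
    rw [show (N : ℝ) * δ = Real.pi / 2 by rw [hδdef]; field_simp]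
    simp
  calc ∫ p : E × E, (f p.2 - f p.1) ^ 2 ∂ν
      ≤ ∫ p, N * ∑ j ∈ Finset.range N,
          rotationIncrement f δ (ContinuousLinearMap.rotation (j * δ) p) ^ 2 ∂ν := by
        refine integral_mono_of_nonneg (ae_of_all _ fun p => sq_nonneg _)
          ((integrable_finsetSum _ fun j _ => hint j).const_mul _) (ae_of_all _ fun p => ?_)
        have := sq_sum_le_card_mul_sum_sq (s := Finset.range N)
          (f := fun j : ℕ => rotationIncrement f δ (ContinuousLinearMap.rotation (j * δ) p))
        simp only
        rw [htel p]
        simpa using this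
    _ = (N : ℝ) ^ 2 * ∫ p, rotationIncrement f δ p ^ 2 ∂ν := by
        rw [integral_const_mul, integral_finsetSum _ fun j _ => hint j]
        simp_rw [heq]
        simp
        ring

theorem integral_sq_sub_le_of_lipschitzWith {f : E → ℝ} (hf : LipschitzWith 1 f) :
    ∫ p : E × E, (f p.2 - f p.1) ^ 2
      ∂((stdGaussian E).prod (stdGaussian E)) ≤ (Real.pi / 2) ^ 2 := by
  set μ := stdGaussian E
  have hdiff : ∀ᵐ p ∂(μ.prod μ), DifferentiableAt ℝ f p.1 :=
    (measurePreserving_fst (μ := μ) (ν := μ)).quasiMeasurePreserving.ae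
      ((stdGaussian_absolutelyContinuous E).ae_le hf.ae_differentiableAt)
  have hD : Measurable fun p : E × E => fderiv ℝ f p.1 p.2 := by
    have h1 : Measurable fun p : E × E => (fderiv ℝ f p.1, p.2) :=
      ((measurable_fderiv ℝ f).comp measurable_fst).prodMk measurable_snd
    exact (isBoundedBilinearMap_apply (𝕜 := ℝ) (E := E) (F := ℝ)).continuous.measurable.comp h1
  have hnorm (x : E) : ‖fderiv ℝ f x‖ ≤ 1 := by
    simpa using norm_fderiv_le_of_lipschitz ℝ hf (x₀ := x)
  have hDint : Integrable (fun p : E × E => (Real.pi / 2 * fderiv ℝ f p.1 p.2) ^ 2)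
      (μ.prod μ) := by
    refine (integrable_sq_norm_add_norm_stdGaussian.const_mul ((Real.pi / 2) ^ 2)).mono'
      ((hD.const_mul _).pow_const 2).aestronglyMeasurable (ae_of_all _ fun p => ?_)
    rw [Real.norm_eq_abs, abs_pow, abs_mul, mul_pow, abs_of_pos Real.pi_div_two_pos]
    have : |fderiv ℝ f p.1 p.2| ≤ ‖p.1‖ + ‖p.2‖ := by
      have h1 := (fderiv ℝ f p.1).le_of_opNorm_le (hnorm p.1) p.2
      rw [Real.norm_eq_abs, one_mul] at h1
      linarith [norm_nonneg p.1]
    gcongr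
  have hlim : Tendsto (fun N : ℕ => ∫ p, (((N + 1 : ℕ) : ℝ) *
      rotationIncrement f (Real.pi / 2 / (N + 1 : ℕ)) p) ^ 2 ∂(μ.prod μ)) atTop
      (𝓝 (∫ p, (Real.pi / 2 * fderiv ℝ f p.1 p.2) ^ 2 ∂(μ.prod μ))) := by
    refine tendsto_integral_of_dominated_convergence
      (fun p => (Real.pi / 2) ^ 2 * (‖p.1‖ + ‖p.2‖) ^ 2) (fun N => ?_)
      (integrable_sq_norm_add_norm_stdGaussian.const_mul _) (fun N => ae_of_all _ fun p => ?_) ?_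
    · exact (((continuous_rotationIncrement hf _).const_mul _).pow 2).aestronglyMeasurable
    · rw [Real.norm_eq_abs, abs_pow, ← mul_pow]
      have hN : (0 : ℝ) < ((N + 1 : ℕ) : ℝ) := by positivity
      gcongr
      rw [abs_mul, abs_of_pos hN]
      calc _ ≤ ((N + 1 : ℕ) : ℝ) * (Real.pi / 2 / (N + 1 : ℕ) * (‖p.1‖ + ‖p.2‖)) := by
            gcongr; exact abs_rotationIncrement_le hf (by positivity) p
        _ = _ := by field_simp
    · filter_upwards [hdiff] with p hp
      exact (tendsto_rotationIncrement_div hp).pow 2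
  calc _ ≤ ∫ p, (Real.pi / 2 * fderiv ℝ f p.1 p.2) ^ 2 ∂(μ.prod μ) := by
        refine ge_of_tendsto hlim (Eventually.of_forall fun N => ?_)
        simp_rw [mul_pow]
        rw [integral_const_mul]
        exact integral_sq_sub_le_mul_integral_rotationIncrement hf N.succ_pos
    _ = ∫ x, (Real.pi / 2) ^ 2 * ‖fderiv ℝ f x‖ ^ 2 ∂μ := by
        rw [integral_prod _ hDint]
        simp_rw [mul_pow, integral_const_mul, μ, integral_sq_strongDual_stdGaussian]
    _ ≤ ∫ x, (Real.pi / 2) ^ 2 ∂μ := by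
        refine integral_mono_of_nonneg (ae_of_all _ fun x => by positivity)
          (integrable_const _) (ae_of_all _ fun x => ?_)
        have := hnorm x
        have : ‖fderiv ℝ f x‖ ^ 2 ≤ 1 := pow_le_one₀ (norm_nonneg _) this
        simp only
        nlinarith [sq_nonneg (Real.pi / 2)]
    _ = _ := by simp

/-- A Gaussian Poincaré inequality for Lipschitz functions. -/
theorem variance_stdGaussian_le_of_lipschitzWith {f : E → ℝ} (hf : LipschitzWith 1 f) :
    Var[f; stdGaussian E] ≤ 2 := by
  set μ := stdGaussian E
  have hL : MemLp f 2 μ := hf.memLp_two_stdGaussian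
  have h1 : MemLp (fun p : E × E => f p.1) 2 (μ.prod μ) :=
    hL.comp_measurePreserving measurePreserving_fst
  have h2 : MemLp (fun p : E × E => f p.2) 2 (μ.prod μ) :=
    hL.comp_measurePreserving measurePreserving_snd
  have key := integral_sq_sub_le_of_lipschitzWith hf
  have hexp : ∫ p : E × E, (f p.2 - f p.1) ^ 2 ∂(μ.prod μ) = 2 * Var[f; μ] := by
    rw [variance_eq_sub hL]
    have hmul : Integrable (fun p : E × E => f p.1 * f p.2) (μ.prod μ) :=
      (hL.integrable one_le_two).mul_prod (hL.integrable one_le_two)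
    have : (fun p : E × E => (f p.2 - f p.1) ^ 2) =
        fun p => f p.2 ^ 2 + f p.1 ^ 2 - 2 * (f p.1 * f p.2) := by ext; ring
    rw [this, integral_sub (f := fun p : E × E => f p.2 ^ 2 + f p.1 ^ 2)
        (h2.integrable_sq.add h1.integrable_sq) (hmul.const_mul 2),
      integral_add h2.integrable_sq h1.integrable_sq, integral_const_mul,
      integral_prod_mul f f, integral_fun_fst (fun x => f x ^ 2),
      integral_fun_snd (fun x => f x ^ 2)]
    simp [Pi.pow_apply]
    ring
  rw [hexp] at key
  have := Real.pi_lt_d2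
  nlinarith [Real.pi_pos]

end

section

variable {H : Type*} [NormedAddCommGroup H] [InnerProductSpace ℝ H] [FiniteDimensional ℝ H]

theorem det_smul_starProjection_add_smul_starProjection (V : Submodule ℝ H) (a b : ℝ) :
    LinearMap.det (a • V.starProjection + b • Vᗮ.starProjection : H →L[ℝ] H).toLinearMap =
      a ^ finrank ℝ V * b ^ finrank ℝ Vᗮ := by
  set e := Submodule.prodEquivOfIsCompl V Vᗮ V.isCompl_orthogonal
  have h : (a • V.starProjection + b • Vᗮ.starProjection : H →L[ℝ] H).toLinearMap =
      (e : (V × Vᗮ) →ₗ[ℝ] H) ∘ₗ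
        (LinearMap.prodMap (a • LinearMap.id) (b • LinearMap.id)) ∘ₗ (e.symm : H →ₗ[ℝ] V × Vᗮ) := by
    have h' : (a • V.starProjection + b • Vᗮ.starProjection : H →L[ℝ] H).toLinearMap ∘ₗ
        (e : (V × Vᗮ) →ₗ[ℝ] H) = (e : (V × Vᗮ) →ₗ[ℝ] H) ∘ₗ
        (LinearMap.prodMap (a • LinearMap.id) (b • LinearMap.id)) := by
      have h1 (x : V) : V.starProjection (x : H) = x :=
        Submodule.starProjection_eq_self_iff.2 x.2
      have h2 (x : Vᗮ) : V.starProjection (x : H) = 0 :=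
        (Submodule.starProjection_apply_eq_zero_iff _).2 x.2
      ext x <;> simp [e, h1, h2]
    rw [← LinearMap.comp_assoc, ← h', LinearMap.comp_assoc]
    ext; simp
  rw [h, LinearMap.det_conj, LinearMap.det_prodMap]
  simp [LinearMap.det_smul]

variable {Y : Type*} [NormedAddCommGroup Y] [NormedSpace ℝ Y]

theorem exists_contraction_isMaxOn_abs_det (f : H →L[ℝ] Y) (hf : Function.Injective f) :
    ∃ A : H →L[ℝ] H, (∀ x, ‖f (A x)‖ ≤ ‖x‖) ∧ A.det ≠ 0 ∧
      ∀ B : H →L[ℝ] H, (∀ x, ‖f (B x)‖ ≤ ‖x‖) → |B.det| ≤ |A.det| := by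
  obtain ⟨K, hK0, hK⟩ := f.toLinearMap.exists_antilipschitzWith (LinearMap.ker_eq_bot.2 hf)
  have hK' (x : H) : ‖x‖ ≤ K * ‖f x‖ := by simpa using hK.le_mul_dist x 0
  set S : Set (H →L[ℝ] H) := {B | ∀ x, ‖f (B x)‖ ≤ ‖x‖}
  have hclosed : IsClosed S := by
    rw [show S = ⋂ x, {B : H →L[ℝ] H | ‖f (B x)‖ ≤ ‖x‖} by ext; simp [S]]
    exact isClosed_iInter fun x => isClosed_le (by fun_prop) continuous_const
  have hbdd : Bornology.IsBounded S := by
    refine (Metric.isBounded_closedBall (x := 0) (r := K)).subset fun B hB => ?_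
    rw [mem_closedBall_zero_iff]
    refine B.opNorm_le_bound K.2 fun x => (hK' _).trans ?_
    exact mul_le_mul_of_nonneg_left (hB x) K.2
  have : ProperSpace (H →L[ℝ] H) := FiniteDimensional.proper ℝ _
  set c : ℝ := (‖f‖ + 1)⁻¹
  have hc : 0 < c := by positivity
  have hcS : c • ContinuousLinearMap.id ℝ H ∈ S := by
    intro x
    simp only [smul_apply, ContinuousLinearMap.id_apply, map_smul, norm_smul,
      Real.norm_eq_abs, abs_of_pos hc]
    have h1 : c * ‖f x‖ ≤ c * ((‖f‖ + 1) * ‖x‖) := by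
      gcongr
      exact f.le_of_opNorm_le (by linarith) x
    rwa [← mul_assoc, inv_mul_cancel₀ (by positivity), one_mul] at h1
  obtain ⟨A, hA, hmax⟩ := (Metric.isCompact_of_isClosed_isBounded hclosed hbdd).exists_isMaxOn
    ⟨_, hcS⟩ (ContinuousLinearMap.continuous_det.abs.continuousOn)
  refine ⟨A, hA, ?_, fun B hB => hmax hB⟩
  have h := hmax hcS
  simp only [Set.mem_ofPred_eq] at h
  have hpos : 0 < |(c • ContinuousLinearMap.id ℝ H).det| := by
    rw [ContinuousLinearMap.det]
    simp [LinearMap.det_smul, hc.ne']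
  exact abs_pos.1 (hpos.trans_le h)

/-- In an optimal position, the map is nowhere small on subspaces of at least half the dimension. -/
theorem exists_contraction_forall_exists_mem_quarter_le (f : H →L[ℝ] Y)
    (hf : Function.Injective f) :
    ∃ T : H →L[ℝ] Y, (∀ x, ‖T x‖ ≤ ‖x‖) ∧ ∀ V : Submodule ℝ H,
      0 < finrank ℝ V → finrank ℝ H ≤ 2 * finrank ℝ V → ∃ v ∈ V, ‖v‖ = 1 ∧ 1 / 4 ≤ ‖T v‖ := by
  obtain ⟨A, hA, hA0, hmax⟩ := exists_contraction_isMaxOn_abs_det f hf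
  refine ⟨f ∘L A, hA, fun V hV0 hV => ?_⟩
  by_contra! hcon
  have hV4 : ∀ v ∈ V, ‖f (A v)‖ ≤ 1 / 4 * ‖v‖ := by
    intro v hv
    rcases eq_or_ne v 0 with rfl | hv0
    · simp
    have hvn : 0 < ‖v‖ := norm_pos_iff.2 hv0
    have := hcon (‖v‖⁻¹ • v) (V.smul_mem _ hv) (by simp [norm_smul, hvn.ne'])
    simp only [ContinuousLinearMap.comp_apply, map_smul, norm_smul, norm_inv, norm_norm] at this
    rw [inv_mul_lt_iff₀ hvn] at this
    linarith
  set D : H →L[ℝ] H := (2 : ℝ) • V.starProjection + (3 / 4 : ℝ) • Vᗮ.starProjection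
  have hD (x : H) : ‖f ((A ∘L D) x)‖ ≤ ‖x‖ := by
    have h1 : f ((A ∘L D) x) =
        (2 : ℝ) • f (A (V.starProjection x)) + (3 / 4 : ℝ) • f (A (Vᗮ.starProjection x)) := by
      simp [D]
    have h2 := hV4 (V.starProjection x) (V.starProjection_apply_mem x)
    have h3 := hA (Vᗮ.starProjection x)
    have h4 := V.norm_sq_eq_add_norm_sq_starProjection x
    have h5 : ‖f ((A ∘L D) x)‖ ≤ 1 / 2 * ‖V.starProjection x‖ + 3 / 4 * ‖Vᗮ.starProjection x‖ := by
      rw [h1]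
      refine (norm_add_le _ _).trans ?_
      rw [norm_smul, norm_smul, Real.norm_of_nonneg (by norm_num),
        Real.norm_of_nonneg (by norm_num)]
      linarith
    refine h5.trans (abs_le_of_sq_le_sq' ?_ (norm_nonneg _)).2
    rw [h4]
    nlinarith [sq_nonneg (3 / 4 * ‖V.starProjection x‖ - 1 / 2 * ‖Vᗮ.starProjection x‖),
      sq_nonneg ‖V.starProjection x‖, sq_nonneg ‖Vᗮ.starProjection x‖]
  have hdet := hmax _ hD
  have hdetD : D.det = 2 ^ finrank ℝ V * (3 / 4) ^ finrank ℝ Vᗮ :=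
    det_smul_starProjection_add_smul_starProjection V 2 (3 / 4)
  have hmul : (A ∘L D).det = A.det * D.det := by
    simp only [ContinuousLinearMap.det]
    exact LinearMap.det_comp _ _
  have hdim := V.finrank_add_finrank_orthogonal
  have hone : 1 < D.det := by
    rw [hdetD]
    calc (1 : ℝ) < (3 / 2) ^ finrank ℝ V := one_lt_pow₀ (by norm_num) hV0.ne'
      _ = 2 ^ finrank ℝ V * (3 / 4) ^ finrank ℝ V := by rw [← mul_pow]; norm_num
      _ ≤ _ := by
        gcongr ?_ * ?_
        exact pow_le_pow_of_le_one (by norm_num) (by norm_num) (by omega)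
  rw [hmul, abs_mul] at hdet
  have := abs_pos.2 hA0
  nlinarith [le_abs_self D.det]

end

theorem exists_injective_continuousLinearMap_of_not_finiteDimensional {Y : Type*}
    [NormedAddCommGroup Y] [NormedSpace ℝ Y] (hY : ¬ FiniteDimensional ℝ Y) (n : ℕ) :
    ∃ f : EuclideanSpace ℝ (Fin n) →L[ℝ] Y, Function.Injective f := by
  have h : (n : Cardinal) ≤ Module.rank ℝ Y := by
    refine Cardinal.natCast_le_aleph0.trans ?_
    rw [← not_lt]
    exact fun h => hY (Module.rank_lt_aleph0_iff.1 h)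
  obtain ⟨s, hs, hli⟩ := le_rank_iff_exists_linearIndependent_finset.1 h
  let e : Fin n ≃ s := (finCongr hs.symm).trans s.equivFin.symm
  have hli' : LinearIndependent ℝ fun i => (e i : Y) := hli.comp e e.injective
  refine ⟨LinearMap.toContinuousLinearMap
    (Fintype.linearCombination ℝ (fun i => (e i : Y)) ∘ₗ
      (WithLp.linearEquiv 2 ℝ (Fin n → ℝ)).toLinearMap), ?_⟩
  have := hli'.fintypeLinearCombination_injective
  simpa using this.comp (WithLp.linearEquiv 2 ℝ (Fin n → ℝ)).injective

theorem Orthonormal.fin_snoc {H : Type*} [NormedAddCommGroup H] [InnerProductSpace ℝ H] {n : ℕ}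
    {u : Fin n → H} (hu : Orthonormal ℝ u) {v : H} (hv : ‖v‖ = 1) (huv : ∀ i, ⟪u i, v⟫ = 0) :
    Orthonormal ℝ (Fin.snoc u v : Fin (n + 1) → H) := by
  constructor
  · intro i
    refine Fin.lastCases ?_ (fun i => ?_) i <;> simp [hv, hu.1]
  · intro i j
    refine Fin.lastCases ?_ (fun i => ?_) i <;> refine Fin.lastCases ?_ (fun j => ?_) j
    · simp
    · intro _
      simpa using (real_inner_comm _ _).trans (huv j)
    · simp [huv]
    · intro hij
      simpa using hu.2 (fun h => hij (by rw [h]))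

/-- A weak form of the Dvoretzky–Rogers lemma. -/
theorem exists_family_norm_sum_le {Y : Type*} [NormedAddCommGroup Y] [NormedSpace ℝ Y]
    (hY : ¬ FiniteDimensional ℝ Y) (k : ℕ) :
    ∃ e : Fin k → Y, (∀ i, 1 / 4 ≤ ‖e i‖) ∧
      ∀ a : EuclideanSpace ℝ (Fin k), ‖∑ i, a i • e i‖ ≤ ‖a‖ := by
  obtain ⟨f, hf⟩ := exists_injective_continuousLinearMap_of_not_finiteDimensional hY (2 * k)
  obtain ⟨T, hT, hV⟩ := exists_contraction_forall_exists_mem_quarter_le f hf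
  have key : ∀ j ≤ k, ∃ u : Fin j → EuclideanSpace ℝ (Fin (2 * k)),
      Orthonormal ℝ u ∧ ∀ i, 1 / 4 ≤ ‖T (u i)‖ := by
    intro j
    induction j with
    | zero => exact fun _ => ⟨Fin.elim0, ⟨fun i => i.elim0, fun i => i.elim0⟩, fun i => i.elim0⟩
    | succ j ih =>
      intro hj
      obtain ⟨u, hu, hTu⟩ := ih (by omega)
      set W := Submodule.span ℝ (Set.range u)
      have hW : finrank ℝ W = j := by
        simpa using finrank_span_eq_card hu.linearIndependent
      have hdim := W.finrank_add_finrank_orthogonal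
      rw [finrank_euclideanSpace_fin] at hdim
      obtain ⟨v, hvW, hv1, hTv⟩ := hV Wᗮ (by omega) (by rw [finrank_euclideanSpace_fin]; omega)
      refine ⟨Fin.snoc u v, hu.fin_snoc hv1 fun i => ?_, fun i => ?_⟩
      · exact W.inner_right_of_mem_orthogonal (Submodule.subset_span ⟨i, rfl⟩) hvW
      · refine Fin.lastCases ?_ (fun i => ?_) i <;> simp only [Fin.snoc_last, Fin.snoc_castSucc]
        exacts [hTv, hTu i]
  obtain ⟨u, hu, hTu⟩ := key k le_rfl
  refine ⟨fun i => T (u i), hTu, fun a => ?_⟩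
  have h1 : ∑ i, a i • T (u i) = T (∑ i, a i • u i) := by simp
  rw [h1]
  refine (hT _).trans (le_of_eq ?_)
  rw [norm_eq_sqrt_real_inner (∑ i, a i • u i), hu.inner_sum, EuclideanSpace.norm_eq]
  congr 1
  simp [sq]

theorem gaussianReal_real_setOf_abs_le_lt_one (t : ℝ) :
    (gaussianReal 0 1).real {x | |x| ≤ t} < 1 := by
  have hpos : 0 < (gaussianReal 0 1).real (Set.Ioi t) := by
    rw [measureReal_def, ENNReal.toReal_pos_iff]
    refine ⟨pos_iff_ne_zero.2 fun h => ?_, measure_lt_top _ _⟩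
    have := gaussianReal_absolutelyContinuous' 0 one_ne_zero h
    simp at this
  have hm : MeasurableSet {x : ℝ | |x| ≤ t} := measurableSet_le (by fun_prop) (by fun_prop)
  have h1 := probReal_compl_eq_one_sub (μ := gaussianReal 0 1) hm
  have h2 : (gaussianReal 0 1).real (Set.Ioi t) ≤ (gaussianReal 0 1).real {x | |x| ≤ t}ᶜ := by
    refine measureReal_mono fun x hx => ?_
    simp only [Set.mem_compl_iff, Set.mem_ofPred_eq, not_le]
    exact lt_of_lt_of_le hx (le_abs_self x)
  linarith

section

variable {m : ℕ}

/-- The set of points whose first coordinate exceeding `t` in absolute value is the `j`-th one. -/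
def firstExceedance (t : ℝ) (j : Fin m) : Set (Fin m → ℝ) :=
  {x | t < |x j| ∧ ∀ i < j, |x i| ≤ t}

theorem measurableSet_firstExceedance (t : ℝ) (j : Fin m) :
    MeasurableSet (firstExceedance t j) := by
  simp only [firstExceedance, Set.ofPred_and, Set.ofPred_forall]
  refine (measurableSet_lt (by fun_prop) (by fun_prop)).inter ?_
  exact .iInter fun i => .iInter fun _ => measurableSet_le (by fun_prop) (by fun_prop)

theorem pairwise_disjoint_firstExceedance (t : ℝ) :
    Pairwise (Function.onFun Disjoint (firstExceedance (m := m) t)) := by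
  intro i j hij
  rw [Function.onFun, Set.disjoint_left]
  rintro x ⟨hi, hi'⟩ ⟨hj, hj'⟩
  rcases lt_or_gt_of_ne hij with h | h
  · exact (hj' i h).not_gt hi
  · exact (hi' j h).not_gt hj

theorem iUnion_firstExceedance (t : ℝ) :
    ⋃ j, firstExceedance (m := m) t j = (Set.univ.pi fun _ => {x | |x| ≤ t})ᶜ := by
  ext x
  simp only [Set.mem_iUnion, Set.mem_compl_iff, Set.mem_pi, Set.mem_univ, true_imp_iff,
    Set.mem_ofPred_eq, firstExceedance, not_forall, not_le]
  refine ⟨fun ⟨j, hj, _⟩ => ⟨j, hj⟩, fun ⟨j, hj⟩ => ?_⟩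
  obtain ⟨i, hi⟩ := (Set.toFinite {i | t < |x i|}).exists_minimal ⟨j, hj⟩
  exact ⟨i, hi.1, fun l hl => not_lt.1 fun h => hl.not_ge (hi.2 h hl.le)⟩

/-- The map changing the signs of all the coordinates but the `j`-th one. -/
def flipOthers (j : Fin m) (x : Fin m → ℝ) : Fin m → ℝ := fun i => if i = j then x i else -x i

theorem measurePreserving_flipOthers (j : Fin m) :
    MeasurePreserving (flipOthers j) (Measure.pi fun _ => gaussianReal 0 1)
      (Measure.pi fun _ => gaussianReal 0 1) := by
  have := measurePreserving_pi (fun _ : Fin m => gaussianReal 0 1) (fun _ => gaussianReal 0 1)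
    (f := fun i y => if i = j then y else -y) fun i => by
      by_cases h : i = j
      · simp only [h, if_true]
        exact MeasurePreserving.id _
      · simp only [h, if_false]
        exact ⟨measurable_neg, by simpa using gaussianReal_map_neg (μ := 0) (v := 1)⟩
  exact this

theorem flipOthers_mem_firstExceedance_iff {t : ℝ} {j : Fin m} {x : Fin m → ℝ} :
    flipOthers j x ∈ firstExceedance t j ↔ x ∈ firstExceedance t j := by
  have (i : Fin m) : |flipOthers j x i| = |x i| := by
    simp only [flipOthers]
    split_ifs <;> simp
  simp [firstExceedance, this]

variable {Y : Type*} [NormedAddCommGroup Y] [NormedSpace ℝ Y]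

theorem le_sq_norm_sum_add_sq_norm_sum_flipOthers (e : Fin m → Y) {c t : ℝ} (hc : 0 ≤ c)
    (ht : 0 ≤ t) {j : Fin m} (hj : c ≤ ‖e j‖) {x : Fin m → ℝ} (hx : x ∈ firstExceedance t j) :
    2 * (c * t) ^ 2 ≤ ‖∑ i, x i • e i‖ ^ 2 + ‖∑ i, flipOthers j x i • e i‖ ^ 2 := by
  have h1 : ∑ i, x i • e i + ∑ i, flipOthers j x i • e i = (2 * x j) • e j := by
    rw [← Finset.sum_add_distrib, Finset.sum_eq_single j]
    · simp only [flipOthers, if_true]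
      module
    · intro i _ hij
      simp [flipOthers, hij]
    · simp
  have h2 := norm_add_le (∑ i, x i • e i) (∑ i, flipOthers j x i • e i)
  rw [h1, norm_smul, norm_mul, Real.norm_eq_abs, Real.norm_eq_abs, abs_two] at h2
  have h3 : 2 * (c * t) ≤ 2 * |x j| * ‖e j‖ := by
    have := mul_le_mul hj hx.1.le ht (norm_nonneg _)
    linarith
  have h4 : 0 ≤ c * t := by positivity
  nlinarith [sq_nonneg (‖∑ i, x i • e i‖ - ‖∑ i, flipOthers j x i • e i‖)]

theorem mul_measureReal_firstExceedance_le_setIntegral (e : Fin m → Y) {c t : ℝ} (hc : 0 ≤ c)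
    (ht : 0 ≤ t) {j : Fin m} (hj : c ≤ ‖e j‖)
    (hint : Integrable (fun x : Fin m → ℝ => ‖∑ i, x i • e i‖ ^ 2)
      (Measure.pi fun _ => gaussianReal 0 1)) :
    (c * t) ^ 2 * (Measure.pi fun _ => gaussianReal 0 1).real (firstExceedance t j) ≤
      ∫ x in firstExceedance t j, ‖∑ i, x i • e i‖ ^ 2 ∂(Measure.pi fun _ => gaussianReal 0 1) := by
  set π := Measure.pi fun _ : Fin m => gaussianReal 0 1
  set F : (Fin m → ℝ) → ℝ := fun x => ‖∑ i, x i • e i‖ ^ 2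
  have hm := measurableSet_firstExceedance t j
  have hR := measurePreserving_flipOthers j
  have hg : Integrable ((firstExceedance t j).indicator F) π := hint.indicator hm
  have h1 : ∫ x, (firstExceedance t j).indicator F (flipOthers j x) ∂π =
      ∫ x, (firstExceedance t j).indicator F x ∂π := by
    have := integral_map (μ := π) hR.measurable.aemeasurable
      (f := (firstExceedance t j).indicator F) (by rw [hR.map_eq]; exact hg.aestronglyMeasurable)
    rw [hR.map_eq] at this
    exact this.symm
  have hg' : Integrable (fun x => (firstExceedance t j).indicator F (flipOthers j x)) π :=
    hR.integrable_comp_of_integrable hg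
  have h2 : ∫ x, (firstExceedance t j).indicator (fun _ => 2 * (c * t) ^ 2) x ∂π ≤
      ∫ x, ((firstExceedance t j).indicator F x +
        (firstExceedance t j).indicator F (flipOthers j x)) ∂π := by
    refine integral_mono ((integrable_const _).indicator hm) (hg.add hg') fun x => ?_
    by_cases hx : x ∈ firstExceedance t j
    · have hx' := flipOthers_mem_firstExceedance_iff.2 hx
      simp only [Set.indicator_of_mem, hx, hx']
      exact le_sq_norm_sum_add_sq_norm_sum_flipOthers e hc ht hj hx
    · have hx' := mt flipOthers_mem_firstExceedance_iff.1 hx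
      simp [Set.indicator_of_notMem, hx, hx']
  rw [integral_add hg hg', h1, integral_indicator hm, integral_indicator hm,
    setIntegral_const, smul_eq_mul] at h2
  linarith

theorem mul_one_sub_pow_le_integral_sq_norm_sum (e : Fin m → Y) {c t : ℝ} (hc : 0 ≤ c)
    (ht : 0 ≤ t) (he : ∀ j, c ≤ ‖e j‖)
    (hint : Integrable (fun x : Fin m → ℝ => ‖∑ i, x i • e i‖ ^ 2)
      (Measure.pi fun _ => gaussianReal 0 1)) :
    (c * t) ^ 2 * (1 - (gaussianReal 0 1).real {x | |x| ≤ t} ^ m) ≤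
      ∫ x, ‖∑ i, x i • e i‖ ^ 2 ∂(Measure.pi fun _ : Fin m => gaussianReal 0 1) := by
  set π := Measure.pi fun _ : Fin m => gaussianReal 0 1
  have hm : MeasurableSet (Set.univ.pi fun _ : Fin m => {x : ℝ | |x| ≤ t}) :=
    .univ_pi fun _ => measurableSet_le (by fun_prop) (by fun_prop)
  have h1 : 1 - (gaussianReal 0 1).real {x | |x| ≤ t} ^ m =
      ∑ j, π.real (firstExceedance t j) := by
    rw [← measureReal_iUnion_fintype (pairwise_disjoint_firstExceedance t)
      (measurableSet_firstExceedance t), iUnion_firstExceedance, probReal_compl_eq_one_sub hm]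
    simp [π, measureReal_def, Measure.pi_pi]
  rw [h1, Finset.mul_sum]
  calc _ ≤ ∑ j, ∫ x in firstExceedance t j, ‖∑ i, x i • e i‖ ^ 2 ∂π :=
        Finset.sum_le_sum fun j _ =>
          mul_measureReal_firstExceedance_le_setIntegral e hc ht (he j) hint
    _ = ∫ x in ⋃ j, firstExceedance t j, ‖∑ i, x i • e i‖ ^ 2 ∂π :=
        (integral_iUnion_fintype (measurableSet_firstExceedance t)
          (pairwise_disjoint_firstExceedance t) fun j => hint.integrableOn).symm
    _ ≤ _ := setIntegral_le_integral hint (ae_of_all _ fun x => sq_nonneg _)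

end

theorem exists_forall_le_integral_sq_norm_sum {c : ℝ} (hc : 0 < c) (K : ℝ) :
    ∃ m : ℕ, ∀ {Y : Type u} [NormedAddCommGroup Y] [NormedSpace ℝ Y] (e : Fin m → Y),
      (∀ j, c ≤ ‖e j‖) → Integrable (fun x : Fin m → ℝ => ‖∑ i, x i • e i‖ ^ 2)
        (Measure.pi fun _ => gaussianReal 0 1) →
      K ≤ ∫ x, ‖∑ i, x i • e i‖ ^ 2 ∂(Measure.pi fun _ : Fin m => gaussianReal 0 1) := by
  set t : ℝ := (2 * |K| + 1) / c with htdef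
  have ht : 0 ≤ t := by positivity
  obtain ⟨m, hm⟩ := exists_pow_lt_of_lt_one (by norm_num : (0 : ℝ) < 1 / 2)
    (gaussianReal_real_setOf_abs_le_lt_one t)
  refine ⟨m, fun e he hint => le_trans ?_
    (mul_one_sub_pow_le_integral_sq_norm_sum e hc.le ht he hint)⟩
  rw [show c * t = 2 * |K| + 1 by rw [htdef]; field_simp]
  nlinarith [abs_nonneg K, le_abs_self K, sq_nonneg (2 * |K| + 1)]

theorem ContinuousLinearMap.norm_bounds_of_net {H Y : Type*} [NormedAddCommGroup H]
    [NormedSpace ℝ H] [NormedAddCommGroup Y] [NormedSpace ℝ Y] (U : H →L[ℝ] Y) {N : Set H}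
    (hN : ∀ a : H, ‖a‖ = 1 → ∃ b ∈ N, ‖a - b‖ ≤ 1 / 8) {M : ℝ} (hM : 0 ≤ M)
    (hU : ∀ b ∈ N, |‖U b‖ - M| ≤ M / 4) (a : H) :
    4 / 7 * M * ‖a‖ ≤ ‖U a‖ ∧ ‖U a‖ ≤ 10 / 7 * M * ‖a‖ := by
  have h1 : ‖U‖ ≤ 5 / 4 * M + ‖U‖ * (1 / 8) := by
    refine U.opNorm_le_of_unit_norm (by positivity) fun a ha => ?_
    obtain ⟨b, hb, hab⟩ := hN a ha
    have h2 := (abs_le.1 (hU b hb)).2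
    have h3 : ‖U (a - b)‖ ≤ ‖U‖ * (1 / 8) := U.le_opNorm_of_le hab
    have h4 : ‖U a‖ ≤ ‖U b‖ + ‖U (a - b)‖ := by
      rw [map_sub]
      exact norm_le_insert' _ _
    linarith
  have h2 : ‖U‖ ≤ 10 / 7 * M := by linarith
  refine ⟨?_, U.le_of_opNorm_le h2 a⟩
  rcases eq_or_ne a 0 with rfl | ha
  · simp
  have ha' : 0 < ‖a‖ := norm_pos_iff.2 ha
  obtain ⟨b, hb, hab⟩ := hN (‖a‖⁻¹ • a) (by simp [norm_smul, ha'.ne'])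
  have h3 := (abs_le.1 (hU b hb)).1
  have h4 : ‖U (‖a‖⁻¹ • a - b)‖ ≤ ‖U‖ * (1 / 8) := U.le_opNorm_of_le hab
  have h5 : ‖U b‖ ≤ ‖U (‖a‖⁻¹ • a)‖ + ‖U (‖a‖⁻¹ • a - b)‖ := by
    rw [map_sub, norm_sub_rev]
    exact norm_le_insert' _ _
  rw [map_smul, norm_smul, norm_inv, norm_norm] at h5
  have h6 : 4 / 7 * M ≤ ‖a‖⁻¹ * ‖U a‖ := by linarith
  rwa [le_inv_mul_iff₀ ha', mul_comm] at h6

theorem lipschitzWith_one_norm_apply {E Y : Type*} [NormedAddCommGroup E] [NormedSpace ℝ E]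
    [NormedAddCommGroup Y] [NormedSpace ℝ Y] {T : E →L[ℝ] Y} (hT : ∀ x, ‖T x‖ ≤ ‖x‖) :
    LipschitzWith 1 fun x => ‖T x‖ := by
  refine LipschitzWith.of_dist_le_mul fun x y => ?_
  rw [NNReal.coe_one, one_mul, dist_eq_norm]
  refine (abs_norm_sub_norm_le _ _).trans ?_
  rw [← map_sub, dist_eq_norm]
  exact hT _

section

variable {ι : Type*} [Fintype ι] {E : Type*} [NormedAddCommGroup E] [InnerProductSpace ℝ E]
  [FiniteDimensional ℝ E] [MeasurableSpace E] [BorelSpace E]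

theorem stdGaussian_map_sum_smul {a : EuclideanSpace ℝ ι} (ha : ‖a‖ = 1) :
    (stdGaussian (PiLp 2 fun _ : ι => E)).map (fun x => ∑ i, a i • x i) = stdGaussian E := by
  have h := stdGaussian_map_of_norm_adjoint
    (∑ i, a i • PiLp.proj 2 (fun _ : ι => E) i : (PiLp 2 fun _ : ι => E) →L[ℝ] E)
    (fun y => WithLp.toLp 2 fun i => a i • y) (fun x y => ?_) fun y => ?_
  · convert h using 2
    ext x
    simp
  · simp [sum_inner, PiLp.inner_apply, inner_smul_left, inner_smul_right]
  · rw [PiLp.norm_eq_of_L2]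
    simp only [norm_smul, mul_pow]
    rw [← Finset.sum_mul, ← EuclideanSpace.norm_sq_eq, ha]
    simp

variable {Y : Type*} [NormedAddCommGroup Y] [NormedSpace ℝ Y]

theorem stdGaussian_setOf_le_abs_norm_sub_le {T : E →L[ℝ] Y} (hT : ∀ x, ‖T x‖ ≤ ‖x‖)
    {a : EuclideanSpace ℝ ι} (ha : ‖a‖ = 1) {s : ℝ} (hs : 0 < s) :
    stdGaussian (PiLp 2 fun _ : ι => E)
      {x | s ≤ |‖T (∑ i, a i • x i)‖ - ∫ y, ‖T y‖ ∂(stdGaussian E)|} ≤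
      ENNReal.ofReal (2 / s ^ 2) := by
  have hL := lipschitzWith_one_norm_apply hT
  have h1 := meas_ge_le_variance_div_sq hL.memLp_two_stdGaussian hs
  have hm (M : ℝ) : MeasurableSet {x | s ≤ |‖T x‖ - M|} :=
    measurableSet_le measurable_const (by fun_prop : Continuous fun x => |‖T x‖ - M|).measurable
  refine le_trans (le_of_eq ?_) (h1.trans ?_)
  · generalize ∫ y, ‖T y‖ ∂(stdGaussian E) = M
    rw [← stdGaussian_map_sum_smul (E := E) ha, Measure.map_apply (by fun_prop) (hm M)]
    rfl
  · gcongr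
    exact variance_stdGaussian_le_of_lipschitzWith hL

/-- A linear map that is bounded on average from below contains good copies of low-dimensional
Euclidean spaces. -/
theorem exists_forall_mem_abs_norm_sub_le {T : E →L[ℝ] Y} (hT : ∀ x, ‖T x‖ ≤ ‖x‖)
    {N : Finset (EuclideanSpace ℝ ι)} (hN : ∀ a ∈ N, ‖a‖ = 1)
    (hM : 0 < ∫ y, ‖T y‖ ∂(stdGaussian E))
    (hM2 : 32 * (N.card : ℝ) < (∫ y, ‖T y‖ ∂(stdGaussian E)) ^ 2) :
    ∃ U : EuclideanSpace ℝ ι →L[ℝ] Y, ∀ a ∈ N,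
      |‖U a‖ - ∫ y, ‖T y‖ ∂(stdGaussian E)| ≤ (∫ y, ‖T y‖ ∂(stdGaussian E)) / 4 := by
  set M := ∫ y, ‖T y‖ ∂(stdGaussian E) with hMdef
  set μ := stdGaussian (PiLp 2 fun _ : ι => E)
  have h1 : μ (⋃ a ∈ N, {x | M / 4 ≤ |‖T (∑ i, a i • x i)‖ - M|}) < 1 := by
    calc _ ≤ ∑ a ∈ N, μ {x | M / 4 ≤ |‖T (∑ i, a i • x i)‖ - M|} :=
          measure_biUnion_finset_le _ _
      _ ≤ ∑ a ∈ N, ENNReal.ofReal (2 / (M / 4) ^ 2) := Finset.sum_le_sum fun a ha =>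
          stdGaussian_setOf_le_abs_norm_sub_le hT (hN a ha) (by positivity)
      _ = ENNReal.ofReal (N.card * (2 / (M / 4) ^ 2)) := by
          rw [Finset.sum_const, ENNReal.ofReal_mul (by positivity)]
          simp
      _ < 1 := by
          rw [ENNReal.ofReal_lt_one]
          field_simp
          linarith
  obtain ⟨x, hx⟩ : ∃ x : PiLp 2 fun _ : ι => E,
      x ∉ ⋃ a ∈ N, {x | M / 4 ≤ |‖T (∑ i, a i • x i)‖ - M|} := by
    by_contra! h
    rw [Set.eq_univ_of_forall h, measure_univ] at h1
    exact lt_irrefl _ h1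
  refine ⟨∑ i, (EuclideanSpace.proj i : EuclideanSpace ℝ ι →L[ℝ] ℝ).smulRight (T (x i)),
    fun a ha => ?_⟩
  simp only [Set.mem_iUnion, not_exists, Set.mem_ofPred_eq, not_le] at hx
  have := (hx a ha).le
  simpa using this

end

theorem exists_finset_net_unitSphere (H : Type*) [NormedAddCommGroup H] [NormedSpace ℝ H]
    [FiniteDimensional ℝ H] {ε : ℝ} (hε : 0 < ε) :
    ∃ N : Finset H, (∀ a ∈ N, ‖a‖ = 1) ∧ ∀ a : H, ‖a‖ = 1 → ∃ b ∈ N, ‖a - b‖ ≤ ε := by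
  have : ProperSpace H := FiniteDimensional.proper ℝ H
  obtain ⟨t, hts, htf, ht⟩ := (isCompact_sphere (0 : H) 1).finite_cover_balls hε
  refine ⟨htf.toFinset, fun a ha => ?_, fun a ha => ?_⟩
  · simpa using hts (htf.mem_toFinset.1 ha)
  · obtain ⟨b, hb, hab⟩ := Set.mem_iUnion₂.1 (ht (by simpa using ha))
    exact ⟨b, htf.mem_toFinset.2 hb, by rw [← dist_eq_norm]; exact (Metric.mem_ball.1 hab).le⟩

/-- A weak form of Dvoretzky's theorem. -/
theorem exists_continuousLinearMap_norm_le_le_three_mul {Y : Type*} [NormedAddCommGroup Y]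
    [NormedSpace ℝ Y] (hY : ¬ FiniteDimensional ℝ Y) (ι : Type*) [Fintype ι] :
    ∃ U : EuclideanSpace ℝ ι →L[ℝ] Y, ∀ a, ‖a‖ ≤ ‖U a‖ ∧ ‖U a‖ ≤ 3 * ‖a‖ := by
  obtain ⟨N, hN1, hN⟩ :=
    exists_finset_net_unitSphere (EuclideanSpace ℝ ι) (by norm_num : (0 : ℝ) < 1 / 8)
  obtain ⟨m, hm⟩ := exists_forall_le_integral_sq_norm_sum (by norm_num : (0 : ℝ) < 1 / 4)
    (32 * N.card + 3)
  obtain ⟨e, he, hle⟩ := exists_family_norm_sum_le hY m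
  set T : EuclideanSpace ℝ (Fin m) →L[ℝ] Y :=
    ∑ i, (EuclideanSpace.proj i : EuclideanSpace ℝ (Fin m) →L[ℝ] ℝ).smulRight (e i)
  have hTe (x) : T x = ∑ i, x i • e i := by simp [T]
  have hT (x) : ‖T x‖ ≤ ‖x‖ := by rw [hTe]; exact hle x
  have hL := lipschitzWith_one_norm_apply hT
  have hL2 := hL.memLp_two_stdGaussian
  have hmp : MeasurePreserving (WithLp.toLp 2) (Measure.pi fun _ : Fin m => gaussianReal 0 1)
      (stdGaussian (EuclideanSpace ℝ (Fin m))) := ⟨by fun_prop, map_pi_eq_stdGaussian⟩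
  have hint : Integrable (fun x => ‖T x‖ ^ 2) (stdGaussian (EuclideanSpace ℝ (Fin m))) :=
    hL2.integrable_sq
  have hint' := hmp.integrable_comp_of_integrable hint
  have hK := hm e he (by simpa [Function.comp_def, hTe] using hint')
  have hK' : 32 * N.card + 3 ≤ ∫ x, ‖T x‖ ^ 2 ∂(stdGaussian (EuclideanSpace ℝ (Fin m))) := by
    rw [← hmp.map_eq, integral_map hmp.measurable.aemeasurable]
    · simpa [hTe] using hK
    · rw [hmp.map_eq]
      exact hint.aestronglyMeasurable
  have hvar := variance_stdGaussian_le_of_lipschitzWith hL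
  rw [variance_eq_sub hL2] at hvar
  set M := ∫ x, ‖T x‖ ∂(stdGaussian (EuclideanSpace ℝ (Fin m))) with hMdef
  have hM2 : 32 * (N.card : ℝ) + 1 ≤ M ^ 2 := by
    simp only [Pi.pow_apply] at hvar
    linarith
  have hM0 : 0 ≤ M := integral_nonneg fun _ => norm_nonneg _
  have hM : 0 < M := by
    refine hM0.lt_of_ne fun h => ?_
    rw [← h] at hM2
    have : (0 : ℝ) ≤ N.card := by positivity
    linarith
  obtain ⟨U, hU⟩ := exists_forall_mem_abs_norm_sub_le hT hN1 hM (by linarith)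
  have hb := U.norm_bounds_of_net (N := N) hN hM0 hU
  refine ⟨(7 / 4 / M) • U, fun a => ?_⟩
  have h1 : ‖((7 / 4 / M) • U) a‖ = 7 / 4 / M * ‖U a‖ := by
    rw [smul_apply, norm_smul, Real.norm_of_nonneg (by positivity)]
  rw [h1]
  constructor
  · calc ‖a‖ = 7 / 4 / M * (4 / 7 * M * ‖a‖) := by field_simp
      _ ≤ _ := by gcongr; exact (hb a).1
  · calc _ ≤ 7 / 4 / M * (10 / 7 * M * ‖a‖) := by gcongr; exact (hb a).2
      _ = 5 / 2 * ‖a‖ := by field_simp; ring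
      _ ≤ _ := by gcongr; norm_num

section

variable {X : Type*} [NormedAddCommGroup X] [NormedSpace ℝ X]

/-- The common kernel of finitely many functionals. -/
def commonKer (s : Finset (StrongDual ℝ X)) : Submodule ℝ X := ⨅ φ ∈ s, LinearMap.ker φ.toLinearMap

theorem mem_commonKer {s : Finset (StrongDual ℝ X)} {x : X} :
    x ∈ commonKer s ↔ ∀ φ ∈ s, φ x = 0 := by
  simp [commonKer]

theorem commonKer_anti {s t : Finset (StrongDual ℝ X)} (h : s ⊆ t) : commonKer t ≤ commonKer s :=
  fun _ hx => mem_commonKer.2 fun φ hφ => mem_commonKer.1 hx φ (h hφ)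

theorem isClosed_commonKer (s : Finset (StrongDual ℝ X)) : IsClosed (commonKer s : Set X) := by
  rw [show (commonKer s : Set X) = ⋂ φ ∈ s, {x | φ x = 0} by ext; simp [mem_commonKer]]
  exact isClosed_biInter fun φ _ => isClosed_eq φ.continuous continuous_const

theorem not_finiteDimensional_commonKer (hX : ¬ FiniteDimensional ℝ X)
    (s : Finset (StrongDual ℝ X)) : ¬ FiniteDimensional ℝ (commonKer s) := by
  intro h
  let f : X →ₗ[ℝ] s → ℝ := LinearMap.pi fun φ => φ.1.toLinearMap
  have hf : LinearMap.ker f = commonKer s := by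
    ext x
    simp [f, funext_iff, mem_commonKer]
  have : FiniteDimensional ℝ (X ⧸ commonKer s) := by
    rw [← hf]
    exact f.quotKerEquivRange.symm.finiteDimensional
  exact hX (.of_submodule_quotient (commonKer s))

theorem exists_commonKer_norm_le_two_mul (W : Submodule ℝ X) [FiniteDimensional ℝ W] :
    ∃ s : Finset (StrongDual ℝ X), ∀ w ∈ W, ∀ z ∈ commonKer s, ‖w‖ ≤ 2 * ‖w + z‖ := by
  classical
  obtain ⟨N, hN1, hN⟩ := exists_finset_net_unitSphere W (by norm_num : (0 : ℝ) < 1 / 2)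
  choose g hg hgx using fun x : X => exists_dual_vector'' ℝ x
  refine ⟨N.image fun b : W => g (b : X), fun w hw z hz => ?_⟩
  rcases eq_or_ne w 0 with rfl | hw0
  · simp
  have hn : 0 < ‖w‖ := norm_pos_iff.2 hw0
  obtain ⟨b, hb, hab⟩ := hN (‖w‖⁻¹ • ⟨w, hw⟩) (by simp [norm_smul, hn.ne'])
  have hz' : g b z = 0 := mem_commonKer.1 hz _ (Finset.mem_image_of_mem (fun b : W => g (b : X)) hb)
  have hb1 : g b b = 1 := (hgx b).trans (by simpa using hN1 b hb)
  have h1 : g b (‖w‖⁻¹ • w - b) ≥ -(1 / 2) := by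
    refine (abs_le.1 (((g b).le_of_opNorm_le (hg b) _).trans ?_)).1
    simpa using hab
  have h2 : g b (w + z) ≤ ‖w + z‖ := by
    refine (le_abs_self _).trans ?_
    simpa using (g b).le_of_opNorm_le (hg b) (w + z)
  rw [map_add, hz', add_zero] at h2
  rw [map_sub, hb1, map_smul, smul_eq_mul] at h1
  have h3 : 1 / 2 ≤ ‖w‖⁻¹ * g b w := by linarith
  rw [le_inv_mul_iff₀ hn] at h3
  linarith

/-- A subspace is the image of a projection of norm at most `c`. -/
def IsProjectionImage (E : Submodule ℝ X) (c : ℝ) : Prop :=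
  ∃ P : X →L[ℝ] X, ‖P‖ ≤ c ∧ (∀ x, P x ∈ E) ∧ ∀ x ∈ E, P x = x

theorem IsProjectionImage.mono {E : Submodule ℝ X} {c d : ℝ} (h : IsProjectionImage E c)
    (hcd : c ≤ d) : IsProjectionImage E d := by
  obtain ⟨P, hP, h⟩ := h
  exact ⟨P, hP.trans hcd, h⟩

theorem IsProjectionImage.of_inf_ker {E : Submodule ℝ X} {c : ℝ} (φ : StrongDual ℝ X)
    (h : IsProjectionImage (E ⊓ LinearMap.ker φ.toLinearMap) c) :
    IsProjectionImage E (2 * c + 1) := by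
  have h' := h
  obtain ⟨P, hP, hPE, hPx⟩ := h
  have hc : 0 ≤ c := (norm_nonneg P).trans hP
  by_cases hE : ∀ u ∈ E, φ u = 0
  · rw [inf_eq_left.2 fun u hu => by simpa using hE u hu] at h'
    exact h'.mono (by linarith)
  push Not at hE
  obtain ⟨u, hu, hφu⟩ := hE
  have hφP (x : X) : φ (P x) = 0 := by simpa using (hPE x).2
  set v := u - P u with hv
  have hvE : v ∈ E := E.sub_mem hu (hPE u).1
  have hφv : φ v ≠ 0 := by rwa [hv, map_sub, hφP, sub_zero]
  have hv0 : v ≠ 0 := fun h => hφv (by rw [h, map_zero])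
  have hvn : 0 < ‖v‖ := norm_pos_iff.2 hv0
  obtain ⟨g, hg, hgv⟩ := exists_dual_vector ℝ v hvn.ne'
  set Q : X →L[ℝ] X := (‖v‖⁻¹ • g).smulRight v
  have hQx (x : X) : Q x = (‖v‖⁻¹ * g x) • v := by simp [Q]
  have hQ : ‖Q‖ ≤ 1 := by
    simp [Q, ContinuousLinearMap.norm_smulRight_apply, norm_smul, hg, hvn.ne']
  have hPP (x : X) : P (P x) = P x := hPx _ (hPE x)
  have hPv : P v = 0 := by rw [hv, map_sub, hPP, sub_self]
  refine ⟨P + Q ∘L (ContinuousLinearMap.id ℝ X - P), ?_, fun x => ?_, fun x hx => ?_⟩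
  · calc _ ≤ ‖P‖ + ‖Q‖ * (1 + ‖P‖) := by
          refine (norm_add_le _ _).trans ?_
          gcongr
          refine (ContinuousLinearMap.opNorm_comp_le _ _).trans ?_
          gcongr
          refine (norm_sub_le _ _).trans ?_
          gcongr
          exact ContinuousLinearMap.norm_id_le
      _ ≤ c + 1 * (1 + c) := by gcongr
      _ = _ := by ring
  · simp only [add_apply, ContinuousLinearMap.comp_apply, hQx]
    exact E.add_mem (hPE x).1 (E.smul_mem _ hvE)
  · have h1 : x - P x = (φ x / φ v) • v := by
      have h2 : x - P x - (φ x / φ v) • v ∈ E ⊓ LinearMap.ker φ.toLinearMap := by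
        refine ⟨E.sub_mem (E.sub_mem hx (hPE x).1) (E.smul_mem _ hvE), ?_⟩
        simp [hφP, hφv]
      have h3 := hPx _ h2
      rw [map_sub, map_sub, hPP, map_smul, hPv, sub_self, smul_zero, sub_zero] at h3
      exact sub_eq_zero.1 h3.symm
    have h4 : Q (x - P x) = x - P x := by
      rw [h1, map_smul, hQx, hgv]
      simp [hvn.ne']
    simp only [add_apply, ContinuousLinearMap.comp_apply, sub_apply,
      ContinuousLinearMap.id_apply, h4]
    abel

theorem exists_isProjectionImage_of_inf_commonKer (s : Finset (StrongDual ℝ X)) (c : ℝ) :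
    ∃ d, ∀ E : Submodule ℝ X, IsProjectionImage (E ⊓ commonKer s) c → IsProjectionImage E d := by
  classical
  induction s using Finset.induction generalizing c with
  | empty => exact ⟨c, fun E hE => by simpa [commonKer] using hE⟩
  | insert φ s _ ih =>
    obtain ⟨d, hd⟩ := ih (2 * c + 1)
    refine ⟨d, fun E hE => hd E (.of_inf_ker φ ?_)⟩
    rwa [inf_assoc, show commonKer s ⊓ LinearMap.ker φ.toLinearMap = commonKer (insert φ s) by
      ext; simp [mem_commonKer, and_comm]]

theorem IsProjectionImage.of_sup {A B Y : Submodule ℝ X} {C : ℝ} (hC : 0 ≤ C)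
    (hAB : ∀ a ∈ A, ∀ b ∈ B, ‖a‖ ≤ C * ‖a + b‖) (hY : Y ≤ A ⊔ B) (hA : A ≤ Y)
    (P : X →L[ℝ] Y) (hP : ∀ y : Y, P y = y) : IsProjectionImage A (C * ‖P‖) := by
  have H : ∀ (x : A) (y : B), (x : X) = y → A.subtype x = (0 : B →ₗ[ℝ] X) y := by
    intro x y hxy
    have := hAB x x.2 (-y) (B.neg_mem y.2)
    simpa [hxy] using this
  obtain ⟨R, hR⟩ : ∃ R : ↥(A ⊔ B) →ₗ[ℝ] X, ∀ z : ↥(A ⊔ B),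
      ∀ x ∈ A, ∀ y ∈ B, x + y = z → R z = x := by
    let f : X →ₗ.[ℝ] X := ⟨A, A.subtype⟩
    let g : X →ₗ.[ℝ] X := ⟨B, 0⟩
    refine ⟨(f.sup g H).toFun, fun z x hx y hy h => ?_⟩
    exact (LinearPMap.sup_apply (f := f) (g := g) H ⟨x, hx⟩ ⟨y, hy⟩ z h).trans (add_zero x)
  let T : X →ₗ[ℝ] X := R ∘ₗ (Submodule.inclusion hY) ∘ₗ P.toLinearMap
  have hT (x : X) : ∃ a ∈ A, ∃ b ∈ B, a + b = P x ∧ T x = a := by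
    obtain ⟨a, ha, b, hb, hab⟩ := Submodule.mem_sup.1 (hY (P x).2)
    exact ⟨a, ha, b, hb, hab, hR _ a ha b hb hab⟩
  refine ⟨T.mkContinuous (C * ‖P‖) fun x => ?_, T.mkContinuous_norm_le (by positivity) _,
    fun x => ?_, fun x hx => ?_⟩
  · obtain ⟨a, ha, b, hb, hab, hTa⟩ := hT x
    rw [hTa, mul_assoc]
    refine (hAB a ha b hb).trans ?_
    rw [hab]
    gcongr
    exact P.le_opNorm x
  · obtain ⟨a, ha, b, hb, hab, hTa⟩ := hT x
    simpa [hTa] using ha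
  · have : P x = ⟨x, hA hx⟩ := hP ⟨x, hA hx⟩
    exact hR _ x hx 0 B.zero_mem (by simp [this])

/-- If every closed subspace is complemented, the finite-dimensional subspaces are uniformly
complemented. -/
theorem exists_forall_isProjectionImage
    (hcompl : ∀ Y : Submodule ℝ X, IsClosed (Y : Set X) → Y.ClosedComplemented) :
    ∃ c, ∀ E : Submodule ℝ X, FiniteDimensional ℝ E → IsProjectionImage E c := by
  classical
  by_contra! hcon
  let Good (p : Submodule ℝ X × Finset (StrongDual ℝ X)) : Prop :=
    FiniteDimensional ℝ p.1 ∧ ∀ w ∈ p.1, ∀ z ∈ commonKer p.2, ‖w‖ ≤ 2 * ‖w + z‖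
  have step (n : ℕ) (p : {p // Good p}) : ∃ (E : Submodule ℝ X) (q : {p // Good p}),
      E ≤ commonKer p.1.2 ∧ ¬ IsProjectionImage E n ∧ q.1.1 = p.1.1 ⊔ E ∧
        commonKer q.1.2 ≤ commonKer p.1.2 := by
    obtain ⟨⟨W, s⟩, hW, hp⟩ := p
    obtain ⟨d, hd⟩ := exists_isProjectionImage_of_inf_commonKer s n
    obtain ⟨E, hE, hEd⟩ := hcon d
    have := hW
    have : FiniteDimensional ℝ ↥(W ⊔ (E ⊓ commonKer s)) := inferInstance
    obtain ⟨t, ht⟩ := exists_commonKer_norm_le_two_mul (W ⊔ (E ⊓ commonKer s))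
    exact ⟨E ⊓ commonKer s, ⟨(W ⊔ (E ⊓ commonKer s), s ∪ t), this, fun w hw z hz =>
      ht w hw z (commonKer_anti Finset.subset_union_right hz)⟩, inf_le_right,
      fun h => hEd (hd E h), rfl, commonKer_anti Finset.subset_union_left⟩
  choose E q hE hEn hq hqs using step
  let p : ℕ → {p // Good p} := fun n => Nat.rec
    ⟨(⊥, ∅), inferInstanceAs (FiniteDimensional ℝ (⊥ : Submodule ℝ X)), by simp⟩ q n
  have hp (n : ℕ) : p (n + 1) = q n (p n) := rfl
  set W : ℕ → Submodule ℝ X := fun n => (p n).1.1 with hWdef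
  set Z : ℕ → Submodule ℝ X := fun n => commonKer (p n).1.2 with hZdef
  set F : ℕ → Submodule ℝ X := fun n => E n (p n) with hFdef
  have hWF (n : ℕ) : W (n + 1) = W n ⊔ F n := by simp only [hWdef, hFdef, hp, hq]
  have hZ : Antitone Z := antitone_nat_of_succ_le fun n => hqs n (p n)
  have hFZ (n : ℕ) : F n ≤ Z n := hE n (p n)
  have hW : Monotone W := monotone_nat_of_le_succ fun n => by rw [hWF]; exact le_sup_left
  set Y := (⨆ n, F n).topologicalClosure
  have hYle (n : ℕ) : Y ≤ F n ⊔ (W n ⊔ Z (n + 1)) := by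
    have h1 : F n ⊔ (W n ⊔ Z (n + 1)) = Z (n + 1) ⊔ W (n + 1) := by
      rw [hWF, ← sup_assoc, sup_comm, sup_comm (F n)]
    rw [h1]
    refine Submodule.topologicalClosure_minimal _ (iSup_le fun k => ?_) ?_
    · rcases lt_or_ge n k with h | h
      · exact (hFZ k).trans ((hZ h).trans le_sup_left)
      · refine le_trans ?_ ((hW (Nat.succ_le_succ h)).trans le_sup_right)
        rw [Nat.succ_eq_add_one, hWF]
        exact le_sup_right
    · have := (p (n + 1)).2.1
      exact Submodule.isClosed_sup_finiteDimensional _ _ (isClosed_commonKer _)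
  obtain ⟨P, hP⟩ := hcompl Y (Submodule.isClosed_topologicalClosure _)
  obtain ⟨n, hn⟩ := exists_nat_ge (4 * ‖P‖)
  refine hEn n (p n) (IsProjectionImage.mono ?_ hn)
  refine .of_sup (by norm_num) (fun a ha b hb => ?_) (hYle n)
    ((le_iSup F n).trans (Submodule.le_topologicalClosure _)) P hP
  obtain ⟨w, hw, z, hz, rfl⟩ := Submodule.mem_sup.1 hb
  have h1 := (p n).2.2 w hw (a + z) ((Z n).add_mem (hFZ n ha) (hZ n.le_succ hz))
  have h2 := (p (n + 1)).2.2 (a + w) (by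
    change a + w ∈ W (n + 1)
    rw [hWF, add_comm]
    exact Submodule.add_mem_sup hw ha) z hz
  have h3 : ‖a‖ ≤ ‖a + w‖ + ‖w‖ := by simpa using norm_sub_le (a + w) w
  rw [show w + (a + z) = a + (w + z) by abel] at h1
  rw [add_assoc] at h2
  linarith

end

section

variable {X : Type*} [NormedAddCommGroup X] [NormedSpace ℝ X]

/-- The space embeds in a finite-dimensional Euclidean space with squared distortion at most `D`. -/
def EuclideanDistortionLE (E : Type*) [NormedAddCommGroup E] [NormedSpace ℝ E] (D : ℝ) : Prop :=
  ∃ (ι : Type) (_ : Fintype ι) (S : E →ₗ[ℝ] EuclideanSpace ℝ ι),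
    ∀ e, ‖e‖ ^ 2 ≤ ‖S e‖ ^ 2 ∧ ‖S e‖ ^ 2 ≤ D * ‖e‖ ^ 2

theorem EuclideanDistortionLE.mono {E : Type*} [NormedAddCommGroup E] [NormedSpace ℝ E] {C D : ℝ}
    (h : EuclideanDistortionLE E C) (hCD : C ≤ D) : EuclideanDistortionLE E D := by
  obtain ⟨ι, _, S, hS⟩ := h
  exact ⟨ι, _, S, fun e => ⟨(hS e).1, (hS e).2.trans (by gcongr)⟩⟩

theorem exists_euclideanDistortionLE (E : Type*) [NormedAddCommGroup E] [NormedSpace ℝ E]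
    [FiniteDimensional ℝ E] : ∃ D, EuclideanDistortionLE E D := by
  let T : E ≃L[ℝ] EuclideanSpace ℝ (Fin (finrank ℝ E)) := toEuclidean
  set C := ‖(T.symm : EuclideanSpace ℝ (Fin (finrank ℝ E)) →L[ℝ] E)‖
  set C' := ‖(T : E →L[ℝ] EuclideanSpace ℝ (Fin (finrank ℝ E)))‖
  have hC : 0 ≤ C := norm_nonneg _
  refine ⟨(C * C') ^ 2, Fin (finrank ℝ E), inferInstance, C • T.toLinearMap, fun e => ?_⟩
  have h1 : ‖(C • T.toLinearMap) e‖ = C * ‖T e‖ := by simp [norm_smul, hC]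
  rw [h1, ← mul_pow]
  constructor
  · gcongr
    simpa using (T.symm : EuclideanSpace ℝ (Fin (finrank ℝ E)) →L[ℝ] E).le_opNorm (T e)
  · rw [mul_assoc]
    gcongr
    exact (T : E →L[ℝ] EuclideanSpace ℝ (Fin (finrank ℝ E))).le_opNorm e

theorem EuclideanDistortionLE.improve (hX : ¬ FiniteDimensional ℝ X) {c : ℝ} (hc : 0 ≤ c)
    (hproj : ∀ E : Submodule ℝ X, FiniteDimensional ℝ E → IsProjectionImage E c)
    {E : Submodule ℝ X} [FiniteDimensional ℝ E] {D : ℝ} (hE : EuclideanDistortionLE E D) {t : ℝ}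
    (ht : 0 < t) : EuclideanDistortionLE E (18 * c ^ 2 / t ^ 2 + 72 * c ^ 2 * t ^ 2 * D) := by
  obtain ⟨ι, _, S, hS⟩ := hE
  obtain ⟨s, hs⟩ := exists_commonKer_norm_le_two_mul E
  obtain ⟨U, hU⟩ := exists_continuousLinearMap_norm_le_le_three_mul
    (not_finiteDimensional_commonKer hX s) ι
  let J : E →ₗ[ℝ] X := E.subtype + t • (commonKer s).subtype ∘ₗ U.toLinearMap ∘ₗ S
  have hJ (e : E) : J e = e + t • (U (S e) : X) := by simp [J]
  have hJ1 (e : E) : ‖e‖ ≤ 2 * ‖J e‖ := by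
    rw [hJ]
    exact hs e e.2 _ ((commonKer s).smul_mem t (U (S e)).2)
  have hJ2 (e : E) : t * ‖S e‖ ≤ 3 * ‖J e‖ := by
    have h1 : ‖t • (U (S e) : X)‖ ≤ ‖J e‖ + ‖e‖ := by
      have : t • (U (S e) : X) = J e - e := by rw [hJ]; abel
      rw [this]
      exact norm_sub_le _ _
    rw [norm_smul, Real.norm_of_nonneg ht.le] at h1
    have h2 : t * ‖S e‖ ≤ t * ‖(U (S e) : X)‖ := by
      gcongr
      exact (hU _).1
    linarith [hJ1 e]
  have hJinj : LinearMap.ker J = ⊥ := by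
    refine LinearMap.ker_eq_bot'.2 fun e he => ?_
    have := hJ1 e
    rw [he] at this
    simpa using this
  obtain ⟨g, hg⟩ := J.exists_leftInverse_of_injective hJinj
  have hg' (e : E) : g (J e) = e := LinearMap.congr_fun hg e
  obtain ⟨P, hP, hPJ, hPx⟩ := hproj (LinearMap.range J) inferInstance
  have hL (x : X) : J (g (P x)) = P x := by
    obtain ⟨e, he⟩ := hPJ x
    rw [← he, hg']
  have hPle (x : X) : ‖P x‖ ≤ c * ‖x‖ := P.le_of_opNorm_le hP x
  have hL1 (x : X) : ‖g (P x)‖ ≤ 2 * c * ‖x‖ := by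
    have := hJ1 (g (P x))
    rw [hL] at this
    linarith [hPle x]
  have hL2 (x : X) : t * ‖S (g (P x))‖ ≤ 3 * c * ‖x‖ := by
    have := hJ2 (g (P x))
    rw [hL] at this
    linarith [hPle x]
  have hS1 (e : E) : ‖e‖ ≤ ‖S e‖ := (abs_le_of_sq_le_sq' (hS e).1 (norm_nonneg _)).2
  have hle (e : E) : ‖e‖ ≤ ‖S (g (P e))‖ + 6 * c * t * ‖S e‖ := by
    have h1 : e = g (P e) + t • g (P (U (S e))) := by
      conv_lhs => rw [← hg' e, ← hPx (J e) ⟨e, rfl⟩, hJ]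
      simp
    have h2 : ‖g (P (U (S e)))‖ ≤ 2 * c * (3 * ‖S e‖) := by
      refine (hL1 _).trans ?_
      gcongr
      exact (hU _).2
    calc ‖e‖ ≤ ‖g (P e)‖ + ‖t • g (P (U (S e)))‖ := by
          conv_lhs => rw [h1]
          exact norm_add_le _ _
      _ ≤ ‖S (g (P e))‖ + t * (2 * c * (3 * ‖S e‖)) := by
          rw [norm_smul, Real.norm_of_nonneg ht.le]
          gcongr
          exact hS1 _
      _ = _ := by ring
  let S₁ : E →ₗ[ℝ] EuclideanSpace ℝ ι := S ∘ₗ g ∘ₗ P.toLinearMap ∘ₗ E.subtype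
  let S' : E →ₗ[ℝ] EuclideanSpace ℝ (ι ⊕ ι) :=
    { toFun e := WithLp.toLp 2 (Sum.elim (√2 • S₁ e) ((√2 * (6 * c * t)) • S e))
      map_add' x y := by ext (i | i) <;> simp
      map_smul' a x := by ext (i | i) <;> simp <;> ring }
  have hS' (e : E) : ‖S' e‖ ^ 2 = 2 * (‖S (g (P e))‖ ^ 2 + (6 * c * t * ‖S e‖) ^ 2) := by
    rw [EuclideanSpace.norm_sq_eq, Fintype.sum_sum_type]
    simp only [S', LinearMap.coe_mk, AddHom.coe_mk, Sum.elim_inl, Sum.elim_inr]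
    have (a : ℝ) (x : EuclideanSpace ℝ ι) : ∑ i, ‖(a • x) i‖ ^ 2 = a ^ 2 * ‖x‖ ^ 2 := by
      rw [← EuclideanSpace.norm_sq_eq, norm_smul, mul_pow, Real.norm_eq_abs, sq_abs]
    simp only [PiLp.smul_apply] at this ⊢
    simp only [Pi.smul_apply]
    rw [this, this, mul_pow, Real.sq_sqrt (by norm_num)]
    simp only [S₁, LinearMap.comp_apply, Submodule.subtype_apply, ContinuousLinearMap.coe_coe]
    ring
  refine ⟨ι ⊕ ι, inferInstance, S', fun e => ?_⟩
  rw [hS']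
  constructor
  · calc ‖e‖ ^ 2 ≤ (‖S (g (P e))‖ + 6 * c * t * ‖S e‖) ^ 2 := by gcongr; exact hle e
      _ ≤ _ := by nlinarith [sq_nonneg (‖S (g (P e))‖ - 6 * c * t * ‖S e‖)]
  · have h1 : ‖S (g (P e))‖ ≤ 3 * c / t * ‖e‖ := by
      rw [div_mul_eq_mul_div, le_div_iff₀ ht, mul_comm]
      exact hL2 e
    calc _ ≤ 2 * ((3 * c / t * ‖e‖) ^ 2 + (6 * c * t) ^ 2 * (D * ‖e‖ ^ 2)) := by
          rw [mul_pow _ ‖S e‖]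
          gcongr
          exact (hS e).2
      _ = _ := by ring

/-- If the finite-dimensional subspaces are uniformly complemented, they are uniformly Euclidean. -/
theorem exists_forall_euclideanDistortionLE (hX : ¬ FiniteDimensional ℝ X) {c : ℝ}
    (hproj : ∀ E : Submodule ℝ X, FiniteDimensional ℝ E → IsProjectionImage E c) :
    ∃ D, ∀ E : Submodule ℝ X, FiniteDimensional ℝ E → EuclideanDistortionLE E D := by
  have hc : 0 ≤ c := by
    obtain ⟨P, hP, -⟩ := hproj ⊥ inferInstance
    exact (norm_nonneg P).trans hP
  set K := 90 * c ^ 2 + 1 with hK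
  have hK1 : 1 ≤ K := by
    rw [hK]
    linarith [sq_nonneg c]
  refine ⟨4 * K ^ 2, fun E hE => ?_⟩
  have step (r : ℝ) (hr : 2 * K ≤ r) (h : EuclideanDistortionLE E (r ^ 2)) :
      EuclideanDistortionLE E (r ^ 2 / 2) := by
    have hr0 : 0 < r := by linarith
    refine (h.improve hX hc hproj (t := √r⁻¹) (by positivity)).mono ?_
    rw [Real.sq_sqrt (by positivity)]
    have : 18 * c ^ 2 / r⁻¹ + 72 * c ^ 2 * r⁻¹ * r ^ 2 = (K - 1) * r := by
      rw [hK]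
      field_simp
      ring
    rw [this]
    nlinarith
  have key (n : ℕ) : EuclideanDistortionLE E (4 * K ^ 2 * 2 ^ n) →
      EuclideanDistortionLE E (4 * K ^ 2) := by
    induction n with
    | zero => simp
    | succ n ih =>
      intro h
      refine ih ?_
      have h1 : (√(4 * K ^ 2 * 2 ^ (n + 1))) ^ 2 = 4 * K ^ 2 * 2 ^ (n + 1) :=
        Real.sq_sqrt (by positivity)
      have := step (√(4 * K ^ 2 * 2 ^ (n + 1))) (Real.le_sqrt_of_sq_le ?_) (by rwa [h1])
      · rw [h1, pow_succ] at this
        convert this using 1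
        ring
      · have : (1 : ℝ) ≤ 2 ^ (n + 1) := one_le_pow₀ (by norm_num)
        nlinarith [sq_nonneg K]
  obtain ⟨D, hD⟩ := exists_euclideanDistortionLE E
  obtain ⟨n, hn⟩ := pow_unbounded_of_one_lt D (by norm_num : (1 : ℝ) < 2)
  refine key n (hD.mono (hn.le.trans ?_))
  have : (1 : ℝ) ≤ 4 * K ^ 2 := by nlinarith
  exact le_mul_of_one_le_left (by positivity) this

end

theorem exists_hilbertSpace_of_inner_core {X : Type*} [NormedAddCommGroup X] [NormedSpace ℝ X]
    [CompleteSpace X] {V : Type u} [AddCommGroup V] [Module ℝ V] (core : InnerProductSpace.Core ℝ V)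
    (e : X ≃ₗ[ℝ] V) {D : ℝ} (hle : ∀ x, ‖x‖ ^ 2 ≤ core.inner (e x) (e x))
    (hge : ∀ x, core.inner (e x) (e x) ≤ D * ‖x‖ ^ 2) :
    ∃ (H : Type u) (_ : NormedAddCommGroup H) (_ : InnerProductSpace ℝ H)
      (_ : CompleteSpace H), Nonempty (X ≃L[ℝ] H) := by
  let : NormedAddCommGroup V := core.toNormedAddCommGroup
  let : InnerProductSpace ℝ V := InnerProductSpace.ofCore core.toCore
  have hnorm (v : V) : ‖v‖ ^ 2 = core.inner v v := (real_inner_self_eq_norm_sq v).symm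
  let f : X ≃L[ℝ] V := e.toContinuousLinearEquivOfBounds √D 1 (fun x => by
      rw [← Real.sqrt_sq (norm_nonneg (e x)), ← Real.sqrt_sq (norm_nonneg x), hnorm,
        ← Real.sqrt_mul' _ (sq_nonneg _)]
      exact Real.sqrt_le_sqrt (hge x)) (fun v => by
      rw [one_mul]
      refine (abs_le_of_sq_le_sq' ?_ (norm_nonneg _)).2
      rw [hnorm]
      simpa only [e.apply_symm_apply] using hle (e.symm v))
  exact ⟨V, inferInstance, inferInstance,
    (completeSpace_congr (e := f.toEquiv) f.isUniformEmbedding).1 inferInstance, ⟨f⟩⟩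

section

variable {X : Type u} [NormedAddCommGroup X] [NormedSpace ℝ X]

/-- The pull-back of the Euclidean inner product to a subspace, extended by zero. -/
theorem exists_pulledBack_inner {E : Submodule ℝ X} {D : ℝ} (hD : 0 ≤ D)
    (h : EuclideanDistortionLE E D) :
    ∃ b : X → X → ℝ, (∀ x y, b x y ∈ Set.Icc (-(D * ‖x‖ * ‖y‖)) (D * ‖x‖ * ‖y‖)) ∧
      (∀ x ∈ E, ∀ y ∈ E, b x y = b y x) ∧
      (∀ x ∈ E, ∀ y ∈ E, ∀ z ∈ E, b (x + y) z = b x z + b y z) ∧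
      (∀ r : ℝ, ∀ x ∈ E, ∀ y ∈ E, b (r • x) y = r * b x y) ∧
      ∀ x ∈ E, ‖x‖ ^ 2 ≤ b x x := by
  classical
  obtain ⟨ι, _, S, hS⟩ := h
  have hSle (x : E) : ‖S x‖ ≤ √D * ‖x‖ := by
    rw [← Real.sqrt_sq (norm_nonneg (S x)), ← Real.sqrt_sq (norm_nonneg x),
      ← Real.sqrt_mul' _ (sq_nonneg _)]
    exact Real.sqrt_le_sqrt (hS x).2
  refine ⟨fun x y => if h : x ∈ E ∧ y ∈ E then ⟪S ⟨x, h.1⟩, S ⟨y, h.2⟩⟫ else 0, fun x y => ?_,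
    fun x hx y hy => ?_, fun x hx y hy z hz => ?_, fun r x hx y hy => ?_, fun x hx => ?_⟩
  · rw [Set.mem_Icc, ← abs_le]
    dsimp only
    split_ifs with h
    · calc _ ≤ ‖S ⟨x, h.1⟩‖ * ‖S ⟨y, h.2⟩‖ := abs_real_inner_le_norm _ _
        _ ≤ (√D * ‖x‖) * (√D * ‖y‖) := by gcongr <;> exact hSle _
        _ = (√D * √D) * ‖x‖ * ‖y‖ := by ring
        _ = _ := by rw [Real.mul_self_sqrt hD]
    · rw [abs_zero]
      positivity
  · simp [hx, hy, real_inner_comm]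
  · simp only [hx, hy, hz, E.add_mem hx hy, and_self, dite_true]
    rw [← inner_add_left, ← map_add]
    rfl
  · simp only [hx, hy, E.smul_mem r hx, and_self, dite_true]
    rw [← real_inner_smul_left, ← map_smul]
    rfl
  · simpa [hx] using (hS ⟨x, hx⟩).1

theorem exists_hilbertSpace_of_euclideanDistortionLE [CompleteSpace X] {D : ℝ}
    (h : ∀ E : Submodule ℝ X, FiniteDimensional ℝ E → EuclideanDistortionLE E D) :
    ∃ (H : Type u) (_ : NormedAddCommGroup H) (_ : InnerProductSpace ℝ H)
      (_ : CompleteSpace H), Nonempty (X ≃L[ℝ] H) := by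
  classical
  wlog hD : 0 ≤ D
  · exact this (D := 0) (fun E hE => (h E hE).mono (not_le.1 hD).le) le_rfl
  have hspan (F : Finset X) : FiniteDimensional ℝ (Submodule.span ℝ (F : Set X)) :=
    FiniteDimensional.span_finset ℝ F
  choose b hbIcc hsymm hadd hsmul hpos using fun F : Finset X =>
    exists_pulledBack_inner hD (h _ (hspan F))
  let 𝒰 : Ultrafilter (Finset X) := Ultrafilter.of atTop
  have hmem (x : X) : ∀ᶠ F : Finset X in (𝒰 : Filter (Finset X)),
      x ∈ Submodule.span ℝ (F : Set X) := by
    refine Ultrafilter.of_le atTop ((eventually_ge_atTop {x}).mono fun F hF => ?_)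
    exact Submodule.subset_span (hF (Finset.mem_singleton_self x))
  have hlim (x y : X) : ∃ a ∈ Set.Icc (-(D * ‖x‖ * ‖y‖)) (D * ‖x‖ * ‖y‖),
      Tendsto (fun F => b F x y) 𝒰 (𝓝 a) :=
    isCompact_Icc.ultrafilter_le_nhds (𝒰.map fun F => b F x y)
      (le_principal_iff.2 (Eventually.of_forall (f := (𝒰 : Filter (Finset X))) fun F => hbIcc F x y))
  choose B hBIcc hB using hlim
  have hBpos (x : X) : ‖x‖ ^ 2 ≤ B x x :=
    ge_of_tendsto (hB x x) ((hmem x).mono fun F hx => hpos F x hx)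
  let core : InnerProductSpace.Core ℝ X :=
    { inner := B
      conj_inner_symm x y := by
        refine tendsto_nhds_unique (hB y x) ((hB x y).congr' ?_)
        filter_upwards [hmem x, hmem y] with F hx hy using hsymm F x hx y hy
      re_inner_nonneg x := (sq_nonneg _).trans (hBpos x)
      add_left x y z := by
        refine tendsto_nhds_unique (hB (x + y) z) (((hB x z).add (hB y z)).congr' ?_)
        filter_upwards [hmem x, hmem y, hmem z] with F hx hy hz using (hadd F x hx y hy z hz).symm
      smul_left x y r := by
        refine tendsto_nhds_unique (hB (r • x) y) (((hB x y).const_mul r).congr' ?_)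
        filter_upwards [hmem x, hmem y] with F hx hy using (hsmul F r x hx y hy).symm
      definite x hx := by
        have h1 : ‖x‖ ^ 2 ≤ 0 := (hBpos x).trans_eq hx
        simpa using h1.antisymm (sq_nonneg _) }
  exact exists_hilbertSpace_of_inner_core core (LinearEquiv.refl ℝ X) hBpos fun x =>
    (hBIcc x x).2.trans_eq (by rw [mul_assoc, sq])

end

/-- Lindenstrauss–Tzafriri theorem: if `X` is an infinite-dimensional Banach space in
which every closed subspace is complemented, then `X` is topologically isomorphic to a
Hilbert space. -/
theorem lindenstrauss_tzafriri {X : Type u} [NormedAddCommGroup X] [NormedSpace ℝ X]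
    [CompleteSpace X] (hinf : ¬ FiniteDimensional ℝ X)
    (hcompl : ∀ Y : Submodule ℝ X, IsClosed (Y : Set X) → Y.ClosedComplemented) :
    ∃ (H : Type u) (_ : NormedAddCommGroup H) (_ : InnerProductSpace ℝ H)
      (_ : CompleteSpace H), Nonempty (X ≃L[ℝ] H) := by
  obtain ⟨c, hc⟩ := exists_forall_isProjectionImage hcompl
  obtain ⟨D, hD⟩ := exists_forall_euclideanDistortionLE hinf hc
  exact exists_hilbertSpace_of_euclideanDistortionLE hD
end

section
/- Pelczynski's theorem: every infinite-dimensional complemented closed subspace of ℓ₁ is topologically isomorphic to ℓ₁. -/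
noncomputable section

namespace lp

section Lift

variable {ι : Type*} {E F : Type*} [NormedAddCommGroup E] [NormedSpace ℝ E]
  [NormedAddCommGroup F] [NormedSpace ℝ F]

omit [NormedSpace ℝ E] in
/-- The norm of an element of `ℓ¹` is the sum of the norms of its coordinates. -/
theorem hasSum_norm_one (x : lp (fun _ : ι => E) 1) : HasSum (fun i => ‖x i‖) ‖x‖ := by
  simpa using lp.hasSum_norm (p := 1) (by simp) x

theorem summable_apply_of_norm_le [CompleteSpace F] (T : ι → E →L[ℝ] F) {C : ℝ}
    (hT : ∀ i, ‖T i‖ ≤ C) (x : lp (fun _ : ι => E) 1) : Summable fun i => T i (x i) :=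
  .of_norm_bounded ((hasSum_norm_one x).summable.mul_left C) fun i => (T i).le_of_opNorm_le (hT i) _

/-- The operator on `ℓ¹(ι, E)` induced by a uniformly bounded family of operators on `E`. -/
def lift [CompleteSpace F] (T : ι → E →L[ℝ] F) (C : ℝ) (hT : ∀ i, ‖T i‖ ≤ C) :
    lp (fun _ : ι => E) 1 →L[ℝ] F :=
  LinearMap.mkContinuous
    { toFun x := ∑' i, T i (x i)
      map_add' x y := by
        simp only [lp.coeFn_add, Pi.add_apply, map_add]
        exact (summable_apply_of_norm_le T hT x).tsum_add (summable_apply_of_norm_le T hT y)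
      map_smul' c x := by
        simp only [lp.coeFn_smul, Pi.smul_apply, map_smul, RingHom.id_apply]
        exact (summable_apply_of_norm_le T hT x).tsum_const_smul c }
    C fun x => tsum_of_norm_bounded ((hasSum_norm_one x).mul_left C)
      fun i => (T i).le_of_opNorm_le (hT i) _

@[simp]
theorem lift_single [CompleteSpace F] [DecidableEq ι] (T : ι → E →L[ℝ] F) (C : ℝ)
    (hT : ∀ i, ‖T i‖ ≤ C) (i : ι) (x : E) : lift T C hT (lp.single 1 i x) = T i x := by
  change ∑' j, T j (lp.single (E := fun _ => E) 1 i x j) = T i x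
  rw [tsum_eq_single i, lp.single_apply_self]
  intro j hj
  rw [lp.single_apply_ne _ _ _ hj, map_zero]

theorem opNorm_le_of_forall_single [DecidableEq ι] (T : lp (fun _ : ι => E) 1 →L[ℝ] F) {C : ℝ}
    (hC : 0 ≤ C) (hT : ∀ i x, ‖T (lp.single 1 i x)‖ ≤ C * ‖x‖) : ‖T‖ ≤ C := by
  refine T.opNorm_le_bound hC fun x => ?_
  have h := (lp.hasSum_single ENNReal.one_ne_top x).map T T.continuous
  rw [← h.tsum_eq]
  exact tsum_of_norm_bounded ((hasSum_norm_one x).mul_left C) fun i => hT i _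

theorem norm_singleContinuousLinearMap_le [DecidableEq ι] (i : ι) :
    ‖singleContinuousLinearMap ℝ (fun _ : ι => E) 1 i‖ ≤ 1 :=
  ContinuousLinearMap.opNorm_le_bound _ zero_le_one fun x => by
    simp [lp.norm_single zero_lt_one]

/-- Two operators on `ℓ¹` agree if they agree on vectors supported at one index. -/
theorem clm_ext_single [DecidableEq ι] {S T : lp (fun _ : ι => E) 1 →L[ℝ] F}
    (h : ∀ i x, S (lp.single 1 i x) = T (lp.single 1 i x)) : S = T :=
  lp.ext_continuousLinearMap ENNReal.one_ne_top fun i => ContinuousLinearMap.ext fun x => h i x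

end Lift

section Equiv

variable {E F : Type*} [NormedAddCommGroup E] [NormedSpace ℝ E] [CompleteSpace E]
  [NormedAddCommGroup F] [NormedSpace ℝ F] [CompleteSpace F]

theorem norm_comp_le_of_norm_le_one {G₁ G₂ G₃ : Type*} [NormedAddCommGroup G₁] [NormedSpace ℝ G₁]
    [NormedAddCommGroup G₂] [NormedSpace ℝ G₂] [NormedAddCommGroup G₃] [NormedSpace ℝ G₃]
    {S : G₂ →L[ℝ] G₃} (hS : ‖S‖ ≤ 1) (T : G₁ →L[ℝ] G₂) : ‖S.comp T‖ ≤ ‖T‖ :=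
  (S.opNorm_comp_le T).trans (mul_le_of_le_one_left (norm_nonneg _) hS)

/-- The operator on `ℓ¹` acting coordinatewise by a fixed operator. -/
def mapOne (T : E →L[ℝ] F) : lp (fun _ : ℕ => E) 1 →L[ℝ] lp (fun _ : ℕ => F) 1 :=
  lift (fun i => (singleContinuousLinearMap ℝ (fun _ => F) 1 i).comp T) ‖T‖
    fun i => norm_comp_le_of_norm_le_one (norm_singleContinuousLinearMap_le i) T

omit [CompleteSpace E] in
@[simp]
theorem mapOne_single (T : E →L[ℝ] F) (i : ℕ) (x : E) :
    mapOne T (lp.single 1 i x) = lp.single 1 i (T x) := by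
  simp [mapOne]

/-- Isomorphic spaces have isomorphic `ℓ¹`-sums. -/
def congrOne (e : E ≃L[ℝ] F) : lp (fun _ : ℕ => E) 1 ≃L[ℝ] lp (fun _ : ℕ => F) 1 :=
  .equivOfInverse (mapOne e) (mapOne e.symm)
    (fun x => DFunLike.congr_fun (clm_ext_single (S := (mapOne (e.symm : F →L[ℝ] E)).comp
      (mapOne (e : E →L[ℝ] F))) (T := .id ℝ _) (by simp)) x)
    (fun x => DFunLike.congr_fun (clm_ext_single (S := (mapOne (e : E →L[ℝ] F)).comp
      (mapOne (e.symm : F →L[ℝ] E))) (T := .id ℝ _) (by simp)) x)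

variable (E F) in
/-- `ℓ¹`-sums commute with products. -/
def prodOne : lp (fun _ : ℕ => E × F) 1 ≃L[ℝ] lp (fun _ : ℕ => E) 1 × lp (fun _ : ℕ => F) 1 :=
  .equivOfInverse ((mapOne (.fst ℝ E F)).prod (mapOne (.snd ℝ E F)))
    ((mapOne (.inl ℝ E F)).coprod (mapOne (.inr ℝ E F)))
    (fun x => DFunLike.congr_fun (clm_ext_single
      (S := ((mapOne (.inl ℝ E F)).coprod (mapOne (.inr ℝ E F))).comp
        ((mapOne (.fst ℝ E F)).prod (mapOne (.snd ℝ E F)))) (T := .id ℝ _)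
      (by simp [← lp.single_add])) x)
    (fun x => DFunLike.congr_fun (ContinuousLinearMap.prod_ext
      (f := ((mapOne (.fst ℝ E F)).prod (mapOne (.snd ℝ E F))).comp
        ((mapOne (.inl ℝ E F)).coprod (mapOne (.inr ℝ E F)))) (g := .id ℝ _)
      (clm_ext_single (by simp)) (clm_ext_single (by simp))) x)

/-- The right shift on `ℓ¹`. -/
def shiftOne : lp (fun _ : ℕ => E) 1 →L[ℝ] lp (fun _ : ℕ => E) 1 :=
  lift (fun i => singleContinuousLinearMap ℝ (fun _ => E) 1 (i + 1)) 1
    fun i => norm_singleContinuousLinearMap_le (i + 1)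

/-- The left shift on `ℓ¹`. -/
def unshiftOne : lp (fun _ : ℕ => E) 1 →L[ℝ] lp (fun _ : ℕ => E) 1 :=
  lift (fun i => Nat.casesOn i 0 (singleContinuousLinearMap ℝ (fun _ => E) 1)) 1
    fun i => by cases i <;> simp [norm_singleContinuousLinearMap_le]

omit [CompleteSpace E] in
theorem evalCLM_apply_eq (i : ℕ) (x : lp (fun _ : ℕ => E) 1) :
    evalCLM ℝ (fun _ : ℕ => E) 1 i x = x i := rfl

variable (E) in
/-- Splitting off the first summand of an `ℓ¹`-sum. -/
def consOne : lp (fun _ : ℕ => E) 1 ≃L[ℝ] E × lp (fun _ : ℕ => E) 1 :=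
  .equivOfInverse ((evalCLM ℝ (fun _ => E) 1 0).prod unshiftOne)
    ((singleContinuousLinearMap ℝ (fun _ => E) 1 0).coprod shiftOne)
    (fun x => DFunLike.congr_fun (clm_ext_single
      (S := ((singleContinuousLinearMap ℝ (fun _ => E) 1 0).coprod shiftOne).comp
        ((evalCLM ℝ (fun _ => E) 1 0).prod unshiftOne)) (T := .id ℝ _)
      (fun i x => by cases i <;> simp [shiftOne, unshiftOne, evalCLM_apply_eq])) x)
    (fun x => DFunLike.congr_fun (ContinuousLinearMap.prod_ext
      (f := ((evalCLM ℝ (fun _ => E) 1 0).prod unshiftOne).comp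
        ((singleContinuousLinearMap ℝ (fun _ => E) 1 0).coprod shiftOne)) (g := .id ℝ _)
      (by ext x <;> simp [unshiftOne, evalCLM_apply_eq])
      (clm_ext_single (by simp [shiftOne, unshiftOne, evalCLM_apply_eq]))) x)

variable (E) in
/-- Currying: `ℓ¹(ℕ, E)` is isomorphic to `ℓ¹(ℕ, ℓ¹(ℕ, E))`. -/
def curryOne : lp (fun _ : ℕ => E) 1 ≃L[ℝ] lp (fun _ : ℕ => lp (fun _ : ℕ => E) 1) 1 :=
  let S : lp (fun _ : ℕ => E) 1 →L[ℝ] lp (fun _ : ℕ => lp (fun _ : ℕ => E) 1) 1 :=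
    lift (fun n => (singleContinuousLinearMap ℝ (fun _ => lp (fun _ : ℕ => E) 1) 1 n.unpair.1).comp
      (singleContinuousLinearMap ℝ (fun _ => E) 1 n.unpair.2)) 1 fun n =>
        (norm_comp_le_of_norm_le_one (norm_singleContinuousLinearMap_le _) _).trans
          (norm_singleContinuousLinearMap_le _)
  let T : lp (fun _ : ℕ => lp (fun _ : ℕ => E) 1) 1 →L[ℝ] lp (fun _ : ℕ => E) 1 :=
    lift (fun i => lift (fun j => singleContinuousLinearMap ℝ (fun _ => E) 1 (Nat.pair i j)) 1
      fun j => norm_singleContinuousLinearMap_le _) 1 fun i =>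
        opNorm_le_of_forall_single _ zero_le_one fun j x => by simp [lp.norm_single zero_lt_one]
  .equivOfInverse S T
    (fun x => DFunLike.congr_fun (clm_ext_single (S := T.comp S) (T := .id ℝ _)
      (by simp [S, T])) x)
    (fun x => DFunLike.congr_fun (clm_ext_single (S := S.comp T) (T := .id ℝ _)
      (fun i => DFunLike.congr_fun (clm_ext_single
        (S := (S.comp T).comp (singleContinuousLinearMap ℝ (fun _ => lp (fun _ : ℕ => E) 1) 1 i))
        (T := singleContinuousLinearMap ℝ (fun _ => lp (fun _ : ℕ => E) 1) 1 i)
        (by simp [S, T])))) x)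

end Equiv

end lp

end

/-- Pełczyński's decomposition method: if `X` is isomorphic to its own `ℓ¹`-sum, then a
complemented subspace of `X` containing a complemented copy of `X` is isomorphic to `X`. -/
noncomputable def ContinuousLinearEquiv.pelczynskiDecomposition {X M N Z : Type*}
    [NormedAddCommGroup X] [NormedSpace ℝ X] [CompleteSpace X]
    [NormedAddCommGroup M] [NormedSpace ℝ M] [CompleteSpace M]
    [NormedAddCommGroup N] [NormedSpace ℝ N] [CompleteSpace N]
    [AddCommGroup Z] [Module ℝ Z] [TopologicalSpace Z]
    (e : X ≃L[ℝ] lp (fun _ : ℕ => X) 1) (f : X ≃L[ℝ] M × N) (g : M ≃L[ℝ] X × Z) :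
    M ≃L[ℝ] X :=
  let sq : X ≃L[ℝ] X × X :=
    e.trans ((lp.consOne X).trans ((ContinuousLinearEquiv.refl ℝ X).prodCongr e.symm))
  let absorbX : M ≃L[ℝ] X × M :=
    g.trans ((sq.prodCongr (.refl ℝ Z)).trans ((ContinuousLinearEquiv.prodAssoc ℝ X X Z).trans
      ((ContinuousLinearEquiv.refl ℝ X).prodCongr g.symm)))
  let split : X ≃L[ℝ] lp (fun _ : ℕ => M) 1 × lp (fun _ : ℕ => N) 1 :=
    e.trans ((lp.congrOne f).trans (lp.prodOne M N))
  let absorbM : X ≃L[ℝ] M × X :=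
    split.trans (((lp.consOne M).prodCongr (.refl ℝ _)).trans
      ((ContinuousLinearEquiv.prodAssoc ℝ M _ _).trans
        ((ContinuousLinearEquiv.refl ℝ M).prodCongr split.symm)))
  absorbX.trans ((ContinuousLinearEquiv.prodComm ℝ X M).trans absorbM.symm)

/-- An infinite-dimensional subspace of `ℓ¹` contains a unit vector vanishing on the first `n`
coordinates. -/
theorem exists_mem_norm_eq_one_forall_lt_eq_zero {M : Submodule ℝ (lp (fun _ : ℕ => ℝ) 1)}
    (hinf : ¬ FiniteDimensional ℝ M) (n : ℕ) :
    ∃ y ∈ M, ‖y‖ = 1 ∧ ∀ i < n, y i = 0 := by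
  let R : M →ₗ[ℝ] (Fin n → ℝ) :=
    LinearMap.pi fun i => (lp.evalCLM ℝ (fun _ : ℕ => ℝ) 1 (i : ℕ)).toLinearMap.comp M.subtype
  have hR : ¬ Function.Injective R := fun h => hinf (FiniteDimensional.of_injective R h)
  rw [← LinearMap.ker_eq_bot, Submodule.eq_bot_iff] at hR
  push Not at hR
  obtain ⟨z, hz, hz0⟩ := hR
  refine ⟨(‖(z : lp (fun _ : ℕ => ℝ) 1)‖⁻¹ • z : M), Subtype.prop _, ?_, fun i hi => ?_⟩
  · exact norm_smul_inv_norm (𝕜 := ℝ) (by simpa using hz0)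
  · have : (z : lp (fun _ : ℕ => ℝ) 1) i = 0 := congr_fun hz ⟨i, hi⟩
    simp [this]

/-- A sequence of almost disjointly supported unit vectors in `ℓ¹` spans a complemented copy of
`ℓ¹`: the coordinates of `y k` vanish before `n k`, and are small in norm from `n (k + 1)` on. -/
theorem exists_clm_norm_sub_le {y : ℕ → lp (fun _ : ℕ => ℝ) 1} {n : ℕ → ℕ} (hn : StrictMono n)
    (hn0 : n 0 = 0) (hy : ∀ k, ‖y k‖ = 1) (hzero : ∀ k, ∀ i < n k, y k i = 0) {ε : ℝ}
    (htail : ∀ k, ‖∑ i ∈ Finset.range (n (k + 1)), lp.single 1 i (y k i) - y k‖ ≤ ε) :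
    ∃ Q : lp (fun _ : ℕ => ℝ) 1 →L[ℝ] lp (fun _ : ℕ => ℝ) 1,
      ∀ k, ‖lp.single 1 k 1 - Q (y k)‖ ≤ 2 * ε := by
  have hblock : ∀ i, ∃ k, n k ≤ i ∧ i < n (k + 1) := fun i => by
    induction i with
    | zero => exact ⟨0, hn0.le, hn0.symm.trans_lt (hn (Nat.lt_succ_self 0))⟩
    | succ i ih =>
      obtain ⟨k, hk, hk'⟩ := ih
      rcases (Nat.succ_le_of_lt hk').lt_or_eq with h | h
      · exact ⟨k, by omega, h⟩
      · exact ⟨k + 1, h.ge, h.trans_lt (hn (Nat.lt_succ_self _))⟩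
  choose b hb hb' using hblock
  have hb_eq : ∀ k i, n k ≤ i → i < n (k + 1) → b i = k := fun k i h h' => by
    have h₁ := hn.lt_iff_lt.1 ((hb i).trans_lt h')
    have h₂ := hn.lt_iff_lt.1 (h.trans_lt (hb' i))
    omega
  have hsign : ∀ r : ℝ, ‖(SignType.sign r : ℝ)‖ ≤ 1 := fun r => by
    rcases lt_trichotomy r 0 with h | h | h <;> simp [h]
  let c : ℕ → ℝ := fun i => SignType.sign (y (b i) i)
  have hT : ∀ i, ‖c i • lp.singleContinuousLinearMap ℝ (fun _ : ℕ => ℝ) 1 (b i)‖ ≤ 1 := fun i => by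
    rw [norm_smul]
    exact mul_le_one₀ (hsign _) (norm_nonneg _) (lp.norm_singleContinuousLinearMap_le _)
  let Q := lp.lift (fun i => c i • lp.singleContinuousLinearMap ℝ (fun _ : ℕ => ℝ) 1 (b i)) 1 hT
  have hQ : ‖Q‖ ≤ 1 := LinearMap.mkContinuous_norm_le _ zero_le_one _
  refine ⟨Q, fun k => ?_⟩
  set u : lp (fun _ : ℕ => ℝ) 1 := ∑ i ∈ Finset.range (n (k + 1)), lp.single 1 i (y k i) with hu
  have hnorm : ‖u‖ = ∑ i ∈ Finset.range (n (k + 1)), ‖y k i‖ := by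
    simpa using lp.norm_sum_single (p := 1) (by simp) (y k) (Finset.range (n (k + 1)))
  have hQu : Q u = ‖u‖ • lp.single 1 k 1 := by
    rw [hnorm, Finset.sum_smul, hu, map_sum]
    refine Finset.sum_congr rfl fun i hi => ?_
    rcases lt_or_ge i (n k) with h | h
    · simp [hzero k i h]
    · obtain rfl := hb_eq k i h (Finset.mem_range.1 hi)
      simp only [Q, c, lp.lift_single, _root_.smul_apply,
        lp.singleContinuousLinearMap_apply, ← lp.single_smul, smul_eq_mul, mul_one,
        sign_mul_self, Real.norm_eq_abs]
  have h₁ : ‖(1 - ‖u‖) • (lp.single 1 k 1 : lp (fun _ : ℕ => ℝ) 1)‖ ≤ ε := by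
    have h := (abs_norm_sub_norm_le u (y k)).trans (htail k)
    rw [hy k] at h
    rwa [norm_smul, lp.norm_single zero_lt_one, norm_one, mul_one, Real.norm_eq_abs, abs_sub_comm]
  have h₂ : ‖Q (u - y k)‖ ≤ ε :=
    ((Q.le_of_opNorm_le hQ _).trans_eq (one_mul _)).trans (htail k)
  calc ‖lp.single 1 k 1 - Q (y k)‖
      = ‖(1 - ‖u‖) • (lp.single 1 k 1 : lp (fun _ : ℕ => ℝ) 1) + Q (u - y k)‖ := by
        rw [map_sub, hQu, sub_smul, one_smul]; congr 1; abel
    _ ≤ 2 * ε := (norm_add_le _ _).trans (by linarith)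

/-- An infinite-dimensional closed subspace of `ℓ¹` contains a complemented copy of `ℓ¹`. -/
theorem exists_rightInverse_of_infinite_dimensional {M : Submodule ℝ (lp (fun _ : ℕ => ℝ) 1)}
    [CompleteSpace M] (hinf : ¬ FiniteDimensional ℝ M) :
    ∃ (S : M →L[ℝ] lp (fun _ : ℕ => ℝ) 1) (J : lp (fun _ : ℕ => ℝ) 1 →L[ℝ] M),
      Function.RightInverse J S := by
  choose z hzM hz hz0 using exists_mem_norm_eq_one_forall_lt_eq_zero hinf
  have htail : ∀ m, ∃ N, m < N ∧
      ‖∑ i ∈ Finset.range N, lp.single 1 i (z m i) - z m‖ ≤ 1 / 8 := fun m => by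
    have h := (lp.hasSum_single ENNReal.one_ne_top (z m)).tendsto_sum_nat
    obtain ⟨N, hN, hmN⟩ := ((h.eventually (Metric.closedBall_mem_nhds _ (by norm_num :
      (0 : ℝ) < 1 / 8))).and (Filter.eventually_gt_atTop m)).exists
    exact ⟨N, hmN, by simpa [dist_eq_norm] using hN⟩
  choose N hN hN' using htail
  let n : ℕ → ℕ := fun k => N^[k] 0
  have hsucc : ∀ k, n (k + 1) = N (n k) := fun k => Function.iterate_succ_apply' N k 0
  obtain ⟨Q, hQ⟩ := exists_clm_norm_sub_le (y := fun k => z (n k)) (n := n)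
    (strictMono_nat_of_lt_succ fun k => (hsucc k).symm ▸ hN (n k)) rfl (fun k => hz _)
    (fun k => hz0 _) (ε := 1 / 8) (fun k => (hsucc k).symm ▸ hN' (n k))
  let J := lp.lift (fun k => ContinuousLinearMap.toSpanSingleton ℝ (⟨z (n k), hzM _⟩ : M)) 1
    fun k => by simp [hz]
  let S := Q.comp M.subtypeL
  have hSJ : ‖1 - S.comp J‖ < 1 := by
    refine (lp.opNorm_le_of_forall_single _ (C := 1 / 4) (by norm_num) fun k x => ?_).trans_lt
      (by norm_num)
    have hx : (1 - S.comp J) (lp.single 1 k x) = x • (lp.single 1 k 1 - Q (z (n k))) := by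
      simp [S, J, smul_sub, ← lp.single_smul]
    rw [hx, norm_smul, mul_comm]
    gcongr
    exact (hQ k).trans (by norm_num)
  obtain ⟨U, hU⟩ := isUnit_one_sub_of_norm_lt_one hSJ
  rw [sub_sub_cancel] at hU
  refine ⟨S, J.comp (U⁻¹ : (lp (fun _ : ℕ => ℝ) 1 →L[ℝ] lp (fun _ : ℕ => ℝ) 1)ˣ).val, fun x => ?_⟩
  have h := DFunLike.congr_fun U.mul_inv x
  rwa [hU] at h

/-- Pelczynski's theorem: every infinite-dimensional complemented closed subspace of `ℓ₁`
is topologically isomorphic to `ℓ₁`. -/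
theorem pelczynski_complemented_subspace_of_l1
    (M : Submodule ℝ (lp (fun _ : ℕ => ℝ) 1))
    (hclosed : IsClosed (M : Set (lp (fun _ : ℕ => ℝ) 1)))
    (hinf : ¬ FiniteDimensional ℝ M) (hcompl : M.ClosedComplemented) :
    Nonempty (M ≃L[ℝ] lp (fun _ : ℕ => ℝ) 1) := by
  have : CompleteSpace M := hclosed.completeSpace_coe
  obtain ⟨P, hP⟩ := hcompl
  obtain ⟨S, J, hSJ⟩ := exists_rightInverse_of_infinite_dimensional hinf
  exact ⟨.pelczynskiDecomposition (lp.curryOne ℝ) (.equivOfRightInverse P M.subtypeL hP)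
    (.equivOfRightInverse S J hSJ)⟩
end

section
/- Lindenstrauss' theorem: every infinite-dimensional complemented closed subspace of ℓ∞ is topologically isomorphic to ℓ∞ (i.e., ℓ∞ is prime). -/
open scoped ENNReal

/-- A real-valued set function which is monotone and subadditive. -/
structure IsSubmeasure {α : Type*} (s : Set α → ℝ) : Prop where
  mono : Monotone s
  union_le : ∀ A B, s (A ∪ B) ≤ s A + s B

/-- A set function is exhaustive if it takes arbitrarily small values along every sequence of
pairwise disjoint sets. -/
def IsExhaustive {α : Type*} (s : Set α → ℝ) : Prop :=
  ∀ E : ℕ → Set α, Pairwise (fun i j => Disjoint (E i) (E j)) → ∀ ε > 0, ∃ n, s (E n) < ε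

section SetFunctions

variable {α ι : Type*} {s : Set α → ℝ}

theorem IsExhaustive.empty_nonpos (hs : IsExhaustive s) : s ∅ ≤ 0 :=
  le_of_forall_pos_lt_add fun ε hε => by
    obtain ⟨_, h⟩ := hs (fun _ => ∅) (fun _ _ _ => disjoint_bot_left) ε hε
    simpa using h

theorem IsSubmeasure.biUnion_le (hs : IsSubmeasure s) (h0 : s ∅ ≤ 0) (F : Finset ι)
    (A : ι → Set α) : s (⋃ i ∈ F, A i) ≤ ∑ i ∈ F, s (A i) := by
  classical
  induction F using Finset.induction_on with
  | empty => simpa using h0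
  | insert a F ha ih =>
    rw [Finset.set_biUnion_insert, Finset.sum_insert ha]
    linarith [hs.union_le (A a) (⋃ i ∈ F, A i)]

theorem IsExhaustive.eventually_diff_lt (hs : IsSubmeasure s) (he : IsExhaustive s)
    {E : ℕ → Set α} (hE : Monotone E) {ε : ℝ} (hε : 0 < ε) :
    ∀ᶠ n in Filter.atTop, ∀ m, s (E m \ E n) < ε := by
  suffices ∃ n, ∀ m, n ≤ m → s (E m \ E n) < ε by
    obtain ⟨n, hn⟩ := this
    filter_upwards [Filter.eventually_ge_atTop n] with k hk m
    refine (hs.mono ?_).trans_lt (hn (max m k) (hk.trans (le_max_right _ _)))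
    exact Set.sdiff_subset_sdiff (hE (le_max_left _ _)) (hE hk)
  by_contra! h
  choose g hg hgε using h
  have hmono : Monotone fun i => g^[i] 0 := monotone_nat_of_le_succ fun i => by
    rw [Function.iterate_succ_apply']
    exact hg _
  have hdisj : ∀ i j, i < j →
      Disjoint (E (g (g^[i] 0)) \ E (g^[i] 0)) (E (g (g^[j] 0)) \ E (g^[j] 0)) := by
    intro i j hij
    refine Set.disjoint_left.2 fun x hx hx' => hx'.2 (hE ?_ hx.1)
    rw [← Function.iterate_succ_apply' g]
    exact hmono hij
  obtain ⟨n, hn⟩ := he (fun i => E (g (g^[i] 0)) \ E (g^[i] 0))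
    (fun i j hij => hij.lt_or_gt.elim (hdisj i j) fun h => (hdisj j i h).symm) ε hε
  exact (hgε _).not_gt hn

/-- A family of submeasures dominated by an exhaustive submeasure is uniformly absolutely
continuous with respect to finitely many of its members. -/
theorem IsExhaustive.exists_finset_uniform (hs : IsSubmeasure s) (he : IsExhaustive s)
    {ν : ι → Set α → ℝ} (hν : ∀ i, IsSubmeasure (ν i)) (hle : ∀ i A, ν i A ≤ s A)
    {ε : ℝ} (hε : 0 < ε) :
    ∃ F : Finset ι, ∃ δ > 0, ∀ A, (∀ i ∈ F, ν i A < δ) → ∀ i, ν i A < ε := by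
  classical
  by_contra! h
  obtain ⟨f, hfP, hfr⟩ := exists_seq_of_forall_finset_exists
    (fun x : ι × Set α × ℕ => ε ≤ ν x.1 x.2.1)
    (fun x y => ν x.1 y.2.1 < (1 / 2) ^ y.2.2 ∧ x.2.2 < y.2.2) (fun S _ => by
      obtain ⟨A, hA, j, hj⟩ := h (S.image Prod.fst)
        ((1 / 2) ^ (S.sup (fun x => x.2.2) + 1)) (by positivity)
      refine ⟨(j, A, S.sup (fun x => x.2.2) + 1), hj, fun x hx => ⟨?_, ?_⟩⟩
      · exact hA _ (Finset.mem_image_of_mem _ hx)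
      · exact Nat.lt_succ_of_le (Finset.le_sup (f := fun x : ι × Set α × ℕ => x.2.2) hx))
  have hN : StrictMono fun n => (f n).2.2 := fun m n hmn => (hfr m n hmn).2
  set j : ℕ → ι := fun n => (f n).1
  set A : ℕ → Set α := fun n => (f n).2.1
  have hsmall : ∀ m n, m < n → ν (j m) (A n) ≤ (1 / 2) ^ n := fun m n hmn =>
    (hfr m n hmn).1.le.trans (pow_le_pow_of_le_one (by norm_num) (by norm_num) (hN.id_le n))
  have h0 : s ∅ ≤ 0 := he.empty_nonpos
  have hν0 : ∀ i, ν i ∅ ≤ 0 := fun i => (hle i ∅).trans h0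
  let E : ℕ → ℕ → Set α := fun n m => ⋃ i ∈ Finset.Ico n m, A i
  have hE : ∀ n, Monotone (E n) := fun n m m' hm =>
    Set.biUnion_subset_biUnion_left fun i hi => by
      simp only [Finset.mem_coe, Finset.mem_Ico] at hi ⊢
      omega
  have hM : ∀ n, ∃ M > n, ∀ m, s (E n m \ E n M) < ε / 8 * (1 / 2) ^ n := fun n =>
    ((Filter.eventually_gt_atTop n).and
      (he.eventually_diff_lt hs (hE n) (by positivity))).exists
  choose M hMn hMs using hM
  let F : ℕ → Set α := fun n => E n (M n)
  let G : ℕ → Set α := fun n => ⋂ i ∈ Finset.range (n + 1), F i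
  have hG : Antitone G := fun n m hnm => Set.biInter_subset_biInter_left fun i hi => by
    simp only [Finset.mem_coe, Finset.mem_range] at hi ⊢
    omega
  have hGF : ∀ n, G n ⊆ F n := fun n => Set.biInter_subset_of_mem (by simp)
  have hAF : ∀ n, A n ⊆ F n := fun n =>
    Set.subset_biUnion_of_mem (u := A) (by simpa using hMn n)
  have hFE : ∀ n, ∀ i ≤ n, F n ⊆ E i (M n) := fun n i hi =>
    Set.biUnion_subset_biUnion_left fun k hk => by
      simp only [Finset.mem_coe, Finset.mem_Ico] at hk ⊢
      omega
  have hFG : ∀ n, s (F n \ G n) ≤ ε / 4 := fun n => by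
    have h1 : F n \ G n = ⋃ i ∈ Finset.range (n + 1), F n \ F i := by
      simp only [G, Set.sdiff_iInter]
    calc s (F n \ G n) ≤ ∑ i ∈ Finset.range (n + 1), s (F n \ F i) := by
          rw [h1]; exact hs.biUnion_le h0 _ _
      _ ≤ ∑ i ∈ Finset.range (n + 1), ε / 8 * (1 / 2) ^ i := Finset.sum_le_sum fun i hi =>
          (hs.mono (Set.sdiff_subset_sdiff_left
            (hFE n i (by simpa [Nat.lt_succ_iff] using hi)))).trans
            (hMs i (M n)).le
      _ ≤ ε / 4 := by
          rw [← Finset.mul_sum]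
          nlinarith [sum_geometric_two_le (n + 1)]
  have hνF : ∀ n m, n < m → ν (j n) (F m) ≤ 2 * (1 / 2) ^ m := fun n m hnm => by
    calc ν (j n) (F m) ≤ ∑ i ∈ Finset.Ico m (M m), ν (j n) (A i) := (hν _).biUnion_le (hν0 _) _ _
      _ ≤ ∑ i ∈ Finset.Ico m (M m), (1 / 2 : ℝ) ^ i := Finset.sum_le_sum fun i hi =>
          hsmall _ _ (hnm.trans_le (Finset.mem_Ico.1 hi).1)
      _ = (1 / 2) ^ m * ∑ i ∈ Finset.range (M m - m), (1 / 2 : ℝ) ^ i := by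
          rw [Finset.sum_Ico_eq_sum_range, Finset.mul_sum]
          simp only [pow_add]
      _ ≤ 2 * (1 / 2) ^ m := by
          rw [mul_comm]
          gcongr
          exact sum_geometric_two_le _
  obtain ⟨n, hn⟩ := (he.eventually_diff_lt hs (E := fun n => (G n)ᶜ)
    (fun n m hnm => Set.compl_subset_compl.2 (hG hnm)) (show 0 < ε / 4 by positivity)).exists
  obtain ⟨m, hm, hnm⟩ : ∃ m, (1 / 2 : ℝ) ^ m < ε / 8 ∧ n < m :=
    (((tendsto_pow_atTop_nhds_zero_of_lt_one (by norm_num) (by norm_num)).eventually_lt_const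
      (show 0 < ε / 8 by positivity)).and (Filter.eventually_gt_atTop n)).exists
  have hGG : s (G n \ G m) < ε / 4 := by
    simpa [Set.sdiff_eq, Set.inter_comm] using hn m
  have h1 : ν (j n) (F n) ≤ ν (j n) (F n \ G n) + ν (j n) (G n) :=
    ((hν _).mono (Set.subset_sdiff_union _ _)).trans ((hν _).union_le _ _)
  have h2 : ν (j n) (G n) ≤ ν (j n) (G n \ G m) + ν (j n) (G m) :=
    ((hν _).mono (Set.subset_sdiff_union _ _)).trans ((hν _).union_le _ _)
  have h3 : ε ≤ ν (j n) (F n) := (hfP n).trans ((hν _).mono (hAF n))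
  have h4 := (hν (j n)).mono (hGF m)
  linarith [hνF n m hnm, hFG n, hle (j n) (F n \ G n), hle (j n) (G n \ G m)]

/-- Rosenthal's lemma on uniformly bounded sequences of finitely additive measures on `ℕ`. -/
theorem exists_infinite_forall_diff_singleton_lt {m : ℕ → Set ℕ → ℝ} (hm0 : ∀ n A, 0 ≤ m n A)
    (hm : ∀ n A B, Disjoint A B → m n (A ∪ B) = m n A + m n B)
    {C ε : ℝ} (hC : ∀ n, m n Set.univ ≤ C) (hε : 0 < ε) :
    ∃ S : Set ℕ, S.Infinite ∧ ∀ n ∈ S, m n (S \ {n}) < ε := by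
  have hmono : ∀ n A B, A ⊆ B → m n A ≤ m n B := fun n A B hAB => by
    have := hm n A (B \ A) Set.disjoint_sdiff_right
    rw [Set.union_sdiff_cancel hAB] at this
    linarith [hm0 n (B \ A)]
  suffices H : ∀ K : ℕ, ∀ S : Set ℕ, S.Infinite → (∀ n ∈ S, m n S ≤ K * ε) →
      ∃ S : Set ℕ, S.Infinite ∧ ∀ n ∈ S, m n (S \ {n}) < ε by
    obtain ⟨K, hK⟩ := exists_nat_ge (C / ε)
    exact H K Set.univ Set.infinite_univ fun n _ => (hC n).trans ((div_le_iff₀ hε).1 hK)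
  intro K
  induction K with
  | zero =>
    intro S hS h
    refine ⟨S, hS, fun n hn => ?_⟩
    have := h n hn
    simp only [Nat.cast_zero, zero_mul] at this
    exact ((hmono n _ _ Set.sdiff_subset).trans this).trans_lt hε
  | succ K ih =>
    intro S hS h
    let e : ℕ × ℕ → ℕ := fun p => hS.natEmbedding S (Nat.pair p.1 p.2)
    have he : ∀ p q, e p = e q → p = q := fun p q hpq => by
      have := (hS.natEmbedding S).injective (Subtype.ext hpq)
      rw [Nat.pair_eq_pair] at this
      exact Prod.ext this.1 this.2
    have heS : ∀ p, e p ∈ S := fun p => (hS.natEmbedding S _).2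
    let B : ℕ → Set ℕ := fun p => Set.range fun q => e (p, q)
    have hB : ∀ p, (B p).Infinite := fun p =>
      Set.infinite_range_of_injective fun q q' hq => (Prod.ext_iff.1 (he _ _ hq)).2
    by_cases hex : ∃ p, ∀ n ∈ B p, m n (B p \ {n}) < ε
    · obtain ⟨p, hp⟩ := hex
      exact ⟨B p, hB p, hp⟩
    push Not at hex
    choose k hkB hk using hex
    choose q hq using hkB
    simp only at hq
    refine ih (Set.range k) (Set.infinite_range_of_injective fun p p' hp => ?_) ?_
    · rw [← hq, ← hq] at hp
      exact (Prod.ext_iff.1 (he _ _ hp)).1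
    · rintro _ ⟨p, rfl⟩
      have hd : Disjoint (Set.range k) (B p \ {k p}) := by
        refine Set.disjoint_left.2 ?_
        rintro _ ⟨p', rfl⟩ ⟨⟨r, hr⟩, hne⟩
        simp only at hr
        rw [← hq p'] at hr
        obtain rfl : p = p' := (Prod.ext_iff.1 (he _ _ hr)).1
        exact hne rfl
      have hsub : Set.range k ∪ (B p \ {k p}) ⊆ S := by
        rintro _ (⟨p', rfl⟩ | ⟨⟨r, rfl⟩, -⟩)
        · rw [← hq]; exact heS _
        · exact heS _
      have h1 := hmono (k p) _ _ hsub
      rw [hm _ _ _ hd] at h1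
      have h2 := h (k p) (by rw [← hq]; exact heS _)
      push_cast at h2
      linarith [hk p]

end SetFunctions

namespace lp

section Lift

variable {ι κ V F G : Type*} [NormedAddCommGroup V] [NormedSpace ℝ V] [NormedAddCommGroup F]
  [NormedSpace ℝ F] [NormedAddCommGroup G] [NormedSpace ℝ G]

/-- A uniformly bounded family of operators induces an operator into `ℓ^∞`. -/
noncomputable def inftyLift (T : ι → V →L[ℝ] F) (C : ℝ) (hT : ∀ i, ‖T i‖ ≤ C) :
    V →L[ℝ] lp (fun _ : ι => F) ∞ :=
  have hb : ∀ v i, ‖T i v‖ ≤ max C 0 * ‖v‖ := fun v i =>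
    (T i).le_of_opNorm_le ((hT i).trans (le_max_left _ _)) v
  LinearMap.mkContinuous
    { toFun := fun v => ⟨fun i => T i v, memℓp_infty ⟨max C 0 * ‖v‖, by
        rintro _ ⟨i, rfl⟩
        exact hb v i⟩⟩
      map_add' := fun v w => lp.ext (funext fun i => (T i).map_add v w)
      map_smul' := fun c v => lp.ext (funext fun i => (T i).map_smul c v) }
    (max C 0) fun v => lp.norm_le_of_forall_le (by positivity) (hb v)

@[simp]
theorem inftyLift_apply (T : ι → V →L[ℝ] F) (C : ℝ) (hT : ∀ i, ‖T i‖ ≤ C) (v : V) (i : ι) :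
    inftyLift T C hT v i = T i v := rfl

theorem norm_inftyLift_le (T : ι → V →L[ℝ] F) {C : ℝ} (hT : ∀ i, ‖T i‖ ≤ C) (hC : 0 ≤ C) :
    ‖inftyLift T C hT‖ ≤ C :=
  ContinuousLinearMap.opNorm_le_bound _ hC fun v =>
    lp.norm_le_of_forall_le (by positivity) fun i => (T i).le_of_opNorm_le (hT i) v

/-- Evaluation at a coordinate, as a continuous linear map on `ℓ^∞`. -/
noncomputable def inftyEval (F : Type*) [NormedAddCommGroup F] [NormedSpace ℝ F] (i : ι) :
    lp (fun _ : ι => F) ∞ →L[ℝ] F :=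
  LinearMap.mkContinuous
    { toFun := fun x => x i
      map_add' := fun _ _ => rfl
      map_smul' := fun _ _ => rfl } 1 fun x => by
    rw [one_mul]
    exact lp.norm_apply_le_norm ENNReal.top_ne_zero x i

@[simp]
theorem inftyEval_apply (i : ι) (x : lp (fun _ : ι => F) ∞) : inftyEval F i x = x i := rfl

theorem norm_inftyEval_le (i : ι) : ‖inftyEval (ι := ι) F i‖ ≤ 1 :=
  LinearMap.mkContinuous_norm_le _ zero_le_one _

/-- An operator acting coordinatewise. -/
noncomputable def inftyMap (T : F →L[ℝ] G) :
    lp (fun _ : ι => F) ∞ →L[ℝ] lp (fun _ : ι => G) ∞ :=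
  inftyLift (fun i => T ∘L inftyEval F i) ‖T‖ fun i =>
    (T.opNorm_comp_le _).trans (mul_le_of_le_one_right (norm_nonneg _) (norm_inftyEval_le i))

@[simp]
theorem inftyMap_apply (T : F →L[ℝ] G) (x : lp (fun _ : ι => F) ∞) (i : ι) :
    inftyMap T x i = T (x i) := rfl

/-- Coordinatewise application of a continuous linear equivalence. -/
noncomputable def inftyCongr (e : F ≃L[ℝ] G) :
    lp (fun _ : ι => F) ∞ ≃L[ℝ] lp (fun _ : ι => G) ∞ :=
  .equivOfInverse (inftyMap e) (inftyMap e.symm)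
    (fun x => lp.ext (funext fun i => by simp)) fun x => lp.ext (funext fun i => by simp)

/-- `ℓ^∞` of a product is the product of the `ℓ^∞` spaces. -/
noncomputable def inftyProd :
    lp (fun _ : ι => F × G) ∞ ≃L[ℝ] lp (fun _ : ι => F) ∞ × lp (fun _ : ι => G) ∞ :=
  .equivOfInverse
    ((inftyMap (.fst ℝ F G)).prod (inftyMap (.snd ℝ F G)))
    ((inftyMap (.inl ℝ F G)).coprod (inftyMap (.inr ℝ F G)))
    (fun x => lp.ext (funext fun i => by simp))
    (fun x => Prod.ext (lp.ext (funext fun i => by simp)) (lp.ext (funext fun i => by simp)))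

/-- A coordinate can be split off from `ℓ^∞`. -/
noncomputable def inftyCons :
    (F × lp (fun _ : ℕ => F) ∞) ≃L[ℝ] lp (fun _ : ℕ => F) ∞ :=
  .equivOfInverse
    (inftyLift (fun n => Nat.casesOn n (.fst ℝ F _) fun k => inftyEval F k ∘L .snd ℝ F _) 1 (by
      rintro (_ | k)
      · exact ContinuousLinearMap.norm_fst_le ..
      · refine (ContinuousLinearMap.opNorm_comp_le _ _).trans ?_
        exact mul_le_one₀ (norm_inftyEval_le k) (norm_nonneg _)
          (ContinuousLinearMap.norm_snd_le ..)))
    ((inftyEval F 0).prod (inftyLift (fun n => inftyEval F (n + 1)) 1 fun n =>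
      norm_inftyEval_le _))
    (fun x => Prod.ext (by simp) (lp.ext (funext fun i => by simp)))
    (fun x => lp.ext (funext fun i => by cases i <;> simp))

/-- Currying for `ℓ^∞`. -/
noncomputable def inftyCurry (e : ι × κ ≃ κ) :
    lp (fun _ : κ => F) ∞ ≃L[ℝ] lp (fun _ : ι => lp (fun _ : κ => F) ∞) ∞ :=
  .equivOfInverse
    (inftyLift (fun i => inftyLift (fun j => inftyEval F (e (i, j))) 1
      fun j => norm_inftyEval_le _) 1 fun i => norm_inftyLift_le _ _ zero_le_one)
    (inftyLift (fun k => inftyEval F (e.symm k).2 ∘L inftyEval _ (e.symm k).1) 1 fun k =>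
      (ContinuousLinearMap.opNorm_comp_le _ _).trans
        (mul_le_one₀ (norm_inftyEval_le _) (norm_nonneg _) (norm_inftyEval_le _)))
    (fun x => lp.ext (funext fun i => by simp))
    (fun x => lp.ext (funext fun i => lp.ext (funext fun j => by simp)))

end Lift

/-- Pełczyński's decomposition argument: a complemented subspace of `ℓ^∞` through which the
identity of `ℓ^∞` factors is isomorphic to `ℓ^∞`. -/
theorem nonempty_equiv_of_retracts {Y Z M : Type*} [NormedAddCommGroup Y] [NormedSpace ℝ Y]
    [AddCommGroup Z] [Module ℝ Z] [TopologicalSpace Z] [NormedAddCommGroup M] [NormedSpace ℝ M]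
    (e : lp (fun _ : ℕ => ℝ) ∞ ≃L[ℝ] M × Y) (e' : M ≃L[ℝ] lp (fun _ : ℕ => ℝ) ∞ × Z) :
    Nonempty (M ≃L[ℝ] lp (fun _ : ℕ => ℝ) ∞) := by
  let X := lp (fun _ : ℕ => ℝ) ∞
  let c : X ≃L[ℝ] lp (fun _ : ℕ => X) ∞ := inftyCurry Nat.pairEquiv
  let d : X ≃L[ℝ] X × X := (c.trans inftyCons.symm).trans
    ((ContinuousLinearEquiv.refl ℝ X).prodCongr c.symm)
  let a : X ≃L[ℝ] lp (fun _ : ℕ => M) ∞ × lp (fun _ : ℕ => Y) ∞ :=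
    (c.trans (inftyCongr e)).trans inftyProd
  let f : (M × X) ≃L[ℝ] X :=
    (((ContinuousLinearEquiv.refl ℝ M).prodCongr a).trans
      (ContinuousLinearEquiv.prodAssoc ℝ M _ _).symm).trans
      ((inftyCons.prodCongr (.refl ℝ _)).trans a.symm)
  let g : M ≃L[ℝ] X × M :=
    ((e'.trans (d.prodCongr (.refl ℝ Z))).trans (ContinuousLinearEquiv.prodAssoc ℝ X X Z)).trans
      ((ContinuousLinearEquiv.refl ℝ X).prodCongr e'.symm)
  exact ⟨(g.trans (ContinuousLinearEquiv.prodComm ℝ X M)).trans f⟩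

open scoped lp

section Restriction

variable {W : Type*} [NormedAddCommGroup W] [NormedSpace ℝ W]

open Classical in
/-- Multiplication by the indicator function of a set, as an operator on `ℓ^∞`. -/
noncomputable def restrict (E : Set ℕ) : ℓ^∞(ℕ, ℝ) →L[ℝ] ℓ^∞(ℕ, ℝ) :=
  inftyLift (fun i => if i ∈ E then inftyEval ℝ i else 0) 1 fun i => by
    split_ifs
    · exact norm_inftyEval_le i
    · simp

@[simp]
theorem restrict_apply (E : Set ℕ) (x : ℓ^∞(ℕ, ℝ)) (i : ℕ) :
    restrict E x i = E.indicator x i := by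
  by_cases hi : i ∈ E <;> simp [restrict, hi]

theorem norm_restrict_le (E : Set ℕ) : ‖restrict E‖ ≤ 1 :=
  norm_inftyLift_le _ _ zero_le_one

theorem norm_comp_restrict_le (T : ℓ^∞(ℕ, ℝ) →L[ℝ] W) (E : Set ℕ) :
    ‖T ∘L restrict E‖ ≤ ‖T‖ :=
  (T.opNorm_comp_le _).trans (mul_le_of_le_one_right (norm_nonneg _) (norm_restrict_le E))

theorem restrict_comp_restrict (E F : Set ℕ) :
    restrict E ∘L restrict F = restrict (E ∩ F) := by
  ext x i
  by_cases hE : i ∈ E <;> by_cases hF : i ∈ F <;> simp [hE, hF]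

theorem restrict_union_of_disjoint {A B : Set ℕ} (h : Disjoint A B) :
    restrict (A ∪ B) = restrict A + restrict B := by
  ext x i
  simp [Set.indicator_union_of_disjoint h]

theorem isSubmeasure_norm_comp_restrict (T : ℓ^∞(ℕ, ℝ) →L[ℝ] W) :
    IsSubmeasure fun E => ‖T ∘L restrict E‖ := by
  have hmono : Monotone fun E => ‖T ∘L restrict E‖ := fun A B hAB => by
    have : T ∘L restrict A = (T ∘L restrict B) ∘L restrict A := by
      rw [ContinuousLinearMap.comp_assoc, restrict_comp_restrict, Set.inter_eq_right.2 hAB]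
    simp only [this]
    exact norm_comp_restrict_le _ _
  refine ⟨hmono, fun A B => ?_⟩
  rw [← Set.union_sdiff_self, restrict_union_of_disjoint Set.disjoint_sdiff_right,
    ContinuousLinearMap.comp_add]
  exact (norm_add_le _ _).trans (add_le_add le_rfl (hmono Set.sdiff_subset))

end Restriction

section Positive

/-- Every continuous functional on `ℓ^∞` is dominated by a positive functional of no larger
mass. -/
theorem exists_dominating (μ : ℓ^∞(ℕ, ℝ) →L[ℝ] ℝ) :
    ∃ L : ℓ^∞(ℕ, ℝ) →ₗ[ℝ] ℝ, L 1 ≤ ‖μ‖ ∧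
      ∀ x y : ℓ^∞(ℕ, ℝ), (∀ i, |y i| ≤ x i) → |μ y| ≤ L x := by
  let cone : PointedCone ℝ (ℓ^∞(ℕ, ℝ) × ℓ^∞(ℕ, ℝ)) :=
    { carrier := {p | ∀ i, |p.2 i| ≤ p.1 i}
      add_mem' := fun {p q} hp hq i => (abs_add_le _ _).trans (add_le_add (hp i) (hq i))
      zero_mem' := fun i => by simp
      smul_mem' := fun c p hp i => by
        change |c.1 * p.2 i| ≤ c.1 * p.1 i
        rw [abs_mul, abs_of_nonneg c.2]
        exact mul_le_mul_of_nonneg_left (hp i) c.2 }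
  let f : (ℓ^∞(ℕ, ℝ) × ℓ^∞(ℕ, ℝ)) →ₗ[ℝ] ℝ :=
    (‖μ‖ • (inftyEval ℝ 0).toLinearMap).coprod μ.toLinearMap
  let D : Submodule ℝ (ℓ^∞(ℕ, ℝ) × ℓ^∞(ℕ, ℝ)) := (Submodule.span ℝ {1}).prod ⊤
  obtain ⟨g, hgf, hg⟩ := riesz_extension cone ⟨D, f.domRestrict D⟩ (by
      rintro ⟨⟨z, y⟩, hz, _⟩ hmem
      have hzy : ∀ i, |y i| ≤ z i := hmem
      obtain ⟨t, rfl⟩ := Submodule.mem_span_singleton.1 hz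
      have hy : ∀ i, |y i| ≤ t := fun i => by simpa using hzy i
      have hyt : ‖y‖ ≤ t := lp.norm_le_of_forall_le ((abs_nonneg _).trans (hy 0)) hy
      have h1 := (abs_le.1 (μ.le_opNorm_of_le hyt)).1
      change 0 ≤ ‖μ‖ * (t * 1) + μ y
      linarith) (by
      rintro ⟨z, y⟩
      refine ⟨⟨(‖z‖ • 1, -y), Submodule.smul_mem _ _ (Submodule.mem_span_singleton_self _),
        trivial⟩, fun i => ?_⟩
      have := (abs_le.1 (lp.norm_apply_le_norm ENNReal.top_ne_zero z i)).1
      change |-y i + y i| ≤ ‖z‖ * 1 + z i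
      rw [neg_add_cancel, abs_zero]
      linarith)
  have hg1 : g (1, 0) = ‖μ‖ := by
    have := hgf ⟨(1, 0), Submodule.mem_span_singleton_self _, trivial⟩
    refine this.trans ?_
    change ‖μ‖ * 1 + μ 0 = ‖μ‖
    simp
  have hg2 : ∀ y, g (0, y) = μ y := fun y => by
    have := hgf ⟨(0, y), Submodule.zero_mem _, trivial⟩
    refine this.trans ?_
    change ‖μ‖ * 0 + μ y = μ y
    simp
  have hadd : ∀ x y, g (x, y) = g (x, 0) + μ y := fun x y => by
    rw [← hg2, ← map_add]
    simp
  refine ⟨g ∘ₗ LinearMap.inl ℝ _ _, hg1.le, fun x y hxy => ?_⟩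
  have h1 := hg (x, y) hxy
  have h2 := hg (x, -y) fun i => by
    change |-y i| ≤ x i
    rw [abs_neg]
    exact hxy i
  rw [hadd] at h1 h2
  rw [map_neg] at h2
  exact abs_le.2 ⟨by simp; linarith, by simp; linarith⟩

variable {μ : ℓ^∞(ℕ, ℝ) →L[ℝ] ℝ} {L : ℓ^∞(ℕ, ℝ) →ₗ[ℝ] ℝ}

theorem monotone_of_nonneg (hL : ∀ x : ℓ^∞(ℕ, ℝ), (∀ i, 0 ≤ x i) → 0 ≤ L x)
    {x y : ℓ^∞(ℕ, ℝ)} (h : ∀ i, x i ≤ y i) : L x ≤ L y := by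
  have := hL (y - x) fun i => sub_nonneg.2 (h i)
  rwa [map_sub, sub_nonneg] at this

theorem norm_comp_restrict_le_of_dominating
    (hL : ∀ x y : ℓ^∞(ℕ, ℝ), (∀ i, |y i| ≤ x i) → |μ y| ≤ L x) (E : Set ℕ) :
    ‖μ ∘L restrict E‖ ≤ L (restrict E 1) := by
  refine ContinuousLinearMap.opNorm_le_bound _ ((abs_nonneg (μ 0)).trans (hL _ _ fun i => ?_))
    fun x => ?_
  · by_cases hi : i ∈ E <;> simp [hi]
  · rw [mul_comm, ← smul_eq_mul, ← map_smul]
    refine hL _ _ fun i => ?_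
    have := lp.norm_apply_le_norm ENNReal.top_ne_zero x i
    by_cases hi : i ∈ E
    · simpa [hi] using this
    · simp [hi]

/-- Grothendieck's bound for the dimension of a space of bounded sequences whose norm is dominated
by a Hilbertian seminorm `x ↦ L (x ^ 2) ^ (1 / 2)`. -/
theorem finrank_le_of_sq_norm_le {W : Type*} [AddCommGroup W] [Module ℝ W]
    [FiniteDimensional ℝ W] (ev : W →ₗ[ℝ] ℓ^∞(ℕ, ℝ)) (hev : Function.Injective ev)
    (hL : ∀ x : ℓ^∞(ℕ, ℝ), (∀ i, 0 ≤ x i) → 0 ≤ L x) {K : ℝ} (hK : 0 < K)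
    (h : ∀ x, ‖ev x‖ ^ 2 ≤ K * L (ev x * ev x)) : Module.finrank ℝ W ≤ K * L 1 := by
  obtain ⟨B, hBapp⟩ : ∃ B : LinearMap.BilinForm ℝ W, ∀ x y, B x y = L (ev x * ev y) :=
    ⟨((LinearMap.mul ℝ ℓ^∞(ℕ, ℝ)).compr₂ L).compl₁₂ ev ev, fun _ _ => rfl⟩
  have hBnorm : ∀ x, ‖ev x‖ ^ 2 ≤ K * B x x := fun x => by rw [hBapp]; exact h x
  obtain ⟨v, hv⟩ := LinearMap.BilinForm.exists_orthogonal_basis (B := B)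
    ⟨fun x y => by simp [hBapp, mul_comm]⟩
  have hpos : ∀ j, 0 < B (v j) (v j) := fun j => by
    have h1 : 0 < ‖ev (v j)‖ ^ 2 := by
      have : ev (v j) ≠ 0 := fun h0 => v.ne_zero j (hev (h0.trans (map_zero ev).symm))
      positivity
    exact pos_of_mul_pos_right (h1.trans_le (hBnorm _)) hK.le
  have hpt : ∀ k, ∑ j, (B (v j) (v j))⁻¹ * (ev (v j) k * ev (v j) k) ≤ K := fun k => by
    set S := ∑ j, (B (v j) (v j))⁻¹ * (ev (v j) k * ev (v j) k) with hS
    let x : W := ∑ j, ((B (v j) (v j))⁻¹ * ev (v j) k) • v j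
    have hxk : ev x k = S := by
      have : inftyEval ℝ k (ev x) = S := by
        simp only [x, map_sum, map_smul, inftyEval_apply, smul_eq_mul, hS]
        exact Finset.sum_congr rfl fun j _ => by ring
      exact this
    have hBx : B x x = S := by
      simp only [x, map_sum, LinearMap.sum_apply, map_smul, LinearMap.smul_apply, smul_eq_mul, hS]
      refine Finset.sum_congr rfl fun j _ => ?_
      rw [Finset.sum_eq_single j]
      · field_simp [(hpos j).ne']
      · intro i _ hij
        rw [hv hij]
        simp
      · simp
    have hS0 : 0 ≤ S := Finset.sum_nonneg fun j _ =>
      mul_nonneg (inv_nonneg.2 (hpos j).le) (mul_self_nonneg _)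
    have h1 : S ^ 2 ≤ K * S := by
      have h2 := lp.norm_apply_le_norm ENNReal.top_ne_zero (ev x) k
      rw [hxk, Real.norm_of_nonneg hS0] at h2
      calc S ^ 2 ≤ ‖ev x‖ ^ 2 := pow_le_pow_left₀ hS0 h2 2
        _ ≤ K * S := hBx ▸ hBnorm x
    by_contra! hlt
    nlinarith
  have key : L (∑ j, (B (v j) (v j))⁻¹ • (ev (v j) * ev (v j))) ≤ L (K • 1) := by
    refine monotone_of_nonneg hL fun k => ?_
    have h1 : (∑ j, (B (v j) (v j))⁻¹ • (ev (v j) * ev (v j))) k =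
        ∑ j, (B (v j) (v j))⁻¹ * (ev (v j) k * ev (v j) k) := by
      rw [← inftyEval_apply, map_sum]
      exact Finset.sum_congr rfl fun j _ => map_smul (inftyEval ℝ k) _ _
    have h2 : (K • (1 : ℓ^∞(ℕ, ℝ))) k = K := mul_one K
    rw [h1, h2]
    exact hpt k
  rw [map_sum, map_smul, smul_eq_mul] at key
  have hone : ∀ j, L ((B (v j) (v j))⁻¹ • (ev (v j) * ev (v j))) = 1 := fun j => by
    rw [map_smul, smul_eq_mul, ← hBapp, inv_mul_cancel₀ (hpos j).ne']
  simp only [hone, Finset.sum_const, Finset.card_univ, Fintype.card_fin, nsmul_eq_mul, mul_one]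
    at key
  exact key

/-- A subspace of `ℓ^∞` whose norm is dominated by a Hilbertian seminorm is finite dimensional. -/
theorem finiteDimensional_of_sq_norm_le (M : Submodule ℝ ℓ^∞(ℕ, ℝ))
    (hL : ∀ x : ℓ^∞(ℕ, ℝ), (∀ i, 0 ≤ x i) → 0 ≤ L x) {K : ℝ} (hK : 0 < K)
    (h : ∀ x ∈ M, ‖x‖ ^ 2 ≤ K * L (x * x)) : FiniteDimensional ℝ M := by
  obtain ⟨n, hn⟩ := exists_nat_ge (K * L 1)
  have : Module.Free ℝ M := Module.Free.of_divisionRing ℝ M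
  suffices Module.rank ℝ M ≤ n from
    Module.rank_lt_aleph0_iff.1 (this.trans_lt Cardinal.natCast_lt_aleph0)
  refine rank_le fun s hs => ?_
  let W : Submodule ℝ M := Submodule.span ℝ (s : Set M)
  have : FiniteDimensional ℝ W := FiniteDimensional.span_finset ℝ s
  have hW := finrank_le_of_sq_norm_le (M.subtype ∘ₗ W.subtype)
    (M.injective_subtype.comp W.injective_subtype) hL hK fun x => h _ x.1.2
  rw [finrank_span_finset_eq_card hs] at hW
  exact_mod_cast hW.trans hn

end Positive

/-- A subspace of `ℓ^∞` is finite dimensional if it is the range of a projection whose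
semivariation is exhaustive. -/
theorem finiteDimensional_of_isExhaustive (M : Submodule ℝ ℓ^∞(ℕ, ℝ))
    (P : ℓ^∞(ℕ, ℝ) →L[ℝ] M) (hP : ∀ x : M, P x = x)
    (he : IsExhaustive fun E => ‖P ∘L restrict E‖) : FiniteDimensional ℝ M := by
  choose D hD1 hD using exists_dominating
  let ν : {f : StrongDual ℝ M // ‖f‖ ≤ 1} → Set ℕ → ℝ := fun f E => ‖(f.1 ∘L P) ∘L restrict E‖
  obtain ⟨F, δ, hδ, hF⟩ := he.exists_finset_uniform (isSubmeasure_norm_comp_restrict P)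
    (ν := ν) (fun f => isSubmeasure_norm_comp_restrict _) (fun f E =>
      (f.1.opNorm_comp_le (P ∘L restrict E)).trans
        (mul_le_of_le_one_left (P ∘L restrict E).opNorm_nonneg f.2)) (ε := 1 / 2) (by norm_num)
  have hDpos : ∀ μ, ∀ x : ℓ^∞(ℕ, ℝ), (∀ i, 0 ≤ x i) → 0 ≤ D μ x := fun μ x hx =>
    (abs_nonneg _).trans (hD μ x 0 fun i => by simpa using hx i)
  let L : ℓ^∞(ℕ, ℝ) →ₗ[ℝ] ℝ := ∑ f ∈ F, D (f.1 ∘L P)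
  have hLapp : ∀ x, L x = ∑ f ∈ F, D (f.1 ∘L P) x := fun x => by simp [L]
  have hL : ∀ x : ℓ^∞(ℕ, ℝ), (∀ i, 0 ≤ x i) → 0 ≤ L x := fun x hx => by
    rw [hLapp]
    exact Finset.sum_nonneg fun f _ => hDpos _ x hx
  obtain ⟨η, hη, hPη⟩ : ∃ η > 0, ‖P‖ * η ≤ 1 / 2 := by
    refine ⟨1 / (2 * (‖P‖ + 1)), by positivity, ?_⟩
    rw [mul_one_div, div_le_div_iff₀ (by positivity) (by norm_num)]
    linarith
  refine finiteDimensional_of_sq_norm_le M hL (K := (δ * η ^ 2)⁻¹) (by positivity) fun x hx => ?_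
  rw [← div_eq_inv_mul, le_div_iff₀ (by positivity)]
  by_contra! hlt
  have hsq : ∀ i, 0 ≤ (x * x) i := fun i => mul_self_nonneg _
  have hx0 : 0 < ‖x‖ := (norm_nonneg x).lt_of_ne fun h0 => by
    rw [← h0] at hlt
    linarith [hL _ hsq]
  let A : Set ℕ := {i | η * ‖x‖ ≤ |x i|}
  have hA : ∀ f, ν f A < 1 / 2 := hF A fun f hf => by
    calc ν f A ≤ D (f.1 ∘L P) (restrict A 1) :=
          norm_comp_restrict_le_of_dominating (hD _) A
      _ ≤ D (f.1 ∘L P) (((η * ‖x‖) ^ 2)⁻¹ • (x * x)) := by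
          refine monotone_of_nonneg (hDpos _) fun i => ?_
          change _ ≤ ((η * ‖x‖) ^ 2)⁻¹ * (x i * x i)
          by_cases hi : i ∈ A
          · rw [← div_eq_inv_mul, le_div_iff₀ (by positivity)]
            have h1 : η * ‖x‖ ≤ |x i| := hi
            simp only [restrict_apply, hi, Set.indicator_of_mem, infty_coeFn_one, Pi.one_apply,
              one_mul]
            rw [← abs_mul_abs_self (x i), ← sq]
            exact pow_le_pow_left₀ (by positivity) h1 2
          · simp only [restrict_apply, hi, not_false_eq_true, Set.indicator_of_notMem]
            exact mul_nonneg (by positivity) (mul_self_nonneg _)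
      _ = ((η * ‖x‖) ^ 2)⁻¹ * D (f.1 ∘L P) (x * x) := by rw [map_smul, smul_eq_mul]
      _ ≤ ((η * ‖x‖) ^ 2)⁻¹ * L (x * x) := by
          refine mul_le_mul_of_nonneg_left ?_ (by positivity)
          rw [hLapp]
          exact Finset.single_le_sum (f := fun f : {f : StrongDual ℝ M // ‖f‖ ≤ 1} =>
            D (f.1 ∘L P) (x * x)) (fun f _ => hDpos _ _ hsq) hf
      _ < δ := by
          rw [← div_eq_inv_mul, div_lt_iff₀ (by positivity)]
          linarith
  obtain ⟨f, hf1, hfx⟩ := exists_dual_vector'' ℝ (⟨x, hx⟩ : M)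
  have hsplit : x = restrict A x + restrict Aᶜ x := by
    rw [← add_apply, ← restrict_union_of_disjoint disjoint_compl_right]
    ext i
    simp
  have hsmall : ‖restrict Aᶜ x‖ ≤ η * ‖x‖ := lp.norm_le_of_forall_le (by positivity) fun i => by
    by_cases hi : i ∈ A
    · simpa [hi] using (by positivity : 0 ≤ η * ‖x‖)
    · have h1 : |x i| < η * ‖x‖ := not_le.1 hi
      simpa [hi] using h1.le
  have hfP : f (P x) = ‖x‖ := by
    rw [show x = ((⟨x, hx⟩ : M) : ℓ^∞(ℕ, ℝ)) from rfl, hP]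
    exact hfx
  have h1 : f (P (restrict A x)) ≤ ν ⟨f, hf1⟩ A * ‖x‖ :=
    (le_abs_self _).trans (((f ∘L P) ∘L restrict A).le_opNorm x)
  have h2 : f (P (restrict Aᶜ x)) ≤ ‖P‖ * (η * ‖x‖) := by
    refine (le_abs_self _).trans ((f.le_of_opNorm_le hf1 _).trans ?_)
    rw [one_mul]
    exact P.le_opNorm_of_le hsmall
  have h3 : f (P x) = f (P (restrict A x)) + f (P (restrict Aᶜ x)) := by
    rw [← map_add, ← map_add, ← hsplit]
  have h4 := hA ⟨f, hf1⟩
  nlinarith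

/-- Rosenthal's theorem: the identity of `ℓ^∞` factors through every operator on `ℓ^∞` whose
semivariation is not exhaustive. -/
theorem exists_factorization_of_not_isExhaustive {W : Type*} [NormedAddCommGroup W]
    [NormedSpace ℝ W] (T : ℓ^∞(ℕ, ℝ) →L[ℝ] W)
    (hT : ¬ IsExhaustive fun E => ‖T ∘L restrict E‖) :
    ∃ (U : ℓ^∞(ℕ, ℝ) →L[ℝ] W) (R : W →L[ℝ] ℓ^∞(ℕ, ℝ)), ∀ x, R (U x) = x := by
  classical
  unfold IsExhaustive at hT
  push Not at hT
  obtain ⟨E, hE, ε, hε, hEε⟩ := hT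
  have hx : ∀ n, ∃ x, ‖x‖ < 1 ∧ ε / 2 < ‖(T ∘L restrict (E n)) x‖ := fun n =>
    (T ∘L restrict (E n)).exists_lt_apply_of_lt_opNorm ((half_lt_self hε).trans_le (hEε n))
  choose x hx1 hxε using hx
  let y : ℕ → ℓ^∞(ℕ, ℝ) := fun n => restrict (E n) (x n)
  have hy1 : ∀ n i, |y n i| ≤ 1 := fun n i =>
    (lp.norm_apply_le_norm ENNReal.top_ne_zero (y n) i).trans
      (((restrict (E n)).le_of_opNorm_le (norm_restrict_le _) _).trans (by
        rw [one_mul]; exact (hx1 n).le))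
  have hy0 : ∀ n i, i ∉ E n → y n i = 0 := fun n i hi => by simp [y, hi]
  let J : ℓ^∞(ℕ, ℝ) →L[ℝ] ℓ^∞(ℕ, ℝ) := inftyLift
    (fun i => if h : ∃ n, i ∈ E n then y h.choose i • inftyEval ℝ h.choose else 0) 1 fun i => by
      split_ifs with h
      · rw [norm_smul]
        exact mul_le_one₀ (hy1 _ _) (norm_nonneg _) (norm_inftyEval_le _)
      · simp
  have hJ : ∀ a n i, i ∈ E n → J a i = y n i * a n := fun a n i hi => by
    have h : ∃ n, i ∈ E n := ⟨n, hi⟩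
    have hn : h.choose = n := by
      by_contra hne
      exact Set.disjoint_left.1 (hE hne) h.choose_spec hi
    simp [J, h, hn]
  have hJ0 : ∀ a i, (∀ n, i ∉ E n) → J a i = 0 := fun a i hi => by
    simp [J, hi]
  have hJe : ∀ n, J (restrict {n} 1) = y n := fun n => by
    ext i
    by_cases h : ∃ k, i ∈ E k
    · obtain ⟨k, hk⟩ := h
      rw [hJ _ _ _ hk]
      rcases eq_or_ne k n with rfl | hkn
      · simp
      · rw [hy0 n i (Set.disjoint_left.1 (hE hkn) hk)]
        simp [hkn]
    · push Not at h
      rw [hJ0 _ _ h, hy0 n i (h n)]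
  choose f hf1 hf using fun n => exists_dual_vector'' ℝ (T (y n))
  let μ : ℕ → ℓ^∞(ℕ, ℝ) →L[ℝ] ℝ := fun n => f n ∘L (T ∘L J)
  have hμe : ∀ n, μ n (restrict {n} 1) = ‖T (y n)‖ := fun n => by
    simp only [μ, ContinuousLinearMap.comp_apply, hJe]
    exact hf n
  choose D hD1 hD using fun n => exists_dominating (μ n)
  obtain ⟨S, hS, hSε⟩ := exists_infinite_forall_diff_singleton_lt
    (m := fun n A => D n (restrict A 1)) (C := ‖T ∘L J‖) (ε := ε / 4)
    (fun n A => (norm_nonneg _).trans (norm_comp_restrict_le_of_dominating (hD n) A))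
    (fun n A B hAB => by
      rw [restrict_union_of_disjoint hAB, add_apply, map_add])
    (fun n => by
      have h1 : restrict Set.univ 1 = 1 := by
        ext i
        simp
      rw [h1]
      exact (hD1 n).trans (((f n).opNorm_comp_le _).trans
        (mul_le_of_le_one_left (T ∘L J).opNorm_nonneg (hf1 n))))
    (by positivity)
  let φ : ℕ → ℕ := fun n => hS.natEmbedding S n
  have hφ : Function.Injective φ := fun m n h => (hS.natEmbedding S).injective (Subtype.ext h)
  have hφS : ∀ n, φ n ∈ S := fun n => (hS.natEmbedding S n).2
  let Q : ℓ^∞(ℕ, ℝ) →L[ℝ] ℓ^∞(ℕ, ℝ) := inftyLift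
    (Function.extend φ (fun n => inftyEval ℝ n) 0) 1 fun i => by
      by_cases h : ∃ n, φ n = i
      · obtain ⟨n, rfl⟩ := h
        rw [hφ.extend_apply]
        exact norm_inftyEval_le n
      · rw [Function.extend_apply' _ _ _ h]
        simp
  have hQ : ∀ a n, Q a (φ n) = a n := fun a n => by
    simp [Q, hφ.extend_apply]
  have hQ0 : ∀ a i, (∀ n, φ n ≠ i) → Q a i = 0 := fun a i hi => by
    have h : ¬ ∃ n, φ n = i := by simpa using hi
    simp [Q, Function.extend_apply' _ _ _ h]
  have hQ1 : ∀ a, ‖Q a‖ ≤ ‖a‖ := fun a => by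
    simpa using Q.le_of_opNorm_le (norm_inftyLift_le _ _ zero_le_one) a
  have hsplit : ∀ a n, Q a = a n • restrict {φ n} 1 + restrict (S \ {φ n}) (Q a) := fun a n => by
    ext i
    change Q a i = a n * restrict {φ n} 1 i + restrict (S \ {φ n}) (Q a) i
    by_cases hi : ∃ k, φ k = i
    · obtain ⟨k, rfl⟩ := hi
      rcases eq_or_ne k n with rfl | hkn
      · simp [hQ]
      · simp [hφ.ne hkn, hφS k]
    · push Not at hi
      simp [hQ0 a i hi, (hi n).symm, Set.indicator_apply]
  have hc : ∀ n, ε / 2 < ‖T (y n)‖ := hxε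
  let R₀ : W →L[ℝ] ℓ^∞(ℕ, ℝ) := inftyLift (fun n => ‖T (y (φ n))‖⁻¹ • f (φ n)) (ε / 2)⁻¹
    fun n => by
      rw [norm_smul, norm_inv, norm_norm]
      exact (mul_le_of_le_one_right (by positivity) (hf1 _)).trans
        (inv_anti₀ (by positivity) (hc _).le)
  let V : ℓ^∞(ℕ, ℝ) →L[ℝ] ℓ^∞(ℕ, ℝ) := R₀ ∘L (T ∘L J) ∘L Q
  have hV : ‖1 - V‖ ≤ 1 / 2 := by
    refine ContinuousLinearMap.opNorm_le_bound _ (by norm_num) fun a =>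
      lp.norm_le_of_forall_le (by positivity) fun n => ?_
    have hc0 : 0 < ‖T (y (φ n))‖ := (half_pos hε).trans (hc _)
    have h1 : V a n = ‖T (y (φ n))‖⁻¹ * μ (φ n) (Q a) := rfl
    have h2 : μ (φ n) (Q a) = a n * ‖T (y (φ n))‖ + μ (φ n) (restrict (S \ {φ n}) (Q a)) := by
      conv_lhs => rw [hsplit a n]
      rw [map_add, map_smul, hμe, smul_eq_mul]
    have h3 : |μ (φ n) (restrict (S \ {φ n}) (Q a))| ≤ ε / 4 * ‖a‖ :=
      ((μ (φ n) ∘L restrict (S \ {φ n})).le_of_opNorm_le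
        ((norm_comp_restrict_le_of_dominating (hD _) _).trans (hSε _ (hφS n)).le) (Q a)).trans
        (mul_le_mul_of_nonneg_left (hQ1 a) (by positivity))
    have h4 : (1 - V) a n = -(‖T (y (φ n))‖⁻¹ * μ (φ n) (restrict (S \ {φ n}) (Q a))) := by
      change a n - V a n = _
      rw [h1, h2]
      field_simp
      ring
    rw [h4]
    change |_| ≤ _
    rw [abs_neg, abs_mul, abs_inv, abs_norm, ← div_eq_inv_mul, div_le_iff₀ hc0]
    refine h3.trans ?_
    nlinarith [norm_nonneg a, hc (φ n)]
  obtain ⟨V', hV'⟩ : ∃ V', V' * V = 1 := by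
    have := isUnit_one_sub_of_norm_lt_one (hV.trans_lt (by norm_num : (1 / 2 : ℝ) < 1))
    rw [sub_sub_cancel] at this
    exact this.exists_left_inv
  exact ⟨(T ∘L J) ∘L Q, V' ∘L R₀, fun a => DFunLike.congr_fun hV' a⟩

end lp

/-- Lindenstrauss' theorem: every infinite-dimensional complemented closed subspace of
`ℓ∞` is topologically isomorphic to `ℓ∞` (i.e. `ℓ∞` is prime). -/
theorem lindenstrauss_complemented_subspace_of_linfty
    (M : Submodule ℝ (lp (fun _ : ℕ => ℝ) ∞))
    (hclosed : IsClosed (M : Set (lp (fun _ : ℕ => ℝ) ∞)))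
    (hinf : ¬ FiniteDimensional ℝ M) (hcompl : M.ClosedComplemented) :
    Nonempty (M ≃L[ℝ] lp (fun _ : ℕ => ℝ) ∞) := by
  obtain ⟨P, hP⟩ := hcompl
  obtain ⟨U, R, hRU⟩ := lp.exists_factorization_of_not_isExhaustive P fun he =>
    hinf (lp.finiteDimensional_of_isExhaustive M P hP he)
  exact lp.nonempty_equiv_of_retracts
    (ContinuousLinearEquiv.equivOfRightInverse P M.subtypeL hP)
    (ContinuousLinearEquiv.equivOfRightInverse R U hRU)
end

section
/- c₀ is prime: every infinite-dimensional complemented closed subspace of c₀ is topologically isomorphic to c₀. -/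
open Filter Topology

local notation "c₀(" E ")" => ZeroAtInftyContinuousMap ℕ E

namespace CZero

section Basic

variable {E F : Type*} [NormedAddCommGroup E] [NormedAddCommGroup F]

/-- The element of `c₀(E)` given by a sequence tending to zero. -/
def ofTendsto (f : ℕ → E) (hf : Tendsto f cofinite (𝓝 0)) : c₀(E) where
  toFun := f
  continuous_toFun := continuous_of_discreteTopology
  zero_at_infty' := by rwa [cocompact_eq_cofinite]

@[simp]
theorem ofTendsto_apply (f : ℕ → E) (hf : Tendsto f cofinite (𝓝 0)) (n : ℕ) :
    ofTendsto f hf n = f n := rfl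

theorem tendsto_cofinite (f : c₀(E)) : Tendsto f cofinite (𝓝 0) := by
  rw [← cocompact_eq_cofinite]
  exact zero_at_infty f

theorem norm_apply_le (f : c₀(E)) (n : ℕ) : ‖f n‖ ≤ ‖f‖ :=
  f.toBCF.norm_coe_le_norm n

theorem norm_le {f : c₀(E)} {C : ℝ} (hC : 0 ≤ C) : ‖f‖ ≤ C ↔ ∀ n, ‖f n‖ ≤ C :=
  BoundedContinuousFunction.norm_le (f := f.toBCF) hC

theorem finite_le_norm (f : c₀(E)) {ε : ℝ} (hε : 0 < ε) : {n | ε ≤ ‖f n‖}.Finite := by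
  have h := (tendsto_cofinite f).norm
  rw [norm_zero] at h
  simpa [Filter.eventually_cofinite] using h.eventually_lt_const hε

theorem tendsto_zero_of_finite {f : ℕ → E} (h : ∀ ε > 0, {n | ε ≤ ‖f n‖}.Finite) :
    Tendsto f cofinite (𝓝 0) := by
  refine Metric.tendsto_nhds.2 fun ε hε => ?_
  simpa [Filter.eventually_cofinite] using h ε hε

theorem tendsto_unpair (f : c₀(c₀(E))) :
    Tendsto (fun k : ℕ => f k.unpair.1 k.unpair.2) cofinite (𝓝 0) := by
  refine tendsto_zero_of_finite fun ε hε => ?_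
  refine (((finite_le_norm f hε).biUnion fun n _ =>
    (finite_le_norm (f n) hε).image (Nat.pair n))).subset fun k hk => ?_
  refine Set.mem_biUnion (x := k.unpair.1) (le_trans hk (norm_apply_le _ _)) ?_
  rw [Set.mem_image]
  exact ⟨k.unpair.2, hk, by rw [Nat.pair_unpair]⟩

variable [NormedSpace ℝ E] [NormedSpace ℝ F]

/-- Evaluation at an index, as a continuous linear map. -/
noncomputable def eval (n : ℕ) : c₀(E) →L[ℝ] E :=
  LinearMap.mkContinuous
    { toFun := fun f => f n
      map_add' := fun _ _ => rfl
      map_smul' := fun _ _ => rfl } 1 fun f => by simpa using norm_apply_le f n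

@[simp]
theorem eval_apply (n : ℕ) (f : c₀(E)) : eval n f = f n := rfl

/-- Reindexing along a map with finite fibres. -/
noncomputable def precomp (g : ℕ → ℕ) (hg : Tendsto g cofinite cofinite) : c₀(E) →L[ℝ] c₀(E) :=
  LinearMap.mkContinuous
    { toFun := fun f => ofTendsto (fun n => f (g n)) ((tendsto_cofinite f).comp hg)
      map_add' := fun _ _ => rfl
      map_smul' := fun _ _ => rfl } 1 fun f => by
    rw [one_mul]
    exact (norm_le (norm_nonneg f)).2 fun n => norm_apply_le f (g n)

@[simp]
theorem precomp_apply (g : ℕ → ℕ) (hg : Tendsto g cofinite cofinite) (f : c₀(E)) (n : ℕ) :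
    precomp g hg f n = f (g n) := rfl

/-- Applying a continuous linear map to every term of a sequence. -/
noncomputable def postcomp (L : E →L[ℝ] F) : c₀(E) →L[ℝ] c₀(F) :=
  LinearMap.mkContinuous
    { toFun := fun f => ofTendsto (fun n => L (f n)) <| by
        simpa [Function.comp_def] using (L.continuous.tendsto 0).comp (tendsto_cofinite f)
      map_add' := fun f g => by ext n; simp
      map_smul' := fun c f => by ext n; simp } ‖L‖ fun f => by
    refine (norm_le (by positivity)).2 fun n => (L.le_opNorm _).trans ?_
    gcongr
    exact norm_apply_le f n

@[simp]
theorem postcomp_apply (L : E →L[ℝ] F) (f : c₀(E)) (n : ℕ) : postcomp L f n = L (f n) := rfl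

/-- An isomorphism of Banach spaces induces an isomorphism of their `c₀`-sums. -/
noncomputable def congr (e : E ≃L[ℝ] F) : c₀(E) ≃L[ℝ] c₀(F) :=
  ContinuousLinearEquiv.equivOfInverse (postcomp (e : E →L[ℝ] F)) (postcomp (e.symm : F →L[ℝ] E))
    (fun f => by ext n; simp) fun f => by ext n; simp

/-- The isomorphism from the open mapping theorem, with bijectivity stated for functions. -/
noncomputable def equivOfBijective [CompleteSpace E] [CompleteSpace F] (f : E →L[ℝ] F)
    (hf : Function.Bijective f) : E ≃L[ℝ] F :=
  ContinuousLinearEquiv.ofBijective f (LinearMap.ker_eq_bot.2 hf.1) (LinearMap.range_eq_top.2 hf.2)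

variable (E F) in
/-- `c₀(E × F) ≅ c₀(E) × c₀(F)`. -/
noncomputable def prodEquiv [CompleteSpace E] [CompleteSpace F] :
    c₀(E × F) ≃L[ℝ] c₀(E) × c₀(F) :=
  equivOfBijective
    ((postcomp (ContinuousLinearMap.fst ℝ E F)).prod (postcomp (ContinuousLinearMap.snd ℝ E F))) <| by
    constructor
    · intro f g h
      ext1 n
      have h₁ := congrArg (fun p => p.1 n) h
      have h₂ := congrArg (fun p => p.2 n) h
      exact Prod.ext h₁ h₂
    · rintro ⟨f, g⟩
      exact ⟨ofTendsto (fun n => (f n, g n)) ((tendsto_cofinite f).prodMk_nhds (tendsto_cofinite g)),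
        rfl⟩

variable (E) in
/-- `c₀(E) ≅ E × c₀(E)`, splitting off the first term. -/
noncomputable def consEquiv [CompleteSpace E] : c₀(E) ≃L[ℝ] E × c₀(E) :=
  equivOfBijective ((eval 0).prod (precomp Nat.succ Nat.succ_injective.tendsto_cofinite)) <| by
    constructor
    · intro f g h
      ext1 n
      cases n with
      | zero => exact congrArg Prod.fst h
      | succ n => exact congrArg (fun p => p.2 n) h
    · rintro ⟨x, f⟩
      refine ⟨ofTendsto (fun n => Nat.casesOn n x f) ?_, rfl⟩
      rw [Nat.cofinite_eq_atTop, ← tendsto_add_atTop_iff_nat 1, ← Nat.cofinite_eq_atTop]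
      exact tendsto_cofinite f

/-- Flattening a double sequence along the pairing function. -/
noncomputable def flatten : c₀(c₀(E)) →L[ℝ] c₀(E) :=
  LinearMap.mkContinuous
    { toFun := fun f => ofTendsto (fun k => f k.unpair.1 k.unpair.2) (tendsto_unpair f)
      map_add' := fun _ _ => rfl
      map_smul' := fun _ _ => rfl } 1 fun f => by
    rw [one_mul]
    exact (norm_le (norm_nonneg f)).2 fun k =>
      (norm_apply_le (f k.unpair.1) k.unpair.2).trans (norm_apply_le f k.unpair.1)

@[simp]
theorem flatten_apply (f : c₀(c₀(E))) (k : ℕ) : flatten f k = f k.unpair.1 k.unpair.2 := rfl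

theorem pair_injective_right (n : ℕ) : Function.Injective (Nat.pair n) := fun a b h => by
  simpa using h

theorem flatten_bijective : Function.Bijective (flatten : c₀(c₀(E)) →L[ℝ] c₀(E)) := by
  constructor
  · intro f g h
    ext n m
    simpa using DFunLike.congr_fun h (Nat.pair n m)
  · intro g
    suffices h : Tendsto
        (fun n => precomp (Nat.pair n) (pair_injective_right n).tendsto_cofinite g) cofinite (𝓝 0) by
      exact ⟨ofTendsto _ h, by ext k; simp⟩
    refine tendsto_zero_of_finite fun ε hε => ?_
    refine ((finite_le_norm g (half_pos hε)).image fun k => k.unpair.1).subset fun n hn => ?_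
    by_contra hcon
    have hle : ‖precomp (Nat.pair n) (pair_injective_right n).tendsto_cofinite g‖ ≤ ε / 2 := by
      refine (norm_le (half_pos hε).le).2 fun m => ?_
      by_contra! hm
      exact hcon ⟨Nat.pair n m, hm.le, by simp⟩
    have := le_trans hn hle
    linarith

variable (E) in
/-- `c₀(c₀(E)) ≅ c₀(E)`. -/
noncomputable def flattenEquiv [CompleteSpace E] : c₀(c₀(E)) ≃L[ℝ] c₀(E) :=
  equivOfBijective flatten flatten_bijective

end Basic

section Decomposition

variable {X M W Z : Type*} [NormedAddCommGroup X] [NormedSpace ℝ X] [CompleteSpace X]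
  [NormedAddCommGroup M] [NormedSpace ℝ M] [CompleteSpace M]
  [NormedAddCommGroup W] [NormedSpace ℝ W] [CompleteSpace W]
  [NormedAddCommGroup Z] [NormedSpace ℝ Z]

/-- Pełczyński's decomposition method: if `X ≅ c₀(X)`, and each of `X` and `M` is isomorphic to
a complemented subspace of the other, then `M ≅ X`. -/
theorem nonempty_equiv_of_decomposition (e : c₀(X) ≃L[ℝ] X) (eX : X ≃L[ℝ] M × W)
    (eM : M ≃L[ℝ] X × Z) : Nonempty (M ≃L[ℝ] X) := by
  let sq : X ≃L[ℝ] X × X :=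
    e.symm.trans ((consEquiv X).trans ((ContinuousLinearEquiv.refl ℝ X).prodCongr e))
  let sum : X ≃L[ℝ] c₀(M) × c₀(W) := e.symm.trans ((congr eX).trans (prodEquiv M W))
  let absorbed : X ≃L[ℝ] M × X :=
    sum.trans <| ((consEquiv M).prodCongr (.refl ℝ c₀(W))).trans <|
      (ContinuousLinearEquiv.prodAssoc ℝ M c₀(M) c₀(W)).trans <|
        (ContinuousLinearEquiv.refl ℝ M).prodCongr sum.symm
  let absorbing : M ≃L[ℝ] X × M :=
    eM.trans <| (sq.prodCongr (.refl ℝ Z)).trans <|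
      (ContinuousLinearEquiv.prodAssoc ℝ X X Z).trans <|
        (ContinuousLinearEquiv.refl ℝ X).prodCongr eM.symm
  exact ⟨absorbing.trans ((ContinuousLinearEquiv.prodComm ℝ X M).trans absorbed.symm)⟩

/-- Pełczyński's decomposition method, with complemented copies given by operators having a
right inverse. -/
theorem nonempty_equiv_of_rightInverse (e : c₀(X) ≃L[ℝ] X) {P : X →L[ℝ] M} {i : M →L[ℝ] X}
    (hP : Function.RightInverse i P) {B : M →L[ℝ] X} {A : X →L[ℝ] M}
    (hB : Function.RightInverse A B) : Nonempty (M ≃L[ℝ] X) :=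
  nonempty_equiv_of_decomposition e (.equivOfRightInverse P i hP) (.equivOfRightInverse B A hB)

end Decomposition

section Series

variable {E : Type*} [NormedAddCommGroup E] [NormedSpace ℝ E] [CompleteSpace E]

/-- A sequence whose finite linear combinations are bounded by the supremum of the coefficients
defines an operator on `c₀` by summation. -/
theorem exists_hasSum_clm (x : ℕ → E) {K : ℝ} (hK : 0 < K)
    (hx : ∀ (F : Finset ℕ) (t : ℕ → ℝ) (δ : ℝ), 0 ≤ δ → (∀ k ∈ F, |t k| ≤ δ) →
      ‖∑ k ∈ F, t k • x k‖ ≤ K * δ) :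
    ∃ A : c₀(ℝ) →L[ℝ] E, ∀ t : c₀(ℝ), HasSum (fun k => t k • x k) (A t) := by
  have hs (t : c₀(ℝ)) : Summable fun k => t k • x k := by
    refine summable_iff_vanishing_norm.2 fun ε hε => ?_
    have hδ : 0 < ε / (2 * K) := by positivity
    refine ⟨(finite_le_norm t hδ).toFinset, fun F hF => ?_⟩
    refine (hx F t _ hδ.le fun k hk => ?_).trans_lt (b := K * (ε / (2 * K))) ?_
    · have := Finset.disjoint_left.1 hF hk
      simp only [Set.Finite.mem_toFinset, Set.mem_ofPred_eq, not_le] at this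
      exact this.le
    · field_simp
      linarith
  refine ⟨LinearMap.mkContinuous
    { toFun := fun t => ∑' k, t k • x k
      map_add' := fun s t => ?_
      map_smul' := fun c t => ?_ } K fun t => ?_, fun t => (hs t).hasSum⟩
  · simpa [add_smul] using (hs s).tsum_add (hs t)
  · simpa [mul_smul] using (hs t).tsum_const_smul c
  · exact le_of_tendsto (hs t).hasSum.norm <| Eventually.of_forall fun F =>
      hx F t _ (norm_nonneg t) fun k _ => norm_apply_le t k

end Series

section GlidingHump

/-- An infinite-dimensional subspace of `c₀` contains a vector bounded by one, attaining the
value one, whose first `N` terms vanish. -/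
theorem exists_peak (M : Submodule ℝ c₀(ℝ)) (hM : ¬ FiniteDimensional ℝ M) (N : ℕ) :
    ∃ (x : M) (j : ℕ), (∀ i < N, x.1 i = 0) ∧ x.1 j = 1 ∧ ∀ i, |x.1 i| ≤ 1 := by
  let L : M →ₗ[ℝ] (Fin N → ℝ) :=
    LinearMap.pi fun i => (eval (E := ℝ) (i : ℕ)).toLinearMap ∘ₗ M.subtype
  obtain ⟨y, hy, hy0⟩ : ∃ y : M, L y = 0 ∧ y ≠ 0 := by
    by_contra! h
    exact hM (FiniteDimensional.of_injective L fun a b hab =>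
      sub_eq_zero.1 (h _ (by rw [map_sub, hab, sub_self])))
  have hyN (i : ℕ) (hi : i < N) : y.1 i = 0 := congrFun hy ⟨i, hi⟩
  obtain ⟨i₀, hi₀⟩ : ∃ i, y.1 i ≠ 0 := by
    by_contra! h
    exact hy0 (Subtype.ext (ZeroAtInftyContinuousMap.ext h))
  obtain ⟨j, hj⟩ : ∃ j, ∀ i, |y.1 i| ≤ |y.1 j| := by
    refine Continuous.exists_forall_ge' continuous_of_discreteTopology i₀ ?_
    have h := (zero_at_infty y.1).abs
    rw [abs_zero] at h
    exact (h.eventually_lt_const (abs_pos.2 hi₀)).mono fun _ h => h.le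
  have hj0 : 0 < |y.1 j| := (abs_pos.2 hi₀).trans_le (hj i₀)
  refine ⟨(y.1 j)⁻¹ • y, j, fun i hi => ?_, ?_, fun i => ?_⟩
  · simp [hyN i hi]
  · simpa using inv_mul_cancel₀ (abs_pos.1 hj0)
  · simpa [abs_mul, abs_inv, inv_mul_le_iff₀ hj0] using hj i

/-- A gliding-hump sequence in an infinite-dimensional subspace of `c₀`. -/
theorem exists_gliding_hump (M : Submodule ℝ c₀(ℝ)) (hM : ¬ FiniteDimensional ℝ M) :
    ∃ (x : ℕ → M) (j : ℕ → ℕ), StrictMono j ∧ (∀ k, (x k).1 (j k) = 1) ∧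
      (∀ k i, |(x k).1 i| ≤ 1) ∧
      (∀ m k, k ≠ m → |(x k).1 (j m)| ≤ (1 / 4) ^ (k + 1)) ∧
      ∀ i, ∃ m, ∀ k, k ≠ m → |(x k).1 i| ≤ (1 / 4) ^ (k + 1) := by
  have step (N : ℕ) : ∃ (x : M) (j N' : ℕ), N ≤ j ∧ j < N' ∧ (∀ i < N, x.1 i = 0) ∧ x.1 j = 1 ∧
      (∀ i, |x.1 i| ≤ 1) ∧ ∀ i ≥ N', |x.1 i| ≤ (1 / 4) ^ (N + 1) := by
    obtain ⟨x, j, hx, hj, h1⟩ := exists_peak M hM N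
    have h := (tendsto_cofinite x.1).abs
    rw [abs_zero, Nat.cofinite_eq_atTop] at h
    obtain ⟨n, hn⟩ := eventually_atTop.1
      (h.eventually_lt_const (show (0 : ℝ) < (1 / 4) ^ (N + 1) by positivity))
    refine ⟨x, j, max n (j + 1), ?_, by simp, hx, hj, h1,
      fun i hi => (hn i (le_of_max_le_left hi)).le⟩
    by_contra! hlt
    simp [hx j hlt] at hj
  choose x j g hle hlt hzero hone hbd htail using step
  let N : ℕ → ℕ := fun k => g^[k] 0
  have hNs (k : ℕ) : N (k + 1) = g (N k) := Function.iterate_succ_apply' g k 0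
  have hN : StrictMono N := strictMono_nat_of_lt_succ fun k => by
    rw [hNs]
    exact (hle _).trans_lt (hlt _)
  have hblock (m i k : ℕ) (h₁ : N m ≤ i) (h₂ : i < N (m + 1)) (hk : k ≠ m) :
      |(x (N k)).1 i| ≤ (1 / 4) ^ (k + 1) := by
    rcases hk.lt_or_gt with hk | hk
    · refine (htail (N k) i ?_).trans ?_
      · rw [← hNs]
        exact (hN.monotone hk).trans h₁
      · exact pow_le_pow_of_le_one (by norm_num) (by norm_num) (by have := hN.le_apply (x := k); omega)
    · rw [hzero (N k) i (h₂.trans_le (hN.monotone hk))]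
      simp
  refine ⟨fun k => x (N k), fun k => j (N k), strictMono_nat_of_lt_succ fun k => ?_,
    fun k => hone _, fun k => hbd _, fun m k hk => hblock m _ k (hle _) ?_ hk, fun i => ?_⟩
  · refine (hlt _).trans_le ?_
    rw [← hNs]
    exact hle _
  · rw [hNs]
    exact hlt _
  · have hex : ∃ m, i < N (m + 1) := ⟨i, (Nat.lt_succ_self i).trans_le hN.le_apply⟩
    refine ⟨Nat.find hex, fun k hk => hblock _ i k ?_ (Nat.find_spec hex) hk⟩
    rcases h : Nat.find hex with _ | n
    · exact Nat.zero_le i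
    · exact not_lt.1 (Nat.find_min hex (m := n) (by omega))

theorem hasSum_quarter_pow_succ : HasSum (fun k : ℕ => ((1 : ℝ) / 4) ^ (k + 1)) (1 / 3) := by
  have h := (hasSum_geometric_of_lt_one (r := (1 : ℝ) / 4) (by norm_num) (by norm_num)).mul_left
    (1 / 4)
  norm_num at h
  simpa only [pow_succ', one_div, inv_pow] using h

/-- Every infinite-dimensional closed subspace of `c₀` contains a copy of `c₀` that is
complemented. -/
theorem exists_rightInverse (M : Submodule ℝ c₀(ℝ)) [CompleteSpace M]
    (hM : ¬ FiniteDimensional ℝ M) :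
    ∃ (A : c₀(ℝ) →L[ℝ] M) (B : M →L[ℝ] c₀(ℝ)), Function.RightInverse A B := by
  obtain ⟨x, j, hj, hone, hbd, hoff, hblock⟩ := exists_gliding_hump M hM
  obtain ⟨A, hA⟩ := exists_hasSum_clm x (K := 4 / 3) (by norm_num) fun F t δ hδ ht => by
    refine (norm_le (f := (∑ k ∈ F, t k • x k).1) (by positivity)).2 ?_
    intro i
    obtain ⟨m, hm⟩ := hblock i
    have hterm (k : ℕ) : |(x k).1 i| ≤ (1 / 4) ^ (k + 1) + if k = m then 1 else 0 := by
      split_ifs with h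
      · exact (hbd k i).trans (by simp)
      · simpa using hm k h
    have hval : (∑ k ∈ F, t k • x k).1 i = ∑ k ∈ F, t k * (x k).1 i := by
      change (eval i ∘L M.subtypeL) _ = _
      simp [map_sum]
    have hgeom : ∑ k ∈ F, ((1 : ℝ) / 4) ^ (k + 1) ≤ 1 / 3 :=
      sum_le_hasSum F (fun _ _ => by positivity) hasSum_quarter_pow_succ
    have hdelta : ∑ k ∈ F, (if k = m then (1 : ℝ) else 0) ≤ 1 := by
      rw [Finset.sum_ite_eq']
      split_ifs <;> norm_num
    calc ‖(∑ k ∈ F, t k • x k).1 i‖ ≤ ∑ k ∈ F, ‖t k * (x k).1 i‖ := by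
          rw [hval]
          exact norm_sum_le _ _
      _ ≤ ∑ k ∈ F, δ * ((1 / 4) ^ (k + 1) + if k = m then 1 else 0) := by
          refine Finset.sum_le_sum fun k hk => ?_
          rw [norm_mul]
          exact mul_le_mul (ht k hk) (hterm k) (norm_nonneg _) hδ
      _ = (∑ k ∈ F, ((1 : ℝ) / 4) ^ (k + 1) + ∑ k ∈ F, if k = m then (1 : ℝ) else 0) * δ := by
          rw [← Finset.mul_sum, Finset.sum_add_distrib, mul_comm]
      _ ≤ 4 / 3 * δ := by
          gcongr
          linarith
  let B : M →L[ℝ] c₀(ℝ) := precomp j hj.injective.tendsto_cofinite ∘L M.subtypeL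
  have hsmall : ‖1 - B ∘L A‖ < 1 := by
    refine (ContinuousLinearMap.opNorm_le_bound _ (by norm_num : (0 : ℝ) ≤ 1 / 3)
      fun t => ?_).trans_lt (by norm_num)
    refine (norm_le (by positivity)).2 fun m => ?_
    have hsum : HasSum (fun k => t k * (x k).1 (j m)) ((A t).1 (j m)) := by
      simpa using (hA t).mapL (eval (j m) ∘L M.subtypeL)
    have hdiff := (hasSum_ite_eq m (t m)).sub hsum
    have hle := hdiff.norm_le_of_bounded (hasSum_quarter_pow_succ.mul_right ‖t‖) fun k => by
      split_ifs with h
      · subst h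
        simp only [hone, mul_one, sub_self, norm_zero]
        positivity
      · rw [zero_sub, norm_neg, norm_mul, mul_comm]
        exact mul_le_mul (hoff m k h) (norm_apply_le t k) (norm_nonneg _) (by positivity)
    exact hle
  let u : (c₀(ℝ) →L[ℝ] c₀(ℝ))ˣ := Units.oneSub (1 - B ∘L A) hsmall
  have hu : (u : c₀(ℝ) →L[ℝ] c₀(ℝ)) = B ∘L A := sub_sub_cancel 1 (B ∘L A)
  refine ⟨A, (↑u⁻¹ : c₀(ℝ) →L[ℝ] c₀(ℝ)) ∘L B, fun t => ?_⟩
  have h := DFunLike.congr_fun u.inv_mul t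
  rw [hu] at h
  exact h

end GlidingHump

end CZero

/-- `c₀` is prime: every infinite-dimensional complemented closed subspace of `c₀` is
topologically isomorphic to `c₀`. -/
theorem c0_is_prime
    (M : Submodule ℝ (ZeroAtInftyContinuousMap ℕ ℝ))
    (hclosed : IsClosed (M : Set (ZeroAtInftyContinuousMap ℕ ℝ)))
    (hinf : ¬ FiniteDimensional ℝ M) (hcompl : M.ClosedComplemented) :
    Nonempty (M ≃L[ℝ] ZeroAtInftyContinuousMap ℕ ℝ) := by
  have : CompleteSpace M := hclosed.completeSpace_coe
  obtain ⟨P, hP⟩ := hcompl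
  have hPM : Function.RightInverse M.subtypeL P := hP
  obtain ⟨A, B, hBA⟩ := CZero.exists_rightInverse M hinf
  exact CZero.nonempty_equiv_of_rightInverse (X := c₀(ℝ)) (M := M) (CZero.flattenEquiv ℝ)
    (P := P) (i := M.subtypeL) hPM
    (B := B) (A := A) hBA
end
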